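/- Let u be Oleinik's global solution of the steady Prandtl system with favorable pressure, and assume its Von Mises transform w is an Oleinik solution on [0,X] for every X > 0. Then for any positive integers k, m and any constants 0 < ε < X and Y > 0, there exists a constant C > 0, depending only on ε, X, Y, the data, p, k and m, such that |∂ₓ^k ∂_y^m u(x,y)| ≤ C for all (x,y) ∈ [ε,X]×[0,Y]. -/

import Mathlib

open Set

/-- Iterated partial derivative `∂ₓ^k ∂_ψ^m w` of a function of two real variables. -/
noncomputable def pd (k m : ℕ) (w : ℝ → ℝ → ℝ) (x ψ : ℝ) : ℝ :=
  iteratedDeriv k (fun x' => iteratedDeriv m (w x') ψ) x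

/-- Von Mises formulation of the steady Prandtl equation with favorable pressure:
`w` is an Oleinik solution on `[0,X]` with structural constants `α, m, M, C₀, δ₁`. -/
structure OleinikSolution (X : ℝ) (p : ℝ → ℝ) (w : ℝ → ℝ → ℝ)
    (α m M C₀ δ₁ : ℝ) : Prop where
  hX : 0 < X
  hp : ContDiff ℝ (⊤ : ℕ∞) p
  hfav : ∀ x : ℝ, deriv p x ≤ 0
  hα : α ∈ Set.Ioo (0 : ℝ) (1 / 2)
  hm : 0 < m
  hmM : m < M
  hC₀ : 0 < C₀
  hδ₁ : δ₁ ∈ Set.Ioo (0 : ℝ) 1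
  cont : ContinuousOn (fun z : ℝ × ℝ => w z.1 z.2) (Set.Icc 0 X ×ˢ Set.Ici 0)
  smooth : ContDiffOn ℝ (⊤ : ℕ∞) (fun z : ℝ × ℝ => w z.1 z.2) (Set.Ioc 0 X ×ˢ Set.Ioi 0)
  bdry : ∀ x ∈ Set.Icc (0 : ℝ) X, w x 0 = 0
  eqn : ∀ x ∈ Set.Ioc (0 : ℝ) X, ∀ ψ ∈ Set.Ioi (0 : ℝ),
    pd 1 0 w x ψ - Real.sqrt (w x ψ) * pd 0 2 w x ψ = -2 * deriv p x
  slope_lb : ∀ x ∈ Set.Icc (0 : ℝ) X, ∀ ψ ∈ Set.Icc (0 : ℝ) δ₁, m < pd 0 1 w x ψ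
  slope_ub : ∀ x ∈ Set.Icc (0 : ℝ) X, ∀ ψ ∈ Set.Icc (0 : ℝ) δ₁, pd 0 1 w x ψ < M
  growth_lb : ∀ x ∈ Set.Icc (0 : ℝ) X, ∀ ψ ∈ Set.Ioc (0 : ℝ) δ₁, m * ψ < w x ψ
  growth_ub : ∀ x ∈ Set.Icc (0 : ℝ) X, ∀ ψ ∈ Set.Ioc (0 : ℝ) δ₁, w x ψ < M * ψ
  dx_bound : ∀ x ∈ Set.Icc (0 : ℝ) X, ∀ ψ ∈ Set.Icc (0 : ℝ) δ₁,
    |pd 1 0 w x ψ| ≤ C₀ * ψ ^ ((1 : ℝ) / 2 + α)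

/-- The steady Prandtl system with favorable pressure: `u, v` solve the boundary
layer equations on `[0,∞) × [0,∞)` with outer flow `(U, p)` satisfying Bernoulli's
law, `U(0) > 0` and `p' ≤ 0`. -/
structure PrandtlSolution (U p : ℝ → ℝ) (u v : ℝ → ℝ → ℝ) : Prop where
  hU : ContDiff ℝ (⊤ : ℕ∞) U
  hp : ContDiff ℝ (⊤ : ℕ∞) p
  bernoulli : ∀ x : ℝ, U x * deriv U x + deriv p x = 0
  hU0 : 0 < U 0
  hfav : ∀ x : ℝ, deriv p x ≤ 0
  cont_u : ContinuousOn (fun z : ℝ × ℝ => u z.1 z.2) (Set.Ici 0 ×ˢ Set.Ici 0)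
  cont_uy : ContinuousOn (fun z : ℝ × ℝ => pd 0 1 u z.1 z.2) (Set.Ici 0 ×ˢ Set.Ici 0)
  cont_uyy : ContinuousOn (fun z : ℝ × ℝ => pd 0 2 u z.1 z.2) (Set.Ici 0 ×ˢ Set.Ici 0)
  smooth : ContDiffOn ℝ (⊤ : ℕ∞) (fun z : ℝ × ℝ => u z.1 z.2) (Set.Ioi 0 ×ˢ Set.Ioi 0)
  eqn : ∀ x ∈ Set.Ioi (0 : ℝ), ∀ y ∈ Set.Ioi (0 : ℝ),
    u x y * pd 1 0 u x y + v x y * pd 0 1 u x y - pd 0 2 u x y = -(deriv p x)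
  div : ∀ x ∈ Set.Ioi (0 : ℝ), ∀ y ∈ Set.Ioi (0 : ℝ),
    pd 1 0 u x y + pd 0 1 v x y = 0
  bc_u : ∀ x ∈ Set.Ici (0 : ℝ), u x 0 = 0
  bc_v : ∀ x ∈ Set.Ici (0 : ℝ), v x 0 = 0
  outer : ∀ x ∈ Set.Ici (0 : ℝ), Filter.Tendsto (u x) Filter.atTop (nhds (U x))
  pos : ∀ x ∈ Set.Ici (0 : ℝ), ∀ y ∈ Set.Ioi (0 : ℝ), 0 < u x y

set_option linter.unusedVariables false

noncomputable def Dx (g : ℝ × ℝ → ℝ) : ℝ × ℝ → ℝ := fun z => fderiv ℝ g z (1, 0)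
noncomputable def Dy (g : ℝ × ℝ → ℝ) : ℝ × ℝ → ℝ := fun z => fderiv ℝ g z (0, 1)
def Om (T d : ℝ) : Set (ℝ × ℝ) := Ioo 0 T ×ˢ Ioo 0 d
def Sm (T d : ℝ) (g : ℝ × ℝ → ℝ) : Prop := ContDiffOn ℝ (⊤ : ℕ∞) g (Om T d)

lemma isOpen_Om (T d : ℝ) : IsOpen (Om T d) := isOpen_Ioo.prod isOpen_Ioo

section
variable {T d : ℝ} {g h : ℝ × ℝ → ℝ} {z : ℝ × ℝ}

lemma Sm.cdAt (hg : Sm T d g) (hz : z ∈ Om T d) : ContDiffAt ℝ (⊤ : ℕ∞) g z :=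
  hg.contDiffAt ((isOpen_Om T d).mem_nhds hz)

lemma Sm.da (hg : Sm T d g) (hz : z ∈ Om T d) : DifferentiableAt ℝ g z :=
  (hg.cdAt hz).differentiableAt (by simp)

lemma Sm.ct (hg : Sm T d g) : ContinuousOn g (Om T d) := ContDiffOn.continuousOn hg

lemma Sm.mono {T' d' : ℝ} (hg : Sm T d g) (hT : T' ≤ T) (hd : d' ≤ d) : Sm T' d' g :=
  ContDiffOn.mono hg (prod_mono (Ioo_subset_Ioo le_rfl hT) (Ioo_subset_Ioo le_rfl hd))

lemma Sm.fd (hg : Sm T d g) : ContDiffOn ℝ (⊤ : ℕ∞) (fderiv ℝ g) (Om T d) :=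
  ContDiffOn.fderiv_of_isOpen hg (isOpen_Om T d) (by simp)

lemma Sm.dx (hg : Sm T d g) : Sm T d (Dx g) := hg.fd.clm_apply contDiffOn_const
lemma Sm.dy (hg : Sm T d g) : Sm T d (Dy g) := hg.fd.clm_apply contDiffOn_const
lemma Sm.add (hg : Sm T d g) (hh : Sm T d h) : Sm T d (fun z => g z + h z) := ContDiffOn.add hg hh
lemma Sm.sub (hg : Sm T d g) (hh : Sm T d h) : Sm T d (fun z => g z - h z) := ContDiffOn.sub hg hh
lemma Sm.mul (hg : Sm T d g) (hh : Sm T d h) : Sm T d (fun z => g z * h z) := ContDiffOn.mul hg hh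
lemma Sm.neg (hg : Sm T d g) : Sm T d (fun z => - g z) := ContDiffOn.neg hg
lemma Sm.div (hg : Sm T d g) (hh : Sm T d h) (h0 : ∀ z ∈ Om T d, h z ≠ 0) :
    Sm T d (fun z => g z / h z) := ContDiffOn.div hg hh h0
lemma Sm.sqrt (hg : Sm T d g) (h0 : ∀ z ∈ Om T d, g z ≠ 0) :
    Sm T d (fun z => Real.sqrt (g z)) := ContDiffOn.sqrt hg h0
lemma Sm.const (c : ℝ) : Sm T d (fun _ => c) := contDiffOn_const
lemma Sm.fst {q : ℝ → ℝ} (hq : ContDiff ℝ (⊤ : ℕ∞) q) : Sm T d (fun z => q z.1) :=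
  (hq.comp contDiff_fst).contDiffOn
lemma Sm.snd {q : ℝ → ℝ} (hq : ContDiff ℝ (⊤ : ℕ∞) q) : Sm T d (fun z => q z.2) :=
  (hq.comp contDiff_snd).contDiffOn
lemma Sm.congr (hg : Sm T d g) (h1 : EqOn h g (Om T d)) : Sm T d h := ContDiffOn.congr hg h1

lemma hasDx (hg : DifferentiableAt ℝ g z) : HasDerivAt (fun t => g (t, z.2)) (Dx g z) z.1 := by
  have h1 : HasDerivAt (fun t : ℝ => (t, z.2)) ((1 : ℝ), (0 : ℝ)) z.1 :=
    (hasDerivAt_id z.1).prodMk (hasDerivAt_const _ _)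
  exact HasFDerivAt.comp_hasDerivAt z.1 (f := fun t : ℝ => (t, z.2)) hg.hasFDerivAt h1

lemma hasDy (hg : DifferentiableAt ℝ g z) : HasDerivAt (fun t => g (z.1, t)) (Dy g z) z.2 := by
  have h1 : HasDerivAt (fun t : ℝ => (z.1, t)) ((0 : ℝ), (1 : ℝ)) z.2 :=
    (hasDerivAt_const _ _).prodMk (hasDerivAt_id z.2)
  exact HasFDerivAt.comp_hasDerivAt z.2 (f := fun t : ℝ => (z.1, t)) hg.hasFDerivAt h1

lemma Dx_eq {c : ℝ} (hg : DifferentiableAt ℝ g z) (h : HasDerivAt (fun t => g (t, z.2)) c z.1) :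
    Dx g z = c := (hasDx hg).unique h
lemma Dy_eq {c : ℝ} (hg : DifferentiableAt ℝ g z) (h : HasDerivAt (fun t => g (z.1, t)) c z.2) :
    Dy g z = c := (hasDy hg).unique h

lemma Dx_congr (h1 : EqOn g h (Om T d)) : EqOn (Dx g) (Dx h) (Om T d) := fun z hz => by
  unfold Dx
  rw [Filter.EventuallyEq.fderiv_eq (h1.eventuallyEq_of_mem ((isOpen_Om T d).mem_nhds hz))]
lemma Dy_congr (h1 : EqOn g h (Om T d)) : EqOn (Dy g) (Dy h) (Om T d) := fun z hz => by
  unfold Dy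
  rw [Filter.EventuallyEq.fderiv_eq (h1.eventuallyEq_of_mem ((isOpen_Om T d).mem_nhds hz))]

lemma Dx_add (hg : Sm T d g) (hh : Sm T d h) :
    EqOn (Dx (fun z => g z + h z)) (fun z => Dx g z + Dx h z) (Om T d) := fun z hz =>
  Dx_eq ((hg.add hh).da hz) ((hasDx (hg.da hz)).add (hasDx (hh.da hz)))
lemma Dy_add (hg : Sm T d g) (hh : Sm T d h) :
    EqOn (Dy (fun z => g z + h z)) (fun z => Dy g z + Dy h z) (Om T d) := fun z hz =>
  Dy_eq ((hg.add hh).da hz) ((hasDy (hg.da hz)).add (hasDy (hh.da hz)))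
lemma Dx_mul (hg : Sm T d g) (hh : Sm T d h) :
    EqOn (Dx (fun z => g z * h z)) (fun z => Dx g z * h z + g z * Dx h z) (Om T d) := fun z hz =>
  Dx_eq ((hg.mul hh).da hz) ((hasDx (hg.da hz)).mul (hasDx (hh.da hz)))
lemma Dy_mul (hg : Sm T d g) (hh : Sm T d h) :
    EqOn (Dy (fun z => g z * h z)) (fun z => Dy g z * h z + g z * Dy h z) (Om T d) := fun z hz =>
  Dy_eq ((hg.mul hh).da hz) ((hasDy (hg.da hz)).mul (hasDy (hh.da hz)))
lemma Dx_sub (hg : Sm T d g) (hh : Sm T d h) :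
    EqOn (Dx (fun z => g z - h z)) (fun z => Dx g z - Dx h z) (Om T d) := fun z hz =>
  Dx_eq ((hg.sub hh).da hz) ((hasDx (hg.da hz)).sub (hasDx (hh.da hz)))
lemma Dy_sub (hg : Sm T d g) (hh : Sm T d h) :
    EqOn (Dy (fun z => g z - h z)) (fun z => Dy g z - Dy h z) (Om T d) := fun z hz =>
  Dy_eq ((hg.sub hh).da hz) ((hasDy (hg.da hz)).sub (hasDy (hh.da hz)))
lemma Dx_neg (hg : Sm T d g) :
    EqOn (Dx (fun z => - g z)) (fun z => - Dx g z) (Om T d) := fun z hz =>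
  Dx_eq (hg.neg.da hz) (hasDx (hg.da hz)).neg
lemma Dy_neg (hg : Sm T d g) :
    EqOn (Dy (fun z => - g z)) (fun z => - Dy g z) (Om T d) := fun z hz =>
  Dy_eq (hg.neg.da hz) (hasDy (hg.da hz)).neg
lemma Dx_div (hg : Sm T d g) (hh : Sm T d h) (h0 : ∀ z ∈ Om T d, h z ≠ 0) :
    EqOn (Dx (fun z => g z / h z)) (fun z => (Dx g z * h z - g z * Dx h z) / h z ^ 2) (Om T d) :=
  fun z hz => Dx_eq ((hg.div hh h0).da hz) ((hasDx (hg.da hz)).div (hasDx (hh.da hz)) (h0 z hz))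
lemma Dy_div (hg : Sm T d g) (hh : Sm T d h) (h0 : ∀ z ∈ Om T d, h z ≠ 0) :
    EqOn (Dy (fun z => g z / h z)) (fun z => (Dy g z * h z - g z * Dy h z) / h z ^ 2) (Om T d) :=
  fun z hz => Dy_eq ((hg.div hh h0).da hz) ((hasDy (hg.da hz)).div (hasDy (hh.da hz)) (h0 z hz))
lemma Dx_sqrt (hg : Sm T d g) (h0 : ∀ z ∈ Om T d, g z ≠ 0) :
    EqOn (Dx (fun z => Real.sqrt (g z))) (fun z => Dx g z / (2 * Real.sqrt (g z))) (Om T d) :=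
  fun z hz => Dx_eq ((hg.sqrt h0).da hz) ((hasDx (hg.da hz)).sqrt (h0 z hz))
lemma Dy_sqrt (hg : Sm T d g) (h0 : ∀ z ∈ Om T d, g z ≠ 0) :
    EqOn (Dy (fun z => Real.sqrt (g z))) (fun z => Dy g z / (2 * Real.sqrt (g z))) (Om T d) :=
  fun z hz => Dy_eq ((hg.sqrt h0).da hz) ((hasDy (hg.da hz)).sqrt (h0 z hz))
lemma Dx_fst {q : ℝ → ℝ} (hq : ContDiff ℝ (⊤ : ℕ∞) q) (z : ℝ × ℝ) :
    Dx (fun z => q z.1) z = deriv q z.1 :=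
  Dx_eq ((hq.comp contDiff_fst).differentiable (by simp) z)
    (hq.differentiable (by simp) z.1).hasDerivAt
lemma Dy_fst {q : ℝ → ℝ} (hq : ContDiff ℝ (⊤ : ℕ∞) q) (z : ℝ × ℝ) :
    Dy (fun z => q z.1) z = 0 :=
  Dy_eq ((hq.comp contDiff_fst).differentiable (by simp) z) (hasDerivAt_const z.2 (q z.1))
lemma Dx_snd {q : ℝ → ℝ} (hq : ContDiff ℝ (⊤ : ℕ∞) q) (z : ℝ × ℝ) :
    Dx (fun z => q z.2) z = 0 :=
  Dx_eq ((hq.comp contDiff_snd).differentiable (by simp) z) (hasDerivAt_const z.1 (q z.2))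
lemma Dy_snd {q : ℝ → ℝ} (hq : ContDiff ℝ (⊤ : ℕ∞) q) (z : ℝ × ℝ) :
    Dy (fun z => q z.2) z = deriv q z.2 :=
  Dy_eq ((hq.comp contDiff_snd).differentiable (by simp) z)
    (hq.differentiable (by simp) z.2).hasDerivAt
lemma Dx_const (c : ℝ) (z : ℝ × ℝ) : Dx (fun _ => c) z = 0 := by simp [Dx]
lemma Dy_const (c : ℝ) (z : ℝ × ℝ) : Dy (fun _ => c) z = 0 := by simp [Dy]

lemma Dxy_comm (hg : Sm T d g) : EqOn (Dx (Dy g)) (Dy (Dx g)) (Om T d) := fun z hz => by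
  have hs : IsSymmSndFDerivAt ℝ g z := (hg.cdAt hz).isSymmSndFDerivAt (by
    simp only [minSmoothness_of_isRCLikeNormedField]; exact WithTop.coe_le_coe.2 (le_top : (2 : ℕ∞) ≤ ⊤))
  have hd : DifferentiableAt ℝ (fderiv ℝ g) z :=
    ((hg.fd.contDiffAt ((isOpen_Om T d).mem_nhds hz)).differentiableAt (by simp))
  have e1 : ∀ v : ℝ × ℝ, fderiv ℝ (fun y => fderiv ℝ g y v) z = (fderiv ℝ (fderiv ℝ g) z).flip v := by
    intro v
    rw [fderiv_clm_apply hd (differentiableAt_const v)]; simp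
  unfold Dx Dy
  rw [e1, e1]
  simpa using hs.eq (1, 0) (0, 1)
end

lemma deriv_nonneg_of_left_max {f : ℝ → ℝ} {f' x s : ℝ} (hs : s < x) (h : HasDerivAt f f' x)
    (hm : ∀ t ∈ Ioo s x, f t ≤ f x) : 0 ≤ f' := by
  have h1 : HasDerivWithinAt f f' (Iio x) x := h.hasDerivWithinAt
  rw [hasDerivWithinAt_iff_tendsto_slope' (by simp)] at h1
  refine ge_of_tendsto h1 ?_
  have : Ioo s x ∈ nhdsWithin x (Iio x) := Ioo_mem_nhdsLT hs
  filter_upwards [this] with t ht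
  rw [slope_def_field]
  exact div_nonneg_of_nonpos (by linarith [hm t ht]) (by linarith [ht.2])

lemma second_deriv_nonpos {g g1 : ℝ → ℝ} {g2 y l r : ℝ} (hy : y ∈ Ioo l r)
    (h1 : ∀ t ∈ Ioo l r, HasDerivAt g (g1 t) t) (h2 : HasDerivAt g1 g2 y)
    (hm : ∀ t ∈ Ioo l r, g t ≤ g y) : g2 ≤ 0 := by
  by_contra hc
  push Not at hc
  have hn : Ioo l r ∈ nhds y := Ioo_mem_nhds hy.1 hy.2
  have hmax : IsLocalMax g y := by filter_upwards [hn] with t ht using hm t ht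
  have hd : deriv g =ᶠ[nhds y] g1 := by
    filter_upwards [hn] with t ht using (h1 t ht).deriv
  have hdd : deriv (deriv g) y = g2 := by rw [hd.deriv_eq]; exact h2.deriv
  have hmin : IsLocalMin g y := isLocalMin_of_deriv_deriv_pos (by rw [hdd]; exact hc)
    hmax.deriv_eq_zero (h1 y hy).continuousAt
  have hcst : g =ᶠ[nhds y] fun _ => g y := by
    filter_upwards [hmax, hmin] with t h3 h4 using le_antisymm h3 h4
  have e0 : deriv g =ᶠ[nhds y] fun _ => 0 := by
    have := hcst.deriv
    simpa using this
  have : deriv (deriv g) y = 0 := by rw [e0.deriv_eq]; simp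
  linarith

set_option maxHeartbeats 1000000 in
/-- Bernstein, top level algebra. -/
lemma bern1 {A Z ζ d v a k G Gx Gp Gpp : ℝ} (hA : 1 ≤ A) (hζ : 0 ≤ ζ) (hζZ : ζ ≤ Z)
    (hd : 0 < d) (hd1 : d ≤ 1) (hv : 0 < v) (hv1 : v ≤ 1) (ha : d ≤ A * a) (ha' : a ≤ A) (hk : 0 ≤ k)
    (h : |Gx - a * Gpp| * v ≤ A * (1 + |G| + |Gp|)) :
    v ^ 2 * (ζ * d ^ 2 * G ^ 2 + ζ ^ 2 * d ^ 2 * G * (Gx - a * Gpp)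
      - a * ζ ^ 2 * (d ^ 2 * Gp ^ 2 + 4 * (k + 1) * d * G * Gp + (k + 1) * (2 * k + 1) * G ^ 2))
    ≤ (Z + 2 * Z ^ 2 * A + A ^ 3 * Z ^ 2 / 2 + 8 * (k + 1) ^ 2 * A * Z ^ 2) * (G ^ 2 + 1) := by
  have hA0 : 0 < A := by linarith
  have ha0 : 0 < a := by
    by_contra hc
    push Not at hc
    nlinarith
  have hZ : 0 ≤ Z := hζ.trans hζZ
  have hd2 : d ^ 2 ≤ 1 := pow_le_one₀ hd.le hd1
  have hv2 : v ^ 2 ≤ 1 := pow_le_one₀ hv.le hv1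
  have hζ2 : ζ ^ 2 ≤ Z ^ 2 := pow_le_pow_left₀ hζ hζZ 2
  -- term 1
  have t1 : v ^ 2 * (ζ * d ^ 2 * G ^ 2) ≤ Z * G ^ 2 := by
    have : v ^ 2 * (ζ * d ^ 2) ≤ 1 * (Z * 1) := by gcongr
    nlinarith [sq_nonneg G]
  -- term 2
  have t2 : v ^ 2 * (ζ ^ 2 * d ^ 2 * G * (Gx - a * Gpp)) ≤
      ζ ^ 2 * d ^ 2 * v * (A * (|G| + G ^ 2 + |G| * |Gp|)) := by
    have e1 : G * (Gx - a * Gpp) ≤ |G| * |Gx - a * Gpp| := by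
      rw [← abs_mul]; exact le_abs_self _
    have e2 : |G| * |Gx - a * Gpp| * v ≤ |G| * (A * (1 + |G| + |Gp|)) := by
      rw [mul_assoc]; exact mul_le_mul_of_nonneg_left h (abs_nonneg _)
    have e3 : |G| * (A * (1 + |G| + |Gp|)) = A * (|G| + G ^ 2 + |G| * |Gp|) := by
      rw [← sq_abs G]; ring
    have e4 : 0 ≤ ζ ^ 2 * d ^ 2 * v := by positivity
    have e5 : G * (Gx - a * Gpp) * v ≤ |G| * |Gx - a * Gpp| * v :=
      mul_le_mul_of_nonneg_right e1 hv.le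
    calc v ^ 2 * (ζ ^ 2 * d ^ 2 * G * (Gx - a * Gpp))
        = ζ ^ 2 * d ^ 2 * v * (G * (Gx - a * Gpp) * v) := by ring
      _ ≤ _ := by
        apply mul_le_mul_of_nonneg_left _ e4
        linarith
  have t3 : ζ ^ 2 * d ^ 2 * v * (A * (|G| + G ^ 2)) ≤ 2 * Z ^ 2 * A * (G ^ 2 + 1) := by
    have e1 : |G| ≤ G ^ 2 + 1 := by rw [← sq_abs G]; nlinarith [sq_nonneg (|G| - 1), abs_nonneg G]
    have e2 : ζ ^ 2 * d ^ 2 * v ≤ Z ^ 2 * 1 * 1 := by gcongr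
    have e3 : A * (|G| + G ^ 2) ≤ A * (2 * (G ^ 2 + 1)) := by
      apply mul_le_mul_of_nonneg_left _ hA0.le; nlinarith
    calc _ ≤ (Z ^ 2 * 1 * 1) * (A * (2 * (G ^ 2 + 1))) := by
          apply mul_le_mul e2 e3 (by positivity) (by positivity)
      _ = _ := by ring
  have key : ∀ P Q : ℝ, P * Q ≤ a / 2 * Q ^ 2 + P ^ 2 / (2 * a) := by
    intro P Q
    have : a / 2 * Q ^ 2 + P ^ 2 / (2 * a) - P * Q = (a * Q - P) ^ 2 / (2 * a) := by
      field_simp; ring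
    have : 0 ≤ (a * Q - P) ^ 2 / (2 * a) := by positivity
    linarith
  have t4 : ζ ^ 2 * d ^ 2 * v * (A * (|G| * |Gp|)) ≤
      a / 2 * (v ^ 2 * ζ ^ 2 * d ^ 2 * Gp ^ 2) + A ^ 3 * Z ^ 2 / 2 * G ^ 2 := by
    have e1 := key (A * |G|) (v * |Gp|)
    have e2 : d ^ 2 * ((A * |G|) ^ 2 / (2 * a)) ≤ A ^ 3 / 2 * G ^ 2 := by
      rw [mul_pow, sq_abs, mul_div_assoc', div_le_iff₀ (by positivity)]
      have : d ^ 2 ≤ A * a := by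
        have : d ^ 2 ≤ d := by nlinarith only [hd, hd1]
        linarith
      linarith [mul_le_mul_of_nonneg_right this (show 0 ≤ A ^ 2 * G ^ 2 by positivity)]
    have e3 : ζ ^ 2 * (d ^ 2 * ((A * |G|) ^ 2 / (2 * a))) ≤ Z ^ 2 * (A ^ 3 / 2 * G ^ 2) := by
      apply mul_le_mul hζ2 e2 (by positivity) (by positivity)
    have e4 := mul_le_mul_of_nonneg_left e1 (show 0 ≤ ζ ^ 2 * d ^ 2 by positivity)
    rw [mul_pow v, sq_abs] at e4
    linarith
  have t5 : - (v ^ 2 * (a * ζ ^ 2 * (4 * (k + 1) * d * G * Gp))) ≤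
      a / 2 * (v ^ 2 * ζ ^ 2 * d ^ 2 * Gp ^ 2) + 8 * (k + 1) ^ 2 * A * Z ^ 2 * G ^ 2 := by
    have e1 : - (4 * (k + 1) * d * G * Gp) ≤ 1 / 2 * (d ^ 2 * Gp ^ 2) + 8 * (k + 1) ^ 2 * G ^ 2 := by
      nlinarith [sq_nonneg (d * Gp + 4 * (k + 1) * G)]
    have e2 : v ^ 2 * (a * ζ ^ 2) ≤ 1 * (A * Z ^ 2) := by gcongr
    have e3 := mul_le_mul_of_nonneg_left e1 (show 0 ≤ v ^ 2 * (a * ζ ^ 2) by positivity)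
    have e4 := mul_le_mul_of_nonneg_right e2 (show 0 ≤ 8 * (k + 1) ^ 2 * G ^ 2 by positivity)
    linarith
  have t6 : 0 ≤ v ^ 2 * (a * ζ ^ 2 * ((k + 1) * (2 * k + 1) * G ^ 2)) := by positivity
  have t7 : 0 ≤ Z + A ^ 3 * Z ^ 2 / 2 + 8 * (k + 1) ^ 2 * A * Z ^ 2 := by positivity
  linarith

set_option maxHeartbeats 1000000 in
lemma bern2 {A d v a j G R Rx Rp Rpp : ℝ} (hA : 1 ≤ A)
    (hd : 0 < d) (hd1 : d ≤ 1) (hv : 0 < v) (hv1 : v ≤ 1) (ha : d ≤ A * a) (ha' : a ≤ A) (hj : 0 ≤ j)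
    (hR : |R| * v ≤ A) (h : |Rx - a * Rpp| * v ≤ A * (1 + |Rp|)) (hG : |G| * v ≤ A * (1 + |Rp|)) :
    v ^ 4 * (d ^ 2 * R * (Rx - a * Rpp)
      - a * (d ^ 2 * Rp ^ 2 + 4 * (j + 1) * d * R * Rp + (j + 1) * (2 * j + 1) * R ^ 2))
    ≤ - (1 / (8 * A ^ 3)) * (v ^ 6 * d ^ 3 * G ^ 2) +
      (A ^ 2 + A ^ 5 + 8 * (j + 1) ^ 2 * A ^ 3 + 1) := by
  have hA0 : 0 < A := by linarith
  have ha0 : 0 < a := by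
    by_contra hc
    push Not at hc
    nlinarith
  have hd2 : d ^ 2 ≤ 1 := pow_le_one₀ hd.le hd1
  have hv2 : v ^ 2 ≤ 1 := pow_le_one₀ hv.le hv1
  have key : ∀ P Q : ℝ, P * Q ≤ a / 4 * Q ^ 2 + P ^ 2 / a := by
    intro P Q
    have : a / 4 * Q ^ 2 + P ^ 2 / a - P * Q = (a * Q - 2 * P) ^ 2 / (4 * a) := by
      field_simp; ring
    have : 0 ≤ (a * Q - 2 * P) ^ 2 / (4 * a) := by positivity
    linarith
  have hRv : R ^ 2 * v ^ 2 ≤ A ^ 2 := by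
    have := pow_le_pow_left₀ (by positivity) hR 2
    rwa [mul_pow, sq_abs] at this
  have t1 : v ^ 4 * (d ^ 2 * R * (Rx - a * Rpp)) ≤ v ^ 2 * d ^ 2 * (A ^ 2 * (1 + |Rp|)) := by
    have e1 : R * (Rx - a * Rpp) ≤ |R| * |Rx - a * Rpp| := by
      rw [← abs_mul]; exact le_abs_self _
    have e2 : (|R| * v) * (|Rx - a * Rpp| * v) ≤ A * (A * (1 + |Rp|)) :=
      mul_le_mul hR h (by positivity) (by positivity)
    calc _ = v ^ 2 * d ^ 2 * (v ^ 2 * (R * (Rx - a * Rpp))) := by ring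
      _ ≤ _ := by
        apply mul_le_mul_of_nonneg_left _ (by positivity)
        have := mul_le_mul_of_nonneg_left e1 (show 0 ≤ v ^ 2 by positivity)
        linarith
  have t2 : v ^ 2 * d ^ 2 * (A ^ 2 * (1 + |Rp|)) ≤
      A ^ 2 + a / 4 * (v ^ 4 * d ^ 2 * Rp ^ 2) + A ^ 5 := by
    have e1 := key (A ^ 2) (v ^ 2 * |Rp|)
    have e2 : v ^ 2 * d ^ 2 * A ^ 2 ≤ 1 * 1 * A ^ 2 := by gcongr
    have e3 : d ^ 2 * ((A ^ 2) ^ 2 / a) ≤ A ^ 5 := by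
      rw [mul_div_assoc', div_le_iff₀ ha0]
      have : d ^ 2 ≤ A * a := by
        have : d ^ 2 ≤ d := by nlinarith only [hd, hd1]
        linarith
      linarith [mul_le_mul_of_nonneg_right this (show 0 ≤ A ^ 4 by positivity)]
    have e4 := mul_le_mul_of_nonneg_left e1 (show 0 ≤ d ^ 2 by positivity)
    rw [mul_pow (v ^ 2), sq_abs] at e4
    linarith
  have t3 : - (v ^ 4 * (a * (4 * (j + 1) * d * R * Rp))) ≤
      a / 2 * (v ^ 4 * d ^ 2 * Rp ^ 2) + 8 * (j + 1) ^ 2 * A ^ 3 := by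
    have e1 : - (4 * (j + 1) * d * R * Rp) ≤ 1 / 2 * (d ^ 2 * Rp ^ 2) + 8 * (j + 1) ^ 2 * R ^ 2 := by
      nlinarith [sq_nonneg (d * Rp + 4 * (j + 1) * R)]
    have e3 := mul_le_mul_of_nonneg_left e1 (show 0 ≤ v ^ 4 * a by positivity)
    have e2 : v ^ 2 * a * (R ^ 2 * v ^ 2) ≤ 1 * A * A ^ 2 := by gcongr
    have e4 := mul_le_mul_of_nonneg_right e2 (show 0 ≤ 8 * (j + 1) ^ 2 by positivity)
    linarith
  have t4 : 0 ≤ v ^ 4 * (a * ((j + 1) * (2 * j + 1) * R ^ 2)) := by positivity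
  have t5 : v ^ 6 * d ^ 3 * G ^ 2 / (2 * A ^ 2) - 1 ≤ v ^ 4 * d ^ 3 * Rp ^ 2 := by
    have e1 : G ^ 2 * v ^ 2 ≤ A ^ 2 * (1 + |Rp|) ^ 2 := by
      have := pow_le_pow_left₀ (by positivity) hG 2
      rwa [mul_pow, sq_abs, mul_pow] at this
    have e2 : (1 + |Rp|) ^ 2 ≤ 2 * (1 + Rp ^ 2) := by
      rw [← sq_abs Rp]; nlinarith [sq_nonneg (1 - |Rp|)]
    have e3 : G ^ 2 * v ^ 2 / (2 * A ^ 2) ≤ 1 + Rp ^ 2 := by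
      rw [div_le_iff₀ (by positivity)]
      linarith [mul_le_mul_of_nonneg_left e2 (show 0 ≤ A ^ 2 by positivity)]
    have e4 := mul_le_mul_of_nonneg_left e3 (show 0 ≤ v ^ 4 * d ^ 3 by positivity)
    have e5 : v ^ 4 * d ^ 3 ≤ 1 := by
      have : v ^ 4 ≤ 1 := pow_le_one₀ hv.le hv1
      have : d ^ 3 ≤ 1 := pow_le_one₀ hd.le hd1
      exact mul_le_one₀ ‹_› (by positivity) ‹_›
    have e6 : v ^ 6 * d ^ 3 * G ^ 2 / (2 * A ^ 2) = v ^ 4 * d ^ 3 * (G ^ 2 * v ^ 2 / (2 * A ^ 2)) := by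
      ring
    rw [e6]; linarith
  have t6 : 1 / (4 * A) * (v ^ 4 * d ^ 3 * Rp ^ 2) ≤ a / 4 * (v ^ 4 * d ^ 2 * Rp ^ 2) := by
    have e1 : 1 / (4 * A) * d ≤ a / 4 := by
      rw [one_div, inv_mul_le_iff₀ (by positivity)]; linarith
    have := mul_le_mul_of_nonneg_right e1 (show 0 ≤ v ^ 4 * d ^ 2 * Rp ^ 2 by positivity)
    linarith
  have t7 : 1 / (4 * A) * (v ^ 6 * d ^ 3 * G ^ 2 / (2 * A ^ 2) - 1) ≤
      1 / (4 * A) * (v ^ 4 * d ^ 3 * Rp ^ 2) :=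
    mul_le_mul_of_nonneg_left t5 (by positivity)
  have t8 : 1 / (4 * A) * (v ^ 6 * d ^ 3 * G ^ 2 / (2 * A ^ 2) - 1) =
      1 / (8 * A ^ 3) * (v ^ 6 * d ^ 3 * G ^ 2) - 1 / (4 * A) := by
    field_simp; ring
  have t9 : 1 / (4 * A) ≤ 1 := by
    rw [div_le_one (by positivity)]; linarith
  linarith

lemma wpow_deriv {H Hp : ℝ → ℝ} {t σ : ℝ} (k : ℕ) (h : HasDerivAt H (Hp t) t) :
    HasDerivAt (fun t => (t - σ) ^ (2 * k + 2) * H t ^ 2)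
      ((2 * k + 2) * (t - σ) ^ (2 * k + 1) * H t ^ 2 + (t - σ) ^ (2 * k + 2) * (2 * (H t * Hp t))) t := by
  have h1 : HasDerivAt (fun t : ℝ => (t - σ) ^ (2 * k + 2))
      ((2 * k + 2) * (t - σ) ^ (2 * k + 1)) t := by
    have := ((hasDerivAt_id t).sub_const σ).fun_pow (2 * k + 2)
    simpa using this
  have h2 := h1.fun_mul (h.fun_pow 2)
  refine h2.congr_deriv ?_
  push_cast; ring

lemma wpow_deriv2 {H Hp : ℝ → ℝ} {Hpp t σ : ℝ} (k : ℕ) (h : HasDerivAt H (Hp t) t)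
    (h' : HasDerivAt Hp Hpp t) :
    HasDerivAt (fun t => (2 * k + 2) * (t - σ) ^ (2 * k + 1) * H t ^ 2 +
        (t - σ) ^ (2 * k + 2) * (2 * (H t * Hp t)))
      (2 * ((t - σ) ^ (2 * k) * ((t - σ) ^ 2 * Hp t ^ 2 + 4 * (k + 1) * (t - σ) * H t * Hp t
        + (k + 1) * (2 * k + 1) * H t ^ 2 + (t - σ) ^ 2 * H t * Hpp))) t := by
  have h1 : HasDerivAt (fun t : ℝ => (t - σ) ^ (2 * k + 2))
      ((2 * k + 2) * (t - σ) ^ (2 * k + 1)) t := by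
    have := ((hasDerivAt_id t).sub_const σ).fun_pow (2 * k + 2)
    simpa using this
  have h0 : HasDerivAt (fun t : ℝ => (t - σ) ^ (2 * k + 1))
      ((2 * k + 1) * (t - σ) ^ (2 * k)) t := by
    have := ((hasDerivAt_id t).sub_const σ).fun_pow (2 * k + 1)
    simpa using this
  have h2 := ((h0.const_mul (2 * (k : ℝ) + 2)).fun_mul (h.fun_pow 2)).fun_add (h1.fun_mul ((h.fun_mul h').const_mul 2))
  refine h2.congr_deriv ?_
  simp; ring

lemma mem_Om {T d x y : ℝ} (h1 : 0 < x) (h2 : x < T) (h3 : 0 < y) (h4 : y < d) : (x, y) ∈ Om T d :=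
  ⟨⟨h1, h2⟩, ⟨h3, h4⟩⟩

set_option maxHeartbeats 1000000 in
lemma bern_main {T d0 : ℝ} {a G R : ℝ × ℝ → ℝ} (hG : Sm T d0 G) (hR : Sm T d0 R)
    {b0 b c e A : ℝ} {N : ℕ} (hb0 : 0 < b0) (hb : b0 < b) (hc : c < T)
    (he : 0 < e) (hed : e < d0) (he1 : e ≤ 1) (hA : 1 ≤ A)
    (ha : ∀ x ∈ Icc b0 c, ∀ y ∈ Ioc 0 e, y ≤ A * a (x, y))
    (ha' : ∀ x ∈ Icc b0 c, ∀ y ∈ Ioc 0 e, a (x, y) ≤ A)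
    (hR0 : ∀ x ∈ Icc b0 c, ∀ y ∈ Ioc 0 e, |R (x, y)| * y ^ N ≤ A)
    (hR1 : ∀ x ∈ Icc b0 c, ∀ y ∈ Ioc 0 e,
      |Dx R (x, y) - a (x, y) * Dy (Dy R) (x, y)| * y ^ N ≤ A * (1 + |Dy R (x, y)|))
    (hG1 : ∀ x ∈ Icc b0 c, ∀ y ∈ Ioc 0 e,
      |Dx G (x, y) - a (x, y) * Dy (Dy G) (x, y)| * y ^ N ≤ A * (1 + |G (x, y)| + |Dy G (x, y)|))
    (hGR : ∀ x ∈ Icc b0 c, ∀ y ∈ Ioc 0 e, |G (x, y)| * y ^ N ≤ A * (1 + |Dy R (x, y)|)) :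
    ∃ C, ∀ x ∈ Icc b c, ∀ y ∈ Ioc 0 e, |G (x, y)| * y ^ (4 * N + 3) ≤ C := by
  have hA0 : 0 < A := by linarith
  by_cases hbc : b ≤ c
  swap
  · exact ⟨0, fun x hx => absurd (hx.1.trans hx.2) hbc⟩
  have hb0c : b0 < c := by linarith
  obtain ⟨Z, hZ⟩ : ∃ q : ℝ, q = c - b0 := ⟨_, rfl⟩
  have hZ0 : 0 < Z := by linarith
  -- bound at the top
  obtain ⟨Ge, hGe⟩ : ∃ Ge, ∀ x ∈ Icc b0 c, |G (x, e)| ≤ Ge := by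
    have hcont : ContinuousOn (fun x => G (x, e)) (Icc b0 c) := by
      refine hG.ct.comp (by fun_prop) ?_
      intro x hx
      exact mem_Om (by linarith [hx.1]) (by linarith [hx.2]) he hed
    obtain ⟨C, hC⟩ := isCompact_Icc.exists_bound_of_continuousOn hcont
    exact ⟨C, fun x hx => by simpa using hC x hx⟩
  obtain ⟨k, hk⟩ : ∃ q : ℕ, q = 4 * N + 2 := ⟨_, rfl⟩
  obtain ⟨j, hj⟩ : ∃ q : ℕ, q = 2 * N := ⟨_, rfl⟩
  obtain ⟨C1, hC1⟩ : ∃ q : ℝ, q = (Z + 2 * Z ^ 2 * A + A ^ 3 * Z ^ 2 / 2 + 8 * ((k : ℝ) + 1) ^ 2 * A * Z ^ 2) := ⟨_, rfl⟩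
  obtain ⟨C2, hC2⟩ : ∃ q : ℝ, q = (A ^ 2 + A ^ 5 + 8 * ((j : ℝ) + 1) ^ 2 * A ^ 3 + 1) := ⟨_, rfl⟩
  have hC1p : 0 < C1 := by rw [hC1]; positivity
  have hC2p : 0 < C2 := by rw [hC2]; positivity
  obtain ⟨B, hB⟩ : ∃ q : ℝ, q = 16 * A ^ 3 * C1 := ⟨_, rfl⟩
  have hBp : 0 < B := by rw [hB]; positivity
  obtain ⟨C5, hC5⟩ : ∃ q : ℝ, q = Z ^ 2 * (1 + 16 * A ^ 3 * C2) + Z ^ 2 * Ge ^ 2 + B * A ^ 2 := ⟨_, rfl⟩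
  have hC5p : 0 ≤ C5 := by rw [hC5]; positivity
  -- main estimate
  have main : ∀ σ : ℝ, 0 < σ → σ < e → ∀ x ∈ Icc b0 c, ∀ y ∈ Icc σ e,
      (x - b0) ^ 2 * ((y - σ) ^ (2 * k + 2) * G (x, y) ^ 2) +
        B * ((y - σ) ^ (2 * j + 2) * R (x, y) ^ 2) ≤ C5 := by
    intro σ hσ hσe
    set Q : ℝ × ℝ → ℝ := fun z => (z.1 - b0) ^ 2 * ((z.2 - σ) ^ (2 * k + 2) * G z ^ 2) +
        B * ((z.2 - σ) ^ (2 * j + 2) * R z ^ 2) with hQ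
    have hsub : Icc b0 c ×ˢ Icc σ e ⊆ Om T d0 := by
      rintro ⟨x, y⟩ ⟨hx, hy⟩
      exact mem_Om (by linarith [hx.1]) (by linarith [hx.2]) (by linarith [hy.1]) (by linarith [hy.2])
    have hQc : ContinuousOn Q (Icc b0 c ×ˢ Icc σ e) := by
      have := hG.ct.mono hsub
      have := hR.ct.mono hsub
      fun_prop
    obtain ⟨⟨x, y⟩, ⟨hx, hy⟩, hmax⟩ := (isCompact_Icc.prod isCompact_Icc).exists_isMaxOn
      ⟨(c, e), ⟨⟨hb0c.le, le_rfl⟩, ⟨hσe.le, le_rfl⟩⟩⟩ hQc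
    simp only at hx hy
    have hmax' : ∀ x' ∈ Icc b0 c, ∀ y' ∈ Icc σ e, (x' - b0) ^ 2 * ((y' - σ) ^ (2 * k + 2) * G (x', y') ^ 2) +
        B * ((y' - σ) ^ (2 * j + 2) * R (x', y') ^ 2) ≤
        (x - b0) ^ 2 * ((y - σ) ^ (2 * k + 2) * G (x, y) ^ 2) +
        B * ((y - σ) ^ (2 * j + 2) * R (x, y) ^ 2) := fun x' hx' y' hy' => hmax (show (x', y') ∈ Icc b0 c ×ˢ Icc σ e from ⟨hx', hy'⟩)
    clear hmax hQc hQ Q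
    suffices hs : (x - b0) ^ 2 * ((y - σ) ^ (2 * k + 2) * G (x, y) ^ 2) +
        B * ((y - σ) ^ (2 * j + 2) * R (x, y) ^ 2) ≤ C5 from fun x' hx' y' hy' => (hmax' x' hx' y' hy').trans hs
    have hy0 : 0 < y := by linarith [hy.1]
    have hye : y ∈ Ioc 0 e := ⟨hy0, hy.2⟩
    have hζ : 0 ≤ x - b0 := by linarith [hx.1]
    have hζZ : x - b0 ≤ Z := by linarith [hx.2]
    have hd0 : 0 ≤ y - σ := by linarith [hy.1]
    have hd1 : y - σ ≤ 1 := by linarith [hy.2]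
    have hdy : y - σ ≤ y := by linarith
    have hζ2 : (x - b0) ^ 2 ≤ Z ^ 2 := pow_le_pow_left₀ hζ hζZ 2
    have hvy : (y - σ) ^ N ≤ y ^ N := pow_le_pow_left₀ hd0 hdy N
    have hRv : |R (x, y)| * (y - σ) ^ N ≤ A :=
      (mul_le_mul_of_nonneg_left hvy (abs_nonneg _)).trans (hR0 x hx y hye)
    have hRterm : (y - σ) ^ (2 * j + 2) * R (x, y) ^ 2 ≤ A ^ 2 := by
      have e1 : (|R (x, y)| * (y - σ) ^ N) ^ 2 ≤ A ^ 2 := pow_le_pow_left₀ (by positivity) hRv 2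
      have e2 : (y - σ) ^ (2 * j + 2) ≤ (y - σ) ^ (N * 2) :=
        pow_le_pow_of_le_one hd0 hd1 (by omega)
      rw [mul_pow, sq_abs, ← pow_mul] at e1
      linarith [mul_le_mul_of_nonneg_right e2 (sq_nonneg (R (x, y)))]
    have hBR : B * ((y - σ) ^ (2 * j + 2) * R (x, y) ^ 2) ≤ B * A ^ 2 :=
      mul_le_mul_of_nonneg_left hRterm hBp.le
    suffices hs : (x - b0) ^ 2 * ((y - σ) ^ (2 * k + 2) * G (x, y) ^ 2) ≤
        Z ^ 2 * (1 + 16 * A ^ 3 * C2) + Z ^ 2 * Ge ^ 2 by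
      rw [hC5]; linarith
    have hpp1 : 0 ≤ Z ^ 2 * (1 + 16 * A ^ 3 * C2) := by positivity
    have hpp2 : 0 ≤ Z ^ 2 * Ge ^ 2 := by positivity
    rcases hx.1.eq_or_lt with hxb | hxb
    · rw [← hxb]; simp; linarith
    rcases hy.1.eq_or_lt with hyσ | hyσ
    · rw [← hyσ]; simp; linarith
    rcases hy.2.eq_or_lt with hye' | hye'
    · have e1 : G (x, y) ^ 2 ≤ Ge ^ 2 := by
        rw [← sq_abs, hye']; exact pow_le_pow_left₀ (abs_nonneg _) (hGe x hx) 2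
      have e2 : (y - σ) ^ (2 * k + 2) ≤ 1 := pow_le_one₀ hd0 hd1
      have e3 : (y - σ) ^ (2 * k + 2) * G (x, y) ^ 2 ≤ 1 * Ge ^ 2 :=
        mul_le_mul e2 e1 (by positivity) (by positivity)
      have e4 := mul_le_mul hζ2 e3 (by positivity) (by positivity)
      linarith
    -- interior maximum
    have hz : (x, y) ∈ Om T d0 := hsub ⟨hx, hy⟩
    have hd : 0 < y - σ := by linarith
    -- x derivative
    have hQx : 0 ≤ 2 * ((x - b0) * ((y - σ) ^ (2 * k + 2) * G (x, y) ^ 2)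
        + (x - b0) ^ 2 * ((y - σ) ^ (2 * k + 2) * (G (x, y) * Dx G (x, y)))
        + B * ((y - σ) ^ (2 * j + 2) * (R (x, y) * Dx R (x, y)))) := by
      have h1 : HasDerivAt (fun t => (t - b0) ^ 2 * ((y - σ) ^ (2 * k + 2) * G (t, y) ^ 2) +
        B * ((y - σ) ^ (2 * j + 2) * R (t, y) ^ 2)) (2 * ((x - b0) * ((y - σ) ^ (2 * k + 2) * G (x, y) ^ 2)
        + (x - b0) ^ 2 * ((y - σ) ^ (2 * k + 2) * (G (x, y) * Dx G (x, y)))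
        + B * ((y - σ) ^ (2 * j + 2) * (R (x, y) * Dx R (x, y))))) x := by
        have g1 := hasDx (hG.da hz)
        have g2 := hasDx (hR.da hz)
        simp only at g1 g2
        have g3 := ((((hasDerivAt_id x).sub_const b0).fun_pow 2).fun_mul
          ((g1.fun_pow 2).const_mul ((y - σ) ^ (2 * k + 2)))).fun_add
          (((g2.fun_pow 2).const_mul ((y - σ) ^ (2 * j + 2))).const_mul B)
        refine g3.congr_deriv ?_
        simp; ring
      refine deriv_nonneg_of_left_max hxb h1 ?_
      intro t ht
      exact hmax' t ⟨ht.1.le, ht.2.le.trans hx.2⟩ y hy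
    have hQpp : (x - b0) ^ 2 * (2 * ((y - σ) ^ (2 * k) * ((y - σ) ^ 2 * Dy G (x, y) ^ 2
          + 4 * (k + 1) * (y - σ) * G (x, y) * Dy G (x, y)
          + (k + 1) * (2 * k + 1) * G (x, y) ^ 2 + (y - σ) ^ 2 * G (x, y) * Dy (Dy G) (x, y))))
        + B * (2 * ((y - σ) ^ (2 * j) * ((y - σ) ^ 2 * Dy R (x, y) ^ 2
          + 4 * (j + 1) * (y - σ) * R (x, y) * Dy R (x, y)
          + (j + 1) * (2 * j + 1) * R (x, y) ^ 2 + (y - σ) ^ 2 * R (x, y) * Dy (Dy R) (x, y)))) ≤ 0 := by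
      have hin : ∀ t ∈ Ioo σ e, (x, t) ∈ Om T d0 := fun t ht => hsub ⟨hx, ht.1.le, ht.2.le⟩
      have hyo : y ∈ Ioo σ e := ⟨hyσ, hye'⟩
      refine second_deriv_nonpos (g := fun t => (x - b0) ^ 2 * ((t - σ) ^ (2 * k + 2) * G (x, t) ^ 2) +
        B * ((t - σ) ^ (2 * j + 2) * R (x, t) ^ 2)) hyo
        (fun t ht => ((wpow_deriv (H := fun t => G (x, t)) (Hp := fun t => Dy G (x, t)) k
          (hasDy (hG.da (hin t ht)))).const_mul ((x - b0) ^ 2)).add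
          ((wpow_deriv (H := fun t => R (x, t)) (Hp := fun t => Dy R (x, t)) j
          (hasDy (hR.da (hin t ht)))).const_mul B))
        (((wpow_deriv2 (H := fun t => G (x, t)) (Hp := fun t => Dy G (x, t)) k
          (hasDy (hG.da (hin y hyo))) (hasDy (hG.dy.da (hin y hyo)))).const_mul ((x - b0) ^ 2)).add
          ((wpow_deriv2 (H := fun t => R (x, t)) (Hp := fun t => Dy R (x, t)) j
          (hasDy (hR.da (hin y hyo))) (hasDy (hR.dy.da (hin y hyo)))).const_mul B)) ?_
      intro t ht
      exact hmax' x hx t ⟨ht.1.le, ht.2.le⟩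
    set δ := y - σ with hδ
    set ζ := x - b0 with hζdef
    have hv : 0 < δ ^ N := by positivity
    have hv1 : δ ^ N ≤ 1 := pow_le_one₀ hd0 hd1
    have haa : δ ≤ A * a (x, y) := hdy.trans (ha x hx y hye)
    have haa' := ha' x hx y hye
    have ha0 : 0 < a (x, y) := (mul_pos_iff_of_pos_left hA0).1 (lt_of_lt_of_le hd haa)
    have b1 := bern1 (k := (k : ℝ)) hA hζ hζZ hd hd1 hv hv1 haa haa' (by positivity)
      ((mul_le_mul_of_nonneg_left hvy (abs_nonneg _)).trans (hG1 x hx y hye))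
    have b2 := bern2 (j := (j : ℝ)) hA hd hd1 hv hv1 haa haa' (by positivity) hRv
      ((mul_le_mul_of_nonneg_left hvy (abs_nonneg _)).trans (hR1 x hx y hye))
      ((mul_le_mul_of_nonneg_left hvy (abs_nonneg _)).trans (hGR x hx y hye))
    rw [← hC1] at b1
    rw [← hC2] at b2
    have hcomb : 0 ≤ δ ^ (2 * k) * (ζ * δ ^ 2 * G (x, y) ^ 2
        + ζ ^ 2 * δ ^ 2 * G (x, y) * (Dx G (x, y) - a (x, y) * Dy (Dy G) (x, y))
        - a (x, y) * ζ ^ 2 * (δ ^ 2 * Dy G (x, y) ^ 2 + 4 * (k + 1) * δ * G (x, y) * Dy G (x, y)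
          + (k + 1) * (2 * k + 1) * G (x, y) ^ 2))
        + B * (δ ^ (2 * j) * (δ ^ 2 * R (x, y) * (Dx R (x, y) - a (x, y) * Dy (Dy R) (x, y))
        - a (x, y) * (δ ^ 2 * Dy R (x, y) ^ 2 + 4 * (j + 1) * δ * R (x, y) * Dy R (x, y)
          + (j + 1) * (2 * j + 1) * R (x, y) ^ 2))) := by
      have e1 := mul_le_mul_of_nonneg_left hQpp ha0.le
      rw [pow_add δ (2 * k) 2, pow_add δ (2 * j) 2] at hQx
      generalize δ ^ (2 * k) = X1 at *
      generalize δ ^ (2 * j) = X2 at *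
      linarith
    have ek : δ ^ (2 * k) = (δ ^ N) ^ 6 * δ ^ 4 * (δ ^ N) ^ 2 := by
      rw [hk]; ring
    have ej : δ ^ (2 * j) = (δ ^ N) ^ 4 := by
      rw [hj]; ring
    rw [ek, ej] at hcomb
    set v := δ ^ N with hvdef
    have c1 := mul_le_mul_of_nonneg_left b1 (show 0 ≤ v ^ 6 * δ ^ 4 by positivity)
    have c2 := mul_le_mul_of_nonneg_left b2 hBp.le
    have c3 : v ^ 6 * δ ^ 4 * (C1 * (G (x, y) ^ 2 + 1)) ≤ C1 * (v ^ 6 * δ ^ 3 * G (x, y) ^ 2) + C1 := by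
      have e1 : v ^ 6 * δ ^ 4 ≤ v ^ 6 * δ ^ 3 := by
        apply mul_le_mul_of_nonneg_left _ (by positivity)
        exact pow_le_pow_of_le_one hd0 hd1 (by norm_num)
      have e2 : v ^ 6 * δ ^ 4 ≤ 1 :=
        mul_le_one₀ (pow_le_one₀ hv.le hv1) (by positivity) (pow_le_one₀ hd0 hd1)
      have e3 := mul_le_mul_of_nonneg_right e1 (show 0 ≤ C1 * G (x, y) ^ 2 by positivity)
      have e4 := mul_le_mul_of_nonneg_right e2 hC1p.le
      linarith
    have c4 : B * (-(1 / (8 * A ^ 3)) * (v ^ 6 * δ ^ 3 * G (x, y) ^ 2) + C2) =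
        - (2 * C1) * (v ^ 6 * δ ^ 3 * G (x, y) ^ 2) + B * C2 := by
      rw [hB]; field_simp; ring
    have c5 : C1 * (v ^ 6 * δ ^ 3 * G (x, y) ^ 2) ≤ C1 * (1 + 16 * A ^ 3 * C2) := by
      rw [c4] at c2
      have : B * C2 = C1 * (16 * A ^ 3 * C2) := by rw [hB]; ring
      linarith
    have c6 := le_of_mul_le_mul_left c5 hC1p
    have e5 : δ ^ (2 * k + 2) ≤ v ^ 6 * δ ^ 3 := by
      rw [hvdef, ← pow_mul, ← pow_add]
      exact pow_le_pow_of_le_one hd0 hd1 (by omega)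
    have e6 := mul_le_mul_of_nonneg_right e5 (sq_nonneg (G (x, y)))
    have e7 := mul_le_mul hζ2 (e6.trans c6) (by positivity) (by positivity)
    linarith
  -- conclusion
  have hbb : 0 < b - b0 := by linarith
  refine ⟨2 ^ (4 * N + 3) * (Real.sqrt C5 / (b - b0)), ?_⟩
  intro x hx y hy
  have h1 := main (y / 2) (by linarith [hy.1]) (by linarith [hy.1, hy.2]) x
    ⟨by linarith [hx.1], hx.2⟩ y ⟨by linarith [hy.1], hy.2⟩
  have hyy : y - y / 2 = y / 2 := by ring
  rw [hyy] at h1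
  have hy2 : 0 < y / 2 := by linarith [hy.1]
  have h2 : 0 ≤ B * ((y / 2) ^ (2 * j + 2) * R (x, y) ^ 2) := by positivity
  have h3 : ((b - b0) * ((y / 2) ^ (4 * N + 3) * |G (x, y)|)) ^ 2 ≤ C5 := by
    rw [mul_pow, mul_pow, sq_abs, ← pow_mul]
    have : (4 * N + 3) * 2 = 2 * k + 2 := by omega
    rw [this]
    have h4 : (b - b0) ^ 2 ≤ (x - b0) ^ 2 := pow_le_pow_left₀ hbb.le (by linarith [hx.1]) 2
    have h5 := mul_le_mul_of_nonneg_right h4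
      (show 0 ≤ (y / 2) ^ (2 * k + 2) * G (x, y) ^ 2 by positivity)
    linarith
  have h6 := Real.le_sqrt_of_sq_le h3
  have h7 : (y / 2) ^ (4 * N + 3) * |G (x, y)| ≤ Real.sqrt C5 / (b - b0) := by
    rw [le_div_iff₀ hbb]; linarith
  have h8 : |G (x, y)| * y ^ (4 * N + 3) = 2 ^ (4 * N + 3) * ((y / 2) ^ (4 * N + 3) * |G (x, y)|) := by
    rw [div_pow]; field_simp
  rw [h8]
  exact mul_le_mul_of_nonneg_left h7 (by positivity)

set_option maxHeartbeats 1000000 in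
lemma dbl_alg {A Zn ζ h ψ q qi g L1 L2 φ P D κ η β n w z0 fx fs Fx Fs ax as fpx fps K1 : ℝ}
    (hA : 1 ≤ A) (hEx : fx = ax * fpx + Fx) (hEs : fs = as * fps + Fs)
    (h1 : κ * φ ≤ w * fx) (h2 : w * fs ≤ n * z0 * D + κ * φ)
    (h3 : w * (fpx - fps) ≤ - (κ * (h * (β * (1 + β) * L1) + η * (1 / 4 * L2))))
    (hwD : w * D = κ * P) (hax : 0 < ax) (has : 0 < as) (hqa : q ≤ A * ax)
    (hr : |ax - as| ≤ A * h * g * as) (hr2 : ax ≤ A ^ 2 * as)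
    (hF : |Fx - Fs| * ψ ≤ A * (h * ψ + D)) (hFs : |Fs| ≤ A)
    (hψζ : ψ ≤ ζ) (hz0 : z0 * ζ = w) (hz0' : 0 ≤ z0) (hw : 0 ≤ w) (hwZ : w ≤ Zn)
    (hD : 0 ≤ D) (hφ : 0 ≤ φ) (hφψ : φ ≤ ψ) (hP : P ≤ h * ψ + η * q)
    (hκ : 1 ≤ κ) (hg : 1 ≤ g) (hψ1 : ψ ≤ 1) (hq : 0 < q) (hqi : q * qi = 1) (hq2 : q * q = ψ)
    (hh : 0 < h) (hη : 0 < η) (hβ : 0 < β) (hn : 0 ≤ n) (hL1 : 0 < L1) (hL2 : 0 < L2)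
    (hK : K1 = A + A * Zn + A ^ 2 * Zn + A + A ^ 2 * n)
    (hs1 : K1 * A * g < β * (q * L1)) (hs2 : 4 * A * (A + A ^ 2 * n) * qi ≤ q * L2) : False := by
  have hA0 : 0 < A := by linarith
  have hψ : 0 < ψ := by rw [← hq2]; positivity
  have hqi0 : 0 < qi := by
    by_contra hc
    push Not at hc
    linarith [mul_nonneg hq.le (neg_nonneg.2 hc)]
  have hκ0 : 0 < κ := by linarith
  have hZn : 0 ≤ Zn := hw.trans hwZ
  obtain ⟨r, hr0⟩ : ∃ r, r = ax / as := ⟨_, rfl⟩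
  have hras : r * as = ax := by rw [hr0]; field_simp
  have hrpos : 0 < r := by rw [hr0]; positivity
  have hrA : r ≤ A ^ 2 := by rw [hr0, div_le_iff₀ has]; exact hr2
  have hr1 : |r - 1| ≤ A * h * g := by
    have : r - 1 = (ax - as) / as := by rw [hr0]; field_simp
    rw [this, abs_div, abs_of_pos has, div_le_iff₀ has]; exact hr
  obtain ⟨Y, hY⟩ : ∃ Y, Y = h + η * qi := ⟨_, rfl⟩
  have hY0 : 0 < Y := by rw [hY]; positivity
  have hPY : P ≤ ψ * Y := by
    have : ψ * Y = h * ψ + η * q * (q * qi) := by rw [hY, ← hq2]; ring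
    rw [this, hqi]; linarith
  obtain ⟨S, hS⟩ : ∃ S, S = h * (β * (1 + β) * L1) + η * (1 / 4 * L2) := ⟨_, rfl⟩
  rw [← hS] at h3
  have m1 : ax * κ * S ≤ (r - 1) * κ * φ + r * (n * z0 * D) + w * (Fx - Fs) + w * ((1 - r) * Fs) := by
    have e1 := mul_le_mul_of_nonneg_left h3 hax.le
    have e2 := mul_le_mul_of_nonneg_left h2 hrpos.le
    have e3 : ax * (w * (fpx - fps)) = w * (fx - Fx) - r * (w * (fs - Fs)) := by
      rw [hEx, hEs, ← hras]; ring
    rw [e3] at e1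
    linarith
  have t1 : (r - 1) * κ * φ ≤ A * h * g * κ := by
    have e1 : (r - 1) * κ ≤ A * h * g * κ :=
      mul_le_mul_of_nonneg_right ((le_abs_self _).trans hr1) hκ0.le
    have e2 := mul_le_mul_of_nonneg_right e1 hφ
    have e3 : A * h * g * κ * φ ≤ A * h * g * κ * 1 :=
      mul_le_mul_of_nonneg_left (hφψ.trans hψ1) (by positivity)
    linarith
  have t2 : r * (n * z0 * D) ≤ A ^ 2 * n * (κ * Y) := by
    have e1 : z0 * D ≤ κ * Y := by
      have e2 : z0 * D * ψ ≤ z0 * D * ζ := mul_le_mul_of_nonneg_left hψζ (by positivity)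
      have e3 : z0 * D * ζ = κ * P := by rw [← hwD, ← hz0]; ring
      have e4 : κ * P ≤ κ * (ψ * Y) := mul_le_mul_of_nonneg_left hPY hκ0.le
      exact le_of_mul_le_mul_right (by linarith) hψ
    have e5 : n * (z0 * D) ≤ n * (κ * Y) := mul_le_mul_of_nonneg_left e1 hn
    have e6 := mul_le_mul hrA e5 (by positivity) (by positivity)
    linarith
  have t3 : w * (Fx - Fs) ≤ A * h * Zn + A * (κ * Y) := by
    have e1 : w * (|Fx - Fs| * ψ) ≤ w * (A * (h * ψ + D)) := mul_le_mul_of_nonneg_left hF hw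
    have e2 : w * (Fx - Fs) ≤ w * |Fx - Fs| := mul_le_mul_of_nonneg_left (le_abs_self _) hw
    have e3 : A * (κ * P) ≤ A * (κ * (ψ * Y)) := by gcongr
    have e4 : A * h * ψ * w ≤ A * h * ψ * Zn := by gcongr
    have e5 : A * (w * D) = A * (κ * P) := by rw [hwD]
    have e6 : (w * |Fx - Fs|) * ψ ≤ (A * h * Zn + A * (κ * Y)) * ψ := by linarith
    exact e2.trans (le_of_mul_le_mul_right e6 hψ)
  have t4 : w * ((1 - r) * Fs) ≤ Zn * (A * h * g * A) := by
    have e1 : (1 - r) * Fs ≤ |r - 1| * |Fs| := by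
      rw [abs_sub_comm, ← abs_mul]; exact le_abs_self _
    have e2 : |r - 1| * |Fs| ≤ A * h * g * A := by gcongr
    have e3 := mul_le_mul_of_nonneg_left (e1.trans e2) hw
    have e4 := mul_le_mul_of_nonneg_right hwZ (show 0 ≤ A * h * g * A by positivity)
    linarith
  have t5 : ax * κ * S ≤ κ * (h * g * K1 + (A + A ^ 2 * n) * (η * qi)) := by
    have e1 : A * h * Zn ≤ A * h * Zn * (g * κ) :=
      le_mul_of_one_le_right (by positivity) (one_le_mul_of_one_le_of_one_le hg hκ)
    have e2 : Zn * (A * h * g * A) ≤ Zn * (A * h * g * A) * κ :=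
      le_mul_of_one_le_right (by positivity) hκ
    have e3 : (A + A ^ 2 * n) * κ * h ≤ (A + A ^ 2 * n) * κ * h * g :=
      le_mul_of_one_le_right (by positivity) hg
    rw [hY] at t2 t3
    rw [hK]
    linarith
  have t6 : q * S ≤ A * ax * S := by
    apply mul_le_mul_of_nonneg_right hqa
    rw [hS]; positivity
  have t7 : ax * S ≤ h * g * K1 + (A + A ^ 2 * n) * (η * qi) := by
    apply le_of_mul_le_mul_left _ hκ0
    linarith
  have t8 := mul_le_mul_of_nonneg_left t7 hA0.le
  have t9 := mul_lt_mul_of_pos_left hs1 hh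
  have t10 := mul_le_mul_of_nonneg_left hs2 hη.le
  have t11 : 0 < q * (h * (β * β * L1)) := by positivity
  rw [hS] at t6 t8
  linarith

lemma rpow_small {β ε : ℝ} (hβ : 0 < β) (hε : 0 < ε) :
    ∃ δ > 0, ∀ ψ ∈ Ioc (0 : ℝ) δ, ψ ^ β < ε := by
  refine ⟨(ε / 2) ^ (1 / β), by positivity, fun ψ hψ => ?_⟩
  have h1 : ψ ^ β ≤ ((ε / 2) ^ (1 / β)) ^ β := Real.rpow_le_rpow hψ.1.le hψ.2 hβ.le
  rw [← Real.rpow_mul (by positivity), one_div_mul_cancel hβ.ne', Real.rpow_one] at h1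
  linarith

noncomputable def bar (β h η ψ : ℝ) : ℝ := h * (ψ - ψ ^ (1 + β)) + η * ψ ^ (1 / 2 : ℝ)

lemma bar_d {β h η ψ : ℝ} (hψ : 0 < ψ) : HasDerivAt (bar β h η)
    (h * (1 - (1 + β) * ψ ^ β) + η * (1 / 2 * ψ ^ (-1 / 2 : ℝ))) ψ := by
  have h1 := Real.hasDerivAt_rpow_const (p := 1 + β) (Or.inl hψ.ne')
  have h2 := Real.hasDerivAt_rpow_const (p := (1 / 2 : ℝ)) (Or.inl hψ.ne')
  have h3 := (((hasDerivAt_id ψ).fun_sub h1).const_mul h).fun_add (h2.const_mul η)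
  refine h3.congr_deriv ?_
  norm_num

lemma bar_dd {β h η ψ : ℝ} (hψ : 0 < ψ) :
    HasDerivAt (fun ψ => h * (1 - (1 + β) * ψ ^ β) + η * (1 / 2 * ψ ^ (-1 / 2 : ℝ)))
    (- (h * (β * (1 + β) * ψ ^ (β - 1)) + η * (1 / 4 * ψ ^ (-3 / 2 : ℝ)))) ψ := by
  have h1 := Real.hasDerivAt_rpow_const (p := β) (Or.inl hψ.ne')
  have h2 := Real.hasDerivAt_rpow_const (p := (-1 / 2 : ℝ)) (Or.inl hψ.ne')
  have h3 := (((h1.const_mul (1 + β)).const_sub 1).const_mul h).fun_add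
    ((h2.const_mul (1 / 2)).const_mul η)
  refine h3.congr_deriv ?_
  norm_num; ring

lemma bar_rel {α ψ : ℝ} (hψ : 0 < ψ) (hψ1 : ψ ≤ 1) (hα : α ∈ Ioo (0 : ℝ) (1 / 2)) :
    0 < ψ ^ (1 / 2 : ℝ) ∧ ψ ^ (1 / 2 : ℝ) * ψ ^ (-1 / 2 : ℝ) = 1 ∧
    ψ ^ (1 / 2 : ℝ) * ψ ^ (1 / 2 : ℝ) = ψ ∧ 1 ≤ ψ ^ (α - 1 / 2) ∧
    ψ ^ (α - 1 / 2) = ψ ^ (α / 2) * (ψ ^ (1 / 2 : ℝ) * ψ ^ (α / 2 - 1)) ∧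
    ψ ^ (1 / 2 : ℝ) * ψ ^ (-3 / 2 : ℝ) = ψ ^ (-1 / 2 : ℝ) * ψ ^ (-1 / 2 : ℝ) ∧
    ψ ^ (1 + α / 2) = ψ * ψ ^ (α / 2) := by
  refine ⟨by positivity, ?_, ?_, ?_, ?_, ?_, ?_⟩
  · rw [← Real.rpow_add hψ]; norm_num
  · rw [← Real.rpow_add hψ]; norm_num
  · exact Real.one_le_rpow_of_pos_of_le_one_of_nonpos hψ hψ1 (by linarith [hα.2])
  · rw [← Real.rpow_add hψ, ← Real.rpow_add hψ]; congr 1; ring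
  · rw [← Real.rpow_add hψ, ← Real.rpow_add hψ]; norm_num
  · rw [Real.rpow_add hψ, Real.rpow_one]

structure DblHyp (T d0 : ℝ) (f F a : ℝ × ℝ → ℝ) (b0 c δ0 A α : ℝ) (N : ℕ) : Prop where
  hf : Sm T d0 f
  hb0 : 0 < b0
  hbc : b0 < c
  hc : c < T
  hδ0 : 0 < δ0
  hδd : δ0 < d0
  hδ1 : δ0 ≤ 1
  hA : 1 ≤ A
  hα : α ∈ Ioo (0 : ℝ) (1 / 2)
  heq : ∀ x ∈ Icc b0 c, ∀ ψ ∈ Ioc 0 δ0, Dx f (x, ψ) = a (x, ψ) * Dy (Dy f) (x, ψ) + F (x, ψ)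
  H1 : ∀ x ∈ Icc b0 c, ∀ s ∈ Icc b0 c, ∀ ψ ∈ Ioc 0 δ0, |f (x, ψ) - f (s, ψ)| ≤ A * ψ
  H2 : ∀ x ∈ Icc b0 c, ∀ s ∈ Icc b0 c, ∀ ψ ∈ Ioc 0 δ0, |f (x, ψ) - f (s, ψ)| * ψ ^ N ≤ A * |x - s|
  H3 : ∀ x ∈ Icc b0 c, ∀ s ∈ Icc b0 c, ∀ ψ ∈ Ioc 0 δ0,
    |F (x, ψ) - F (s, ψ)| * ψ ≤ A * (|x - s| * ψ + |f (x, ψ) - f (s, ψ)|)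
  H4 : ∀ x ∈ Icc b0 c, ∀ ψ ∈ Ioc 0 δ0, |F (x, ψ)| ≤ A
  H5 : ∀ x ∈ Icc b0 c, ∀ s ∈ Icc b0 c, ∀ ψ ∈ Ioc 0 δ0,
    |a (x, ψ) - a (s, ψ)| ≤ A * |x - s| * ψ ^ (α - 1 / 2) * a (s, ψ)
  H6 : ∀ x ∈ Icc b0 c, ∀ ψ ∈ Ioc 0 δ0, ψ ^ (1 / 2 : ℝ) ≤ A * a (x, ψ)
  H7 : ∀ x ∈ Icc b0 c, ∀ ψ ∈ Ioc 0 δ0, a (x, ψ) ≤ A * ψ ^ (1 / 2 : ℝ)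

lemma dbl_core {T d0 : ℝ} {f F a : ℝ × ℝ → ℝ} {b0 c δ0 A α : ℝ} {N : ℕ}
    (H : DblHyp T d0 f F a b0 c δ0 A α N) {s x ψ ψs δ κ η : ℝ}
    (hψs : 0 < ψs) (hδ : δ ≤ δ0) (hs : b0 < s) (hsx : s < x) (hx : x ≤ c) (hψ : ψ ∈ Ioo ψs δ)
    (hη : 0 < η) (hκ : 1 ≤ κ)
    (hmax : ∀ s', b0 ≤ s' → ∀ x', s' ≤ x' → x' ≤ c → ∀ ψ' ∈ Icc ψs δ,
      (s' - b0) ^ (N + 1) * (f (x', ψ') - f (s', ψ')) ≤ κ * bar (α / 2) (x' - s') η ψ')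
    (heqm : (s - b0) ^ (N + 1) * (f (x, ψ) - f (s, ψ)) = κ * bar (α / 2) (x - s) η ψ)
    (hκ2 : 2 * A < κ) (hhalf : ψ ^ (α / 2) < 1 / 2)
    (hs1 : (A + A * (c - b0) ^ (N + 1) + A ^ 2 * (c - b0) ^ (N + 1) + A + A ^ 2 * (N + 1)) * A *
      ψ ^ (α / 2) < α / 2)
    (hs2 : 4 * A * (A + A ^ 2 * (N + 1)) * ψ ^ (1 / 2 : ℝ) < 1) : False := by
  have hA0 : 0 < A := by linarith [H.hA]
  have hψ0 : 0 < ψ := hψs.trans hψ.1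
  have hψm : ψ ∈ Ioc 0 δ0 := ⟨hψ0, hψ.2.le.trans hδ⟩
  have hψ1 : ψ ≤ 1 := hψm.2.trans H.hδ1
  have hsm : s ∈ Icc b0 c := ⟨hs.le, hsx.le.trans hx⟩
  have hxm : x ∈ Icc b0 c := ⟨by linarith, hx⟩
  have hψm' : ψ ∈ Icc ψs δ := ⟨hψ.1.le, hψ.2.le⟩
  have hin : ∀ t ∈ Icc b0 c, ∀ y ∈ Ioc 0 δ0, (t, y) ∈ Om T d0 := fun t ht y hy =>
    mem_Om (by linarith [ht.1, H.hb0]) (by linarith [ht.2, H.hc]) hy.1 (by linarith [hy.2, H.hδd])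
  obtain ⟨r1, r2, r3, r4, r5, r6, r7⟩ := bar_rel hψ0 hψ1 H.hα
  have hh : 0 < x - s := by linarith
  have habs : |x - s| = x - s := abs_of_pos hh
  set ζ := s - b0 with hζdef
  have hζ : 0 < ζ := by linarith
  obtain ⟨φ, hφ⟩ : ∃ φ, φ = ψ - ψ ^ (1 + α / 2) := ⟨_, rfl⟩
  have hφ1 : φ ≤ ψ := by rw [hφ]; linarith [Real.rpow_pos_of_pos hψ0 (1 + α / 2)]
  have hφ2 : ψ / 2 ≤ φ := by
    rw [hφ, r7]
    have := mul_le_mul_of_nonneg_left hhalf.le hψ0.le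
    linarith
  have hPdef : bar (α / 2) (x - s) η ψ = (x - s) * φ + η * ψ ^ (1 / 2 : ℝ) := by rw [hφ]; rfl
  have hP0 : 0 < bar (α / 2) (x - s) η ψ := by
    rw [hPdef]
    have : 0 < φ := by linarith
    positivity
  obtain ⟨D, hD⟩ : ∃ D, D = f (x, ψ) - f (s, ψ) := ⟨_, rfl⟩
  rw [← hD] at heqm
  have hD0 : 0 < D := by
    have h1 : 0 < ζ ^ (N + 1) * D := by rw [heqm]; positivity
    exact (mul_pos_iff_of_pos_left (by positivity)).1 h1
  -- case ζ < ψ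
  have hψζ : ψ ≤ ζ := by
    by_contra hcon
    push Not at hcon
    have e1 := H.H2 x hxm s hsm ψ hψm
    rw [← hD, abs_of_pos hD0, habs] at e1
    have e2 : ζ ^ (N + 1) ≤ ψ ^ (N + 1) := pow_le_pow_left₀ hζ.le hcon.le _
    have e3 := mul_le_mul_of_nonneg_right e2 hD0.le
    have e4 : ψ ^ (N + 1) * D = ψ * (D * ψ ^ N) := by ring
    have e5 := mul_le_mul_of_nonneg_left e1 hψ0.le
    have e6 : κ * bar (α / 2) (x - s) η ψ ≤ 2 * A * bar (α / 2) (x - s) η ψ := by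
      have e7 : A * ((x - s) * ψ) ≤ A * ((x - s) * (2 * φ)) := by gcongr; linarith
      have e8 : 0 ≤ 2 * A * (η * ψ ^ (1 / 2 : ℝ)) := by positivity
      rw [← heqm, hPdef]
      linarith
    have := le_of_mul_le_mul_right e6 hP0
    linarith
  -- x derivative
  have d1 : κ * φ ≤ ζ ^ (N + 1) * Dx f (x, ψ) := by
    have g1 := hasDx (H.hf.da (hin x hxm ψ hψm))
    have g2 : HasDerivAt (fun t => ζ ^ (N + 1) * (f (t, ψ) - f (s, ψ)) -
        κ * ((t - s) * φ + η * ψ ^ (1 / 2 : ℝ)))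
        (ζ ^ (N + 1) * Dx f (x, ψ) - κ * (1 * φ)) x :=
      ((g1.sub_const _).const_mul _).fun_sub
        (((((hasDerivAt_id x).sub_const s).mul_const φ).add_const _).const_mul κ)
    have := deriv_nonneg_of_left_max hsx g2 (fun t ht => by
      have m1 := hmax s hs.le t ht.1.le (ht.2.le.trans hx) ψ hψm'
      rw [show bar (α / 2) (t - s) η ψ = (t - s) * φ + η * ψ ^ (1 / 2 : ℝ) by rw [hφ]; rfl] at m1
      rw [← hD, heqm, hPdef]
      linarith)
    linarith
  have d2 : ζ ^ (N + 1) * Dx f (s, ψ) ≤ (N + 1) * ζ ^ N * D + κ * φ := by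
    have g1 := hasDx (H.hf.da (hin s hsm ψ hψm))
    have g3 : HasDerivAt (fun t => (t - b0) ^ (N + 1)) ((N + 1) * ζ ^ N) s := by
      have := ((hasDerivAt_id s).sub_const b0).fun_pow (N + 1)
      refine this.congr_deriv ?_
      simp [hζdef]
    have g2 : HasDerivAt (fun t => (t - b0) ^ (N + 1) * (f (x, ψ) - f (t, ψ)) -
        κ * ((x - t) * φ + η * ψ ^ (1 / 2 : ℝ)))
        (((N + 1) * ζ ^ N) * (f (x, ψ) - f (s, ψ)) + (s - b0) ^ (N + 1) * (- Dx f (s, ψ))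
          - κ * ((-1) * φ)) s :=
      (g3.fun_mul (g1.const_sub _)).fun_sub
        (((((hasDerivAt_id s).const_sub x).mul_const φ).add_const _).const_mul κ)
    have := deriv_nonneg_of_left_max hs g2 (fun t ht => by
      have m1 := hmax t ht.1.le x (by linarith [ht.2]) hx ψ hψm'
      rw [show bar (α / 2) (x - t) η ψ = (x - t) * φ + η * ψ ^ (1 / 2 : ℝ) by rw [hφ]; rfl] at m1
      rw [← hζdef, ← hD, heqm, hPdef]
      linarith)
    rw [← hζdef, ← hD] at this
    linarith
  have d3 : ζ ^ (N + 1) * (Dy (Dy f) (x, ψ) - Dy (Dy f) (s, ψ)) ≤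
      - (κ * ((x - s) * (α / 2 * (1 + α / 2) * ψ ^ (α / 2 - 1)) + η * (1 / 4 * ψ ^ (-3 / 2 : ℝ)))) := by
    have hin' : ∀ t ∈ Icc b0 c, ∀ y ∈ Ioo ψs δ, (t, y) ∈ Om T d0 := fun t ht y hy =>
      hin t ht y ⟨hψs.trans hy.1, hy.2.le.trans hδ⟩
    have gx : ∀ q ∈ Icc b0 c, ∀ t ∈ Ioo ψs δ, HasDerivAt (fun y => f (q, y)) (Dy f (q, t)) t :=
      fun q hq t ht => hasDy (H.hf.da (hin' q hq t ht))
    have gxx : ∀ q ∈ Icc b0 c, HasDerivAt (fun y => Dy f (q, y)) (Dy (Dy f) (q, ψ)) ψ :=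
      fun q hq => hasDy (H.hf.dy.da (hin' q hq ψ hψ))
    have := second_deriv_nonpos (g := fun y => ζ ^ (N + 1) * (f (x, y) - f (s, y)) -
        κ * bar (α / 2) (x - s) η y) hψ
      (fun t ht => (((gx x hxm t ht).fun_sub (gx s hsm t ht)).const_mul _).fun_sub
        ((bar_d (hψs.trans ht.1)).const_mul κ))
      ((((gxx x hxm).fun_sub (gxx s hsm)).const_mul _).fun_sub
        ((bar_dd hψ0).const_mul κ))
      (fun t ht => by
        have m1 := hmax s hs.le x hsx.le hx t ⟨ht.1.le, ht.2.le⟩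
        show _ ≤ ζ ^ (N + 1) * (f (x, ψ) - f (s, ψ)) - κ * bar (α / 2) (x - s) η ψ
        rw [← hD, heqm]
        linarith)
    linarith
  have hax : 0 < a (x, ψ) := (mul_pos_iff_of_pos_left hA0).1 (r1.trans_le (H.H6 x hxm ψ hψm))
  have has : 0 < a (s, ψ) := (mul_pos_iff_of_pos_left hA0).1 (r1.trans_le (H.H6 s hsm ψ hψm))
  have hH5 := H.H5 x hxm s hsm ψ hψm
  have hH3 := H.H3 x hxm s hsm ψ hψm
  rw [habs] at hH5 hH3
  rw [← hD, abs_of_pos hD0] at hH3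
  have hax2 : a (x, ψ) ≤ A ^ 2 * a (s, ψ) := by
    have e1 := mul_le_mul_of_nonneg_left (H.H6 s hsm ψ hψm) hA0.le
    linarith [H.H7 x hxm ψ hψm]
  have hqi0 : 0 < ψ ^ (-1 / 2 : ℝ) := by positivity
  have hL : 0 < ψ ^ (1 / 2 : ℝ) * ψ ^ (α / 2 - 1) := by positivity
  refine dbl_alg (n := (N : ℝ) + 1) (φ := φ) (ψ := ψ) (ζ := ζ) (z0 := ζ ^ N) H.hA (H.heq x hxm ψ hψm)
    (H.heq s hsm ψ hψm) d1 d2 d3 heqm hax has (H.H6 x hxm ψ hψm) hH5 hax2 hH3 (H.H4 s hsm ψ hψm) hψζ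
    (by ring) (by positivity) (by positivity)
    (pow_le_pow_left₀ hζ.le (show ζ ≤ c - b0 by rw [hζdef]; linarith [hsm.2]) (N + 1)) hD0.le (by linarith) hφ1
    ?_ hκ r4 hψ1 r1 r2 r3 hh hη (by linarith [H.hα.1]) (by positivity) (by positivity)
    (by positivity) rfl ?_ ?_
  · rw [hPdef]
    have := mul_le_mul_of_nonneg_left hφ1 hh.le
    linarith
  · rw [r5, ← mul_assoc]
    exact mul_lt_mul_of_pos_right hs1 hL
  · rw [r6]
    have e1 := mul_le_mul_of_nonneg_right hs2.le hqi0.le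
    rw [mul_assoc, r2, mul_one, one_mul] at e1
    exact mul_le_mul_of_nonneg_right e1 hqi0.le

lemma dbl_claim {T d0 : ℝ} {f F a : ℝ × ℝ → ℝ} {b0 c δ0 A α : ℝ} {N : ℕ}
    (H : DblHyp T d0 f F a b0 c δ0 A α N) {δ κ0 η : ℝ} (hδp : 0 < δ) (hδ : δ ≤ δ0) (hη : 0 < η)
    (hκ2 : 2 * A + 1 ≤ κ0) (hκ3 : 2 * ((c - b0) ^ (N + 1) * A) ≤ κ0 * δ ^ (N + 1))
    (hhalf : ∀ ψ ∈ Ioc 0 δ, ψ ^ (α / 2) < 1 / 2)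
    (hs1 : ∀ ψ ∈ Ioc 0 δ, (A + A * (c - b0) ^ (N + 1) + A ^ 2 * (c - b0) ^ (N + 1) + A + A ^ 2 * (N + 1)) * A *
      ψ ^ (α / 2) < α / 2)
    (hs2 : ∀ ψ ∈ Ioc 0 δ, 4 * A * (A + A ^ 2 * (N + 1)) * ψ ^ (1 / 2 : ℝ) < 1)
    {s0 x0 ψ0 : ℝ} (hs0 : b0 ≤ s0) (hsx0 : s0 ≤ x0) (hx0 : x0 ≤ c) (hψ0 : ψ0 ∈ Ioc 0 δ) :
    (s0 - b0) ^ (N + 1) * (f (x0, ψ0) - f (s0, ψ0)) ≤ κ0 * bar (α / 2) (x0 - s0) η ψ0 := by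
  have hA0 : 0 < A := by linarith [H.hA]
  have hZ : 0 < c - b0 := by linarith [H.hbc]
  have hbarl : ∀ h ψ, 0 ≤ h → ψ ∈ Ioc 0 δ → h * (ψ / 2) + η * ψ ^ (1 / 2 : ℝ) ≤ bar (α / 2) h η ψ := by
    intro h ψ hh hψ
    obtain ⟨r1, r2, r3, r4, r5, r6, r7⟩ := bar_rel hψ.1 (hψ.2.trans (hδ.trans H.hδ1)) H.hα
    show _ ≤ h * (ψ - ψ ^ (1 + α / 2)) + η * ψ ^ (1 / 2 : ℝ)
    rw [r7]
    have e1 := mul_le_mul_of_nonneg_left (hhalf ψ hψ).le hψ.1.le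
    have e2 := mul_le_mul_of_nonneg_left e1 hh
    linarith
  have hbarp : ∀ h ψ, 0 ≤ h → ψ ∈ Ioc 0 δ → 0 < bar (α / 2) h η ψ := by
    intro h ψ hh hψ
    refine lt_of_lt_of_le ?_ (hbarl h ψ hh hψ)
    have := hψ.1
    positivity
  have hin : ∀ t ∈ Icc b0 c, ∀ y ∈ Ioc 0 δ0, (t, y) ∈ Om T d0 := fun t ht y hy =>
    mem_Om (by linarith [ht.1, H.hb0]) (by linarith [ht.2, H.hc]) hy.1 (by linarith [hy.2, H.hδd])
  obtain ⟨t, ht, hts⟩ := rpow_small (β := 1 / 2) (ε := η / ((c - b0) ^ (N + 1) * A)) (by norm_num)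
    (by positivity)
  obtain ⟨ψs, hψs⟩ : ∃ ψs, ψs = min ψ0 t := ⟨_, rfl⟩
  have hψsp : 0 < ψs := by rw [hψs]; exact lt_min hψ0.1 ht
  have hψs0 : ψs ≤ ψ0 := by rw [hψs]; exact min_le_left _ _
  have hψst : (c - b0) ^ (N + 1) * A * ψs ^ (1 / 2 : ℝ) ≤ η := by
    have := hts ψs ⟨hψsp, by rw [hψs]; exact min_le_right _ _⟩
    rw [lt_div_iff₀ (by positivity)] at this
    linarith
  obtain ⟨S, hS⟩ : ∃ S : Set (ℝ × ℝ × ℝ), S = (Icc b0 c ×ˢ Icc b0 c ×ˢ Icc ψs δ) ∩ {q | q.1 ≤ q.2.1} :=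
    ⟨_, rfl⟩
  have hSc : IsCompact S := by
    rw [hS]
    exact (isCompact_Icc.prod (isCompact_Icc.prod isCompact_Icc)).inter_right
      (isClosed_le (by fun_prop) (by fun_prop))
  have hmem : ∀ s x ψ, b0 ≤ s → s ≤ x → x ≤ c → ψ ∈ Icc ψs δ → (s, x, ψ) ∈ S := by
    intro s x ψ h1 h2 h3 h4
    rw [hS]
    exact ⟨⟨⟨h1, h2.trans h3⟩, ⟨h1.trans h2, h3⟩, h4⟩, h2⟩
  have hmem' : ∀ q ∈ S, b0 ≤ q.1 ∧ q.1 ≤ q.2.1 ∧ q.2.1 ≤ c ∧ q.2.2 ∈ Icc ψs δ := by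
    intro q hq
    rw [hS] at hq
    exact ⟨hq.1.1.1, hq.2, hq.1.2.1.2, hq.1.2.2⟩
  have hψd : ∀ ψ ∈ Icc ψs δ, ψ ∈ Ioc 0 δ := fun ψ h => ⟨hψsp.trans_le h.1, h.2⟩
  have hcont : ContinuousOn (fun q : ℝ × ℝ × ℝ => (q.1 - b0) ^ (N + 1) * (f (q.2.1, q.2.2) - f (q.1, q.2.2)) /
      bar (α / 2) (q.2.1 - q.1) η q.2.2) S := by
    refine ContinuousOn.div ?_ ?_ ?_
    · refine ContinuousOn.mul (by fun_prop) (ContinuousOn.sub ?_ ?_)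
      · refine H.hf.continuousOn.comp (by fun_prop) fun q hq => ?_
        obtain ⟨h1, h2, h3, h4⟩ := hmem' q hq
        exact hin _ ⟨by linarith, h3⟩ _ ⟨(hψd _ h4).1, h4.2.trans hδ⟩
      · refine H.hf.continuousOn.comp (by fun_prop) fun q hq => ?_
        obtain ⟨h1, h2, h3, h4⟩ := hmem' q hq
        exact hin _ ⟨h1, by linarith⟩ _ ⟨(hψd _ h4).1, h4.2.trans hδ⟩
    · unfold bar
      have h2 : ContinuousOn (fun q : ℝ × ℝ × ℝ => q.2.2) S := by fun_prop
      refine ContinuousOn.add (ContinuousOn.mul (by fun_prop) (h2.sub (h2.rpow_const ?_)))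
        (continuousOn_const.mul (h2.rpow_const ?_))
      · intro q hq
        exact Or.inl (hψd _ (hmem' q hq).2.2.2).1.ne'
      · intro q hq
        exact Or.inl (hψd _ (hmem' q hq).2.2.2).1.ne'
    · intro q hq
      obtain ⟨h1, h2, h3, h4⟩ := hmem' q hq
      exact (hbarp _ _ (by linarith) (hψd _ h4)).ne'
  have hin0 := hmem s0 x0 ψ0 hs0 hsx0 hx0 ⟨hψs0, hψ0.2⟩
  obtain ⟨⟨s, x, ψ⟩, hq, hmx⟩ := hSc.exists_isMaxOn ⟨_, hin0⟩ hcont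
  obtain ⟨h1, h2, h3, h4⟩ := hmem' _ hq
  simp only at h1 h2 h3 h4
  obtain ⟨κ, hκ⟩ : ∃ κ, κ = (s - b0) ^ (N + 1) * (f (x, ψ) - f (s, ψ)) / bar (α / 2) (x - s) η ψ := ⟨_, rfl⟩
  have hP := hbarp (x - s) ψ (by linarith) (hψd _ h4)
  have hall : ∀ s', b0 ≤ s' → ∀ x', s' ≤ x' → x' ≤ c → ∀ ψ' ∈ Icc ψs δ,
      (s' - b0) ^ (N + 1) * (f (x', ψ') - f (s', ψ')) ≤ κ * bar (α / 2) (x' - s') η ψ' := by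
    intro s' a1 x' a2 a3 ψ' a4
    have := hmx (hmem s' x' ψ' a1 a2 a3 a4)
    simp only [mem_ofPred_eq] at this
    rw [← hκ, div_le_iff₀ (hbarp _ _ (by linarith) (hψd _ a4))] at this
    exact this
  have heqm : (s - b0) ^ (N + 1) * (f (x, ψ) - f (s, ψ)) = κ * bar (α / 2) (x - s) η ψ := by
    rw [hκ, div_mul_cancel₀ _ hP.ne']
  by_cases hle : κ ≤ κ0
  · refine (hall s0 hs0 x0 hsx0 hx0 ψ0 ⟨hψs0, hψ0.2⟩).trans ?_
    exact mul_le_mul_of_nonneg_right hle (hbarp _ _ (by linarith) hψ0).le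
  exfalso
  push Not at hle
  have hκ0 : 0 < κ := by linarith
  have hpos : 0 < (s - b0) ^ (N + 1) * (f (x, ψ) - f (s, ψ)) := by rw [heqm]; positivity
  have hsb : b0 < s := by
    rcases h1.eq_or_lt with h | h
    · exfalso; rw [← h, sub_self, zero_pow (by omega), zero_mul] at hpos; exact lt_irrefl _ hpos
    · exact h
  have hsx : s < x := by
    rcases h2.eq_or_lt with h | h
    · exfalso; rw [h, sub_self, mul_zero] at hpos; exact lt_irrefl _ hpos
    · exact h
  have hsm : s ∈ Icc b0 c := ⟨h1, by linarith⟩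
  have hxm : x ∈ Icc b0 c := ⟨by linarith, h3⟩
  have hψm : ψ ∈ Ioc 0 δ0 := ⟨(hψd _ h4).1, h4.2.trans hδ⟩
  have hzz : (s - b0) ^ (N + 1) ≤ (c - b0) ^ (N + 1) :=
    pow_le_pow_left₀ (by linarith) (by linarith) _
  have hup : ∀ B, 0 ≤ B → |f (x, ψ) - f (s, ψ)| ≤ B →
      κ * bar (α / 2) (x - s) η ψ ≤ (c - b0) ^ (N + 1) * B := by
    intro B hB0 hB
    rw [← heqm]
    have e1 := mul_le_mul_of_nonneg_left ((le_abs_self _).trans hB) (show 0 ≤ (s - b0) ^ (N + 1) by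
      have : 0 < s - b0 := by linarith
      positivity)
    exact e1.trans (mul_le_mul_of_nonneg_right hzz hB0)
  have hbl := hbarl (x - s) ψ (by linarith) (hψd _ h4)
  have hne1 : ψs < ψ := by
    rcases h4.1.eq_or_lt with h | h
    · exfalso
      have e1 := hup _ (mul_nonneg hA0.le hψm.1.le) (H.H1 x hxm s hsm ψ hψm)
      obtain ⟨r1, r2, r3, r4, r5, r6, r7⟩ := bar_rel hψm.1 (hψm.2.trans H.hδ1) H.hα
      rw [h] at hψst
      have e2 := mul_le_mul_of_nonneg_right hψst r1.le
      rw [mul_assoc, r3] at e2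
      have e3 : 0 < (x - s) * (ψ / 2) := mul_pos (by linarith) (by linarith [hψm.1])
      have e4 : 1 * bar (α / 2) (x - s) η ψ ≤ κ * bar (α / 2) (x - s) η ψ :=
        mul_le_mul_of_nonneg_right (by linarith) hP.le
      linarith
    · exact h
  have hne2 : ψ < δ := by
    rcases h4.2.eq_or_lt with h | h
    · exfalso
      have hh : 0 < x - s := by linarith
      have e1 : |f (x, ψ) - f (s, ψ)| ≤ A * (x - s) / ψ ^ N := by
        rw [le_div_iff₀ (pow_pos hψm.1 _)]
        have := H.H2 x hxm s hsm ψ hψm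
        rwa [abs_of_pos hh] at this
      have e2 := hup _ (by have := hψm.1; positivity) e1
      have e3 : κ * ((x - s) * (ψ / 2)) < κ * bar (α / 2) (x - s) η ψ := by
        refine mul_lt_mul_of_pos_left ?_ hκ0
        have : 0 < η * ψ ^ (1 / 2 : ℝ) := mul_pos hη (Real.rpow_pos_of_pos hψm.1 _)
        linarith
      have hψN : 0 < ψ ^ N := pow_pos hψm.1 _
      have e4 := mul_lt_mul_of_pos_right (e3.trans_le e2) hψN
      have e5 : (c - b0) ^ (N + 1) * (A * (x - s) / ψ ^ N) * ψ ^ N = (c - b0) ^ (N + 1) * A * (x - s) := by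
        field_simp
      rw [e5, h] at e4
      have e6 := mul_le_mul_of_nonneg_right hκ3 hh.le
      have e7 : κ0 * (δ ^ (N + 1) * (x - s)) ≤ κ * (δ ^ (N + 1) * (x - s)) :=
        mul_le_mul_of_nonneg_right hle.le (by positivity)
      have e8 : κ * ((x - s) * (δ / 2)) * δ ^ N = κ * (δ ^ (N + 1) * (x - s)) / 2 := by ring
      linarith
    · exact h
  exact dbl_core H hψsp hδ hsb hsx h3 ⟨hne1, hne2⟩ hη (by linarith [H.hA]) hall heqm (by linarith)
    (hhalf ψ (hψd _ h4)) (hs1 ψ (hψd _ h4)) (hs2 ψ (hψd _ h4))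

lemma dbl_one {T d0 : ℝ} {f F a : ℝ × ℝ → ℝ} {b0 c δ0 A α : ℝ} {N : ℕ}
    (H : DblHyp T d0 f F a b0 c δ0 A α N) :
    ∃ δ > 0, δ ≤ δ0 ∧ ∃ C ≥ 0, ∀ s x ψ, b0 ≤ s → s ≤ x → x ≤ c → ψ ∈ Ioc 0 δ →
      (s - b0) ^ (N + 1) * (f (x, ψ) - f (s, ψ)) ≤ C * ((x - s) * ψ) := by
  have hA0 : 0 < A := by linarith [H.hA]
  have hα := H.hα.1
  have hZ : 0 < c - b0 := by linarith [H.hbc]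
  obtain ⟨δ1, p1, q1⟩ := rpow_small (β := α / 2) (ε := 1 / 2) (by linarith) (by norm_num)
  obtain ⟨K1, hK1⟩ : ∃ K1, K1 = (A + A * (c - b0) ^ (N + 1) + A ^ 2 * (c - b0) ^ (N + 1) + A +
    A ^ 2 * ((N:ℝ) + 1)) * A := ⟨_, rfl⟩
  have hK1p : 0 < K1 := by rw [hK1]; positivity
  obtain ⟨K2, hK2⟩ : ∃ K2, K2 = 4 * A * (A + A ^ 2 * ((N:ℝ) + 1)) := ⟨_, rfl⟩
  have hK2p : 0 < K2 := by rw [hK2]; positivity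
  obtain ⟨δ2, p2, q2⟩ := rpow_small (β := α / 2) (ε := α / 2 / K1) (by linarith) (by positivity)
  obtain ⟨δ3, p3, q3⟩ := rpow_small (β := 1 / 2) (ε := 1 / K2) (by norm_num) (by positivity)
  obtain ⟨δ, hδ⟩ : ∃ δ, δ = min δ0 (min δ1 (min δ2 δ3)) := ⟨_, rfl⟩
  have hδp : 0 < δ := by rw [hδ]; exact lt_min H.hδ0 (lt_min p1 (lt_min p2 p3))
  have l0 : δ ≤ δ0 := by rw [hδ]; exact min_le_left _ _
  have l1 : δ ≤ δ1 := by rw [hδ]; exact (min_le_right _ _).trans (min_le_left _ _)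
  have l2 : δ ≤ δ2 := by
    rw [hδ]; exact (min_le_right _ _).trans ((min_le_right _ _).trans (min_le_left _ _))
  have l3 : δ ≤ δ3 := by
    rw [hδ]; exact (min_le_right _ _).trans ((min_le_right _ _).trans (min_le_right _ _))
  obtain ⟨κ0, hκ0⟩ : ∃ κ0, κ0 = 2 * A + 1 + 2 * ((c - b0) ^ (N + 1) * A) / δ ^ (N + 1) := ⟨_, rfl⟩
  have hκp : 0 < κ0 := by rw [hκ0]; positivity
  refine ⟨δ, hδp, l0, κ0, hκp.le, fun s x ψ hs hsx hx hψ => ?_⟩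
  have key : ∀ η > 0, (s - b0) ^ (N + 1) * (f (x, ψ) - f (s, ψ)) ≤ κ0 * bar (α / 2) (x - s) η ψ := by
    intro η hη
    refine dbl_claim H hδp l0 hη ?_ ?_ ?_ ?_ ?_ hs hsx hx hψ
    · rw [hκ0]
      have : 0 ≤ 2 * ((c - b0) ^ (N + 1) * A) / δ ^ (N + 1) := by positivity
      linarith
    · rw [hκ0, add_mul, div_mul_cancel₀ _ (by positivity)]
      have : 0 ≤ (2 * A + 1) * δ ^ (N + 1) := by positivity
      linarith
    · exact fun ψ h => q1 ψ ⟨h.1, h.2.trans l1⟩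
    · intro ψ h
      have := q2 ψ ⟨h.1, h.2.trans l2⟩
      rw [lt_div_iff₀ hK1p] at this
      rw [← hK1]; linarith
    · intro ψ h
      have := q3 ψ ⟨h.1, h.2.trans l3⟩
      rw [lt_div_iff₀ hK2p] at this
      rw [← hK2]; linarith
  have hrp : 0 < ψ ^ (1 / 2 : ℝ) := Real.rpow_pos_of_pos hψ.1 _
  have h1 : 0 ≤ (x - s) * ψ ^ (1 + α / 2) :=
    mul_nonneg (by linarith) (Real.rpow_nonneg hψ.1.le _)
  refine le_of_forall_pos_le_add fun ε hε => ?_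
  have := key (ε / (κ0 * ψ ^ (1 / 2 : ℝ))) (by positivity)
  refine this.trans ?_
  show κ0 * ((x - s) * (ψ - ψ ^ (1 + α / 2)) + ε / (κ0 * ψ ^ (1 / 2 : ℝ)) * ψ ^ (1 / 2 : ℝ)) ≤ _
  have e1 : κ0 * (ε / (κ0 * ψ ^ (1 / 2 : ℝ)) * ψ ^ (1 / 2 : ℝ)) = ε := by field_simp
  have e2 := mul_nonneg hκp.le h1
  rw [mul_add, e1]
  linarith

/-- doubling conclusion -/
lemma dbl_main {T d0 : ℝ} {f F a : ℝ × ℝ → ℝ} {b0 b c δ0 A α : ℝ} {N : ℕ}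
    (H : DblHyp T d0 f F a b0 c δ0 A α N) (hb : b0 < b) :
    ∃ C, ∀ x ∈ Icc b c, ∀ ψ ∈ Ioc 0 δ0, |Dx f (x, ψ)| ≤ C * ψ := by
  have hin : ∀ t ∈ Icc b0 c, ∀ y ∈ Ioc 0 δ0, (t, y) ∈ Om T d0 := fun t ht y hy =>
    mem_Om (by linarith [ht.1, H.hb0]) (by linarith [ht.2, H.hc]) hy.1 (by linarith [hy.2, H.hδd])
  have H' : DblHyp T d0 (fun z => - f z) (fun z => - F z) a b0 c δ0 A α N := by
    have hd : EqOn (Dx (fun z => - f z)) (fun z => - Dx f z) (Om T d0) := Dx_neg H.hf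
    have hdy : EqOn (Dy (fun z => - f z)) (fun z => - Dy f z) (Om T d0) := Dy_neg H.hf
    have hdyy : EqOn (Dy (Dy (fun z => - f z))) (fun z => - Dy (Dy f) z) (Om T d0) :=
      (Dy_congr hdy).trans (Dy_neg H.hf.dy)
    refine ⟨H.hf.neg, H.hb0, H.hbc, H.hc, H.hδ0, H.hδd, H.hδ1, H.hA, H.hα, ?_, ?_, ?_, ?_, ?_, H.H5, H.H6, H.H7⟩
    · intro x hx ψ hψ
      rw [hd (hin x hx ψ hψ), hdyy (hin x hx ψ hψ)]
      simp only [H.heq x hx ψ hψ]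
      ring
    · intro x hx s hs ψ hψ
      have := H.H1 s hs x hx ψ hψ
      rwa [show - f (x, ψ) - - f (s, ψ) = f (s, ψ) - f (x, ψ) by ring]
    · intro x hx s hs ψ hψ
      have := H.H2 s hs x hx ψ hψ
      rwa [show - f (x, ψ) - - f (s, ψ) = f (s, ψ) - f (x, ψ) by ring, abs_sub_comm x]
    · intro x hx s hs ψ hψ
      have := H.H3 s hs x hx ψ hψ
      rwa [show - f (x, ψ) - - f (s, ψ) = f (s, ψ) - f (x, ψ) by ring,
        show - F (x, ψ) - - F (s, ψ) = F (s, ψ) - F (x, ψ) by ring, abs_sub_comm x]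
    · intro x hx ψ hψ
      rw [abs_neg]; exact H.H4 x hx ψ hψ
  obtain ⟨δ, hδ, hδ0, C, hC, h1⟩ := dbl_one H
  obtain ⟨δ', hδ', hδ0', C', hC', h1'⟩ := dbl_one H'
  obtain ⟨b1, hb1⟩ : ∃ b1, b1 = (b0 + b) / 2 := ⟨_, rfl⟩
  obtain ⟨ζ, hζ⟩ : ∃ ζ, ζ = (b1 - b0) ^ (N + 1) := ⟨_, rfl⟩
  have hb1' : b0 < b1 := by linarith
  have hζ0 : 0 < ζ := by rw [hζ]; exact pow_pos (by linarith) _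
  obtain ⟨e, he⟩ : ∃ e, e = min δ δ' := ⟨_, rfl⟩
  have he0 : 0 < e := by rw [he]; exact lt_min hδ hδ'
  have el : e ≤ δ := by rw [he]; exact min_le_left _ _
  have el' : e ≤ δ' := by rw [he]; exact min_le_right _ _
  have small : ∀ x ∈ Icc b c, ∀ ψ ∈ Ioc 0 e, |Dx f (x, ψ)| ≤ (C + C') / ζ * ψ := by
    intro x hx ψ hψ
    have hxm : x ∈ Icc b0 c := ⟨by linarith [hx.1], hx.2⟩
    have g1 := hasDx (H.hf.da (hin x hxm ψ ⟨hψ.1, hψ.2.trans (el.trans hδ0)⟩))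
    have hψ0 := hψ.1
    have hx1 := hx.1
    have up : ∀ s, b1 < s → s < x → f (x, ψ) - f (s, ψ) ≤ (C + C') / ζ * ψ * (x - s) ∧
        -(f (x, ψ) - f (s, ψ)) ≤ (C + C') / ζ * ψ * (x - s) := by
      intro s hs hsx
      have a1 := h1 s x ψ (by linarith) hsx.le hx.2 ⟨hψ.1, hψ.2.trans el⟩
      have a2 := h1' s x ψ (by linarith) hsx.le hx.2 ⟨hψ.1, hψ.2.trans el'⟩
      have a3 : ζ ≤ (s - b0) ^ (N + 1) := by
        rw [hζ]; exact pow_le_pow_left₀ (by linarith) (by linarith) _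
      have hxs : 0 < x - s := by linarith
      have gen : ∀ D E : ℝ, 0 ≤ E → (s - b0) ^ (N + 1) * D ≤ E * ((x - s) * ψ) →
          D ≤ E / ζ * ψ * (x - s) := by
        intro D E hE hDE
        rcases le_or_gt D 0 with h | h
        · exact h.trans (by positivity)
        · have := mul_le_mul_of_nonneg_right a3 h.le
          rw [show E / ζ * ψ * (x - s) = E * ((x - s) * ψ) / ζ by ring, le_div_iff₀ hζ0]
          linarith
      have k1 : 0 ≤ C' * ((x - s) * ψ) := by positivity
      have k2 : 0 ≤ C * ((x - s) * ψ) := by positivity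
      refine ⟨gen _ (C + C') (by linarith) (by linarith), gen _ (C + C') (by linarith) ?_⟩
      have : -(f (x, ψ) - f (s, ψ)) = -f (x, ψ) - -f (s, ψ) := by ring
      rw [this]; linarith
    rw [abs_le]
    constructor
    · have g2 : HasDerivAt (fun t => f (t, ψ) + (C + C') / ζ * ψ * t)
          (Dx f (x, ψ) + (C + C') / ζ * ψ * 1) x := g1.fun_add ((hasDerivAt_id x).const_mul _)
      have := deriv_nonneg_of_left_max (show b1 < x by linarith) g2 (fun s hs => by
        have := (up s hs.1 hs.2).2
        linarith)
      linarith
    · have g2 : HasDerivAt (fun t => (C + C') / ζ * ψ * t - f (t, ψ))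
          ((C + C') / ζ * ψ * 1 - Dx f (x, ψ)) x := ((hasDerivAt_id x).const_mul _).fun_sub g1
      have := deriv_nonneg_of_left_max (show b1 < x by linarith) g2 (fun s hs => by
        have := (up s hs.1 hs.2).1
        linarith)
      linarith
  have hcomp : IsCompact (Icc b c ×ˢ Icc e δ0) := isCompact_Icc.prod isCompact_Icc
  have hct : ContinuousOn (Dx f) (Icc b c ×ˢ Icc e δ0) :=
    H.hf.dx.continuousOn.mono fun z hz =>
      hin z.1 ⟨by linarith [hz.1.1], hz.1.2⟩ z.2 ⟨he0.trans_le hz.2.1, hz.2.2⟩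
  obtain ⟨B, hB⟩ := hcomp.exists_bound_of_continuousOn hct
  refine ⟨(C + C') / ζ + |B| / e, fun x hx ψ hψ => ?_⟩
  have hψ0 := hψ.1
  rcases le_or_gt ψ e with h | h
  · have := small x hx ψ ⟨hψ.1, h⟩
    have k : 0 ≤ |B| / e * ψ := by positivity
    linarith
  · have h2 := (hB (x, ψ) ⟨hx, h.le, hψ.2⟩).trans (le_abs_self B)
    rw [Real.norm_eq_abs] at h2
    have k : 0 ≤ (C + C') / ζ * ψ := by positivity
    have k2 : |B| ≤ |B| / e * ψ := by
      rw [div_mul_eq_mul_div, le_div_iff₀ he0]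
      exact mul_le_mul_of_nonneg_left h.le (abs_nonneg B)
    linarith

def Bx (b c e : ℝ) : Set (ℝ × ℝ) := Icc b c ×ˢ Ioc 0 e

lemma Bx_sub {T d b c e : ℝ} (hb : 0 < b) (hc : c < T) (he : e < d) : Bx b c e ⊆ Om T d :=
  fun z hz => ⟨⟨hb.trans_le hz.1.1, hz.1.2.trans_lt hc⟩, ⟨hz.2.1, hz.2.2.trans_lt he⟩⟩

def Bd (T d σ : ℝ) (g : ℝ × ℝ → ℝ) : Prop := ∀ b c e, 0 < b → c < T → 0 < e → e < d →
  ∃ C ≥ 0, ∀ z ∈ Bx b c e, |g z| ≤ C * z.2 ^ σ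

def Dom (T d : ℝ) (g h : ℝ × ℝ → ℝ) : Prop := ∀ b c e, 0 < b → c < T → 0 < e → e < d →
  ∃ N : ℕ, ∃ C ≥ 0, ∀ z ∈ Bx b c e, |g z| * z.2 ^ N ≤ C * (1 + |h z|)

section
variable {T d σ τ : ℝ} {f g h k : ℝ × ℝ → ℝ}

lemma Bd.add (hg : Bd T d σ g) (hh : Bd T d σ h) : Bd T d σ (fun z => g z + h z) := by
  intro b c e h1 h2 h3 h4
  obtain ⟨C, hC, k1⟩ := hg b c e h1 h2 h3 h4
  obtain ⟨D, hD, k2⟩ := hh b c e h1 h2 h3 h4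
  refine ⟨C + D, by linarith, fun z hz => ?_⟩
  have := abs_add_le (g z) (h z)
  linarith [k1 z hz, k2 z hz]

lemma Bd.neg (hg : Bd T d σ g) : Bd T d σ (fun z => - g z) := by
  intro b c e h1 h2 h3 h4
  obtain ⟨C, hC, k1⟩ := hg b c e h1 h2 h3 h4
  exact ⟨C, hC, fun z hz => by rw [abs_neg]; exact k1 z hz⟩

lemma Bd.mul (hg : Bd T d σ g) (hh : Bd T d τ h) : Bd T d (σ + τ) (fun z => g z * h z) := by
  intro b c e h1 h2 h3 h4
  obtain ⟨C, hC, k1⟩ := hg b c e h1 h2 h3 h4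
  obtain ⟨D, hD, k2⟩ := hh b c e h1 h2 h3 h4
  refine ⟨C * D, by positivity, fun z hz => ?_⟩
  have hz2 : 0 < z.2 := hz.2.1
  have := mul_le_mul (k1 z hz) (k2 z hz) (abs_nonneg _) (by positivity)
  rw [abs_mul, Real.rpow_add hz2]
  linarith

lemma Bd.mono (hd : d ≤ 1) (hg : Bd T d σ g) (h : τ ≤ σ) : Bd T d τ g := by
  intro b c e h1 h2 h3 h4
  obtain ⟨C, hC, k1⟩ := hg b c e h1 h2 h3 h4
  refine ⟨C, hC, fun z hz => (k1 z hz).trans ?_⟩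
  exact mul_le_mul_of_nonneg_left (Real.rpow_le_rpow_of_exponent_ge hz.2.1
    (by linarith [hz.2.2]) h) hC

lemma Bd.congr (hg : Bd T d σ g) (h1 : EqOn h g (Om T d)) : Bd T d σ h := by
  intro b c e h2 h3 h4 h5
  obtain ⟨C, hC, k1⟩ := hg b c e h2 h3 h4 h5
  exact ⟨C, hC, fun z hz => by rw [h1 (Bx_sub h2 h3 h5 hz)]; exact k1 z hz⟩

lemma Bd.const (r : ℝ) : Bd T d 0 (fun _ => r) := by
  intro b c e h1 h2 h3 h4
  exact ⟨|r|, abs_nonneg r, fun z hz => by simp⟩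

lemma Bd.fst {q : ℝ → ℝ} (hq : Continuous q) : Bd T d 0 (fun z => q z.1) := by
  intro b c e h1 h2 h3 h4
  obtain ⟨C, hC⟩ := (isCompact_Icc (a := b) (b := c)).exists_bound_of_continuousOn hq.continuousOn
  exact ⟨|C|, abs_nonneg C, fun z hz => by simpa using (hC z.1 hz.1).trans (le_abs_self C)⟩

lemma Bd.snd : Bd T d 1 (fun z => z.2) := by
  intro b c e h1 h2 h3 h4
  exact ⟨1, zero_le_one, fun z hz => by rw [Real.rpow_one, one_mul, abs_of_pos hz.2.1]⟩

lemma up_ineq {y g A A' t : ℝ} {N N' : ℕ} (hy : 0 < y) (hy1 : y ≤ 1) (hg : 0 ≤ g) (ht : 0 ≤ t)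
    (h : g * y ^ N ≤ A * t) (hN : N ≤ N') (hA : A ≤ A') : g * y ^ N' ≤ A' * t := by
  have e1 : y ^ N' ≤ y ^ N := pow_le_pow_of_le_one hy.le hy1 hN
  exact (mul_le_mul_of_nonneg_left e1 hg).trans (h.trans (mul_le_mul_of_nonneg_right hA ht))

lemma Dom.add (hd : d ≤ 1) (hg : Dom T d g k) (hh : Dom T d h k) : Dom T d (fun z => g z + h z) k := by
  intro b c e h1 h2 h3 h4
  obtain ⟨N, C, hC, k1⟩ := hg b c e h1 h2 h3 h4
  obtain ⟨N', D, hD, k2⟩ := hh b c e h1 h2 h3 h4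
  refine ⟨N + N', C + D, by linarith, fun z hz => ?_⟩
  have hz1 : z.2 ≤ 1 := by linarith [hz.2.2]
  have ht : 0 ≤ 1 + |k z| := by positivity
  have e1 := up_ineq hz.2.1 hz1 (abs_nonneg _) ht (k1 z hz) (show N ≤ N + N' by omega) le_rfl
  have e2 := up_ineq hz.2.1 hz1 (abs_nonneg _) ht (k2 z hz) (show N' ≤ N + N' by omega) le_rfl
  have e3 := mul_le_mul_of_nonneg_right (abs_add_le (g z) (h z)) (pow_nonneg hz.2.1.le (N + N'))
  linarith

lemma Dom.mul (hg : Dom T d g (fun _ => 0)) (hh : Dom T d h k) : Dom T d (fun z => g z * h z) k := by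
  intro b c e h1 h2 h3 h4
  obtain ⟨N, C, hC, k1⟩ := hg b c e h1 h2 h3 h4
  obtain ⟨N', D, hD, k2⟩ := hh b c e h1 h2 h3 h4
  refine ⟨N + N', C * D, by positivity, fun z hz => ?_⟩
  have hz2 : 0 < z.2 := hz.2.1
  have e1 := k1 z hz
  rw [abs_zero, add_zero, mul_one] at e1
  have := mul_le_mul e1 (k2 z hz) (by positivity) (by positivity)
  rw [abs_mul, pow_add]
  linarith

lemma Dom.congr (hg : Dom T d g k) (h1 : EqOn h g (Om T d)) : Dom T d h k := by
  intro b c e h2 h3 h4 h5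
  obtain ⟨N, C, hC, k1⟩ := hg b c e h2 h3 h4 h5
  exact ⟨N, C, hC, fun z hz => by rw [h1 (Bx_sub h2 h3 h5 hz)]; exact k1 z hz⟩

lemma Dom.mono (hg : Dom T d g h) (h1 : ∀ z ∈ Om T d, |h z| ≤ |k z|) : Dom T d g k := by
  intro b c e h2 h3 h4 h5
  obtain ⟨N, C, hC, k1⟩ := hg b c e h2 h3 h4 h5
  refine ⟨N, C, hC, fun z hz => (k1 z hz).trans ?_⟩
  have := h1 z (Bx_sub h2 h3 h5 hz)
  gcongr

lemma Dom.self : Dom T d g g := by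
  intro b c e h2 h3 h4 h5
  exact ⟨0, 1, zero_le_one, fun z hz => by simp⟩

lemma Dom.of_Pb (hg : Dom T d g (fun _ => 0)) : Dom T d g k :=
  hg.mono fun z hz => by simp

lemma Dom.trans (hg : Dom T d g h) (hh : Dom T d h k) (hd : d ≤ 1) : Dom T d g k := by
  intro b c e h1 h2 h3 h4
  obtain ⟨N, C, hC, k1⟩ := hg b c e h1 h2 h3 h4
  obtain ⟨N', D, hD, k2⟩ := hh b c e h1 h2 h3 h4
  refine ⟨N + N', C * (1 + D), by positivity, fun z hz => ?_⟩
  have hz2 : 0 < z.2 := hz.2.1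
  have e1 := mul_le_mul_of_nonneg_right (k1 z hz) (pow_nonneg hz2.le N')
  have e2 : z.2 ^ N' ≤ 1 := pow_le_one₀ hz2.le (by linarith [hz.2.2])
  have e3 : (1 + |h z|) * z.2 ^ N' ≤ (1 + D) * (1 + |k z|) := by
    have : 0 ≤ |k z| := abs_nonneg _
    linarith [k2 z hz]
  have e4 := mul_le_mul_of_nonneg_left e3 hC
  rw [pow_add]
  linarith

lemma Bd.pb (hg : Bd T d σ g) (hd : d ≤ 1) : Dom T d g k := by
  apply Dom.of_Pb
  intro b c e h1 h2 h3 h4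
  obtain ⟨C, hC, k1⟩ := hg b c e h1 h2 h3 h4
  obtain ⟨N, hN⟩ := exists_nat_ge (-σ)
  refine ⟨N, C, hC, fun z hz => ?_⟩
  have hz2 : 0 < z.2 := hz.2.1
  have e1 := mul_le_mul_of_nonneg_right (k1 z hz) (pow_nonneg hz2.le N)
  have e2 : z.2 ^ σ * z.2 ^ N ≤ 1 := by
    rw [← Real.rpow_natCast, ← Real.rpow_add hz2]
    exact Real.rpow_le_one hz2.le (by linarith [hz.2.2]) (by linarith)
  have e3 := mul_le_mul_of_nonneg_left e2 hC
  simp only [abs_zero]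
  linarith

lemma bern_Pb {a G R : ℝ × ℝ → ℝ} (hd : d ≤ 1) (hG : Sm T d G) (hR : Sm T d R)
    (ha : ∃ A, ∀ z ∈ Om T d, z.2 ≤ A * a z) (ha0 : ∀ z ∈ Om T d, 0 ≤ a z)
    (ha' : ∃ A, ∀ z ∈ Om T d, a z ≤ A)
    (hR0 : Dom T d R (fun _ => 0)) (hR1 : Dom T d (fun z => Dx R z - a z * Dy (Dy R) z) (Dy R))
    (hG1 : Dom T d (fun z => Dx G z - a z * Dy (Dy G) z) (fun z => |G z| + |Dy G z|))
    (hGR : Dom T d G (Dy R)) : Dom T d G (fun _ => 0) := by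
  intro b c e h1 h2 h3 h4
  obtain ⟨A1, m1⟩ := ha
  obtain ⟨A2, m2⟩ := ha'
  obtain ⟨N3, A3, p3, m3⟩ := hR0 (b / 2) c e (by linarith) h2 h3 h4
  obtain ⟨N4, A4, p4, m4⟩ := hR1 (b / 2) c e (by linarith) h2 h3 h4
  obtain ⟨N5, A5, p5, m5⟩ := hG1 (b / 2) c e (by linarith) h2 h3 h4
  obtain ⟨N6, A6, p6, m6⟩ := hGR (b / 2) c e (by linarith) h2 h3 h4
  obtain ⟨A, hA⟩ : ∃ A, A = 1 + |A1| + |A2| + A3 + A4 + A5 + A6 := ⟨_, rfl⟩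
  obtain ⟨N, hN⟩ : ∃ N, N = N3 + N4 + N5 + N6 := ⟨_, rfl⟩
  have q1 := abs_nonneg A1
  have q2 := abs_nonneg A2
  have hin : ∀ x ∈ Icc (b / 2) c, ∀ y ∈ Ioc 0 e, (x, y) ∈ Om T d := fun x hx y hy =>
    Bx_sub (b := b / 2) (by linarith) h2 h4 ⟨hx, hy⟩
  have he1 : e ≤ 1 := by linarith
  obtain ⟨C, hC⟩ := bern_main (a := a) (A := A) (N := N) hG hR (b0 := b / 2) (b := b) (by linarith) (by linarith) h2 h3 h4
    he1 (by linarith)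
    (fun x hx y hy => (m1 _ (hin x hx y hy)).trans (mul_le_mul_of_nonneg_right
      (by linarith [le_abs_self A1]) (ha0 _ (hin x hx y hy))))
    (fun x hx y hy => (m2 _ (hin x hx y hy)).trans (by linarith [le_abs_self A2]))
    (fun x hx y hy => by
      have := up_ineq hy.1 (hy.2.trans he1) (abs_nonneg _) (by positivity) (m3 (x, y) ⟨hx, hy⟩)
        (show N3 ≤ N by omega) (show A3 ≤ A by linarith)
      simpa using this)
    (fun x hx y hy => up_ineq hy.1 (hy.2.trans he1) (abs_nonneg _) (by positivity) (m4 (x, y) ⟨hx, hy⟩)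
        (show N4 ≤ N by omega) (show A4 ≤ A by linarith))
    (fun x hx y hy => by
      have := up_ineq hy.1 (hy.2.trans he1) (abs_nonneg _) (by positivity) (m5 (x, y) ⟨hx, hy⟩)
        (show N5 ≤ N by omega) (show A5 ≤ A by linarith)
      rw [abs_of_nonneg (show 0 ≤ |G (x, y)| + |Dy G (x, y)| by positivity), ← add_assoc] at this
      exact this)
    (fun x hx y hy => up_ineq hy.1 (hy.2.trans he1) (abs_nonneg _) (by positivity) (m6 (x, y) ⟨hx, hy⟩)
        (show N6 ≤ N by omega) (show A6 ≤ A by linarith))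
  refine ⟨4 * N + 3, |C|, abs_nonneg C, fun z hz => ?_⟩
  have := (hC z.1 hz.1 z.2 hz.2).trans (le_abs_self C)
  simpa using this
end

structure VM (T d α m M C0 : ℝ) (p : ℝ → ℝ) (W : ℝ × ℝ → ℝ) : Prop where
  hT : 0 < T
  hd : 0 < d
  hd1 : d ≤ 1
  hα : α ∈ Ioo (0 : ℝ) (1 / 2)
  hm : 0 < m
  hM : m < M
  hC0 : 0 < C0
  hp : ContDiff ℝ (⊤ : ℕ∞) p
  sm : Sm T d W
  lb : ∀ z ∈ Om T d, m * z.2 ≤ W z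
  ub : ∀ z ∈ Om T d, W z ≤ M * z.2
  slb : ∀ z ∈ Om T d, m ≤ Dy W z
  sub : ∀ z ∈ Om T d, Dy W z ≤ M
  eqn : ∀ z ∈ Om T d, Dx W z = Real.sqrt (W z) * Dy (Dy W) z + (-2 * deriv p z.1)
  dxb : ∀ z ∈ Om T d, |Dx W z| ≤ C0 * z.2 ^ (1 / 2 + α)

lemma contDiff_deriv {p : ℝ → ℝ} (hp : ContDiff ℝ (⊤ : ℕ∞) p) : ContDiff ℝ (⊤ : ℕ∞) (deriv p) :=
  ((contDiff_succ_iff_deriv (n := ((⊤ : ℕ∞) : WithTop ℕ∞))).1 (by simpa using hp)).2.2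

lemma Sm.dxn {T d : ℝ} {g : ℝ × ℝ → ℝ} (hg : Sm T d g) (n : ℕ) : Sm T d (Dx^[n] g) := by
  induction n with
  | zero => exact hg
  | succ n ih => rw [Function.iterate_succ_apply']; exact ih.dx

lemma lip_of_dx {T d b c ψ C : ℝ} {g : ℝ × ℝ → ℝ} (hg : Sm T d g) (hb : 0 < b) (hc : c < T)
    (hψ : ψ ∈ Ioo 0 d) (h : ∀ x ∈ Icc b c, |Dx g (x, ψ)| ≤ C) :
    ∀ x ∈ Icc b c, ∀ s ∈ Icc b c, |g (x, ψ) - g (s, ψ)| ≤ C * |x - s| := by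
  intro x hx s hs
  have := (convex_Icc b c).norm_image_sub_le_of_norm_hasDerivWithin_le (f := fun t => g (t, ψ))
    (f' := fun t => Dx g (t, ψ)) (C := C) (fun t ht => (hasDx (hg.da (z := (t, ψ))
      (mem_Om (by linarith [ht.1]) (by linarith [ht.2]) hψ.1 hψ.2))).hasDerivWithinAt)
    (fun t ht => by rw [Real.norm_eq_abs]; exact h t ht) hs hx
  simpa [Real.norm_eq_abs] using this

inductive Alg (T d : ℝ) (W : ℝ × ℝ → ℝ) (K : ℕ) : (ℝ × ℝ → ℝ) → Prop
  | fst (q : ℝ → ℝ) (hq : ContDiff ℝ (⊤ : ℕ∞) q) : Alg T d W K (fun z => q z.1)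
  | w : Alg T d W K W
  | fw (j : ℕ) (hj : j ≤ K) : Alg T d W K (fun z => (Dx^[j] W) z * (1 / W z))
  | add (g h : ℝ × ℝ → ℝ) : Alg T d W K g → Alg T d W K h → Alg T d W K (fun z => g z + h z)
  | mul (g h : ℝ × ℝ → ℝ) : Alg T d W K g → Alg T d W K h → Alg T d W K (fun z => g z * h z)
  | congr (g h : ℝ × ℝ → ℝ) : Alg T d W K g → EqOn h g (Om T d) → Alg T d W K h

noncomputable def FF (p : ℝ → ℝ) (W : ℝ × ℝ → ℝ) : ℕ → (ℝ × ℝ → ℝ)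
  | 0 => fun z => -2 * deriv p z.1
  | K + 1 => fun z => Dx (FF p W K) z + 1 / 2 * (Dx W z * (1 / W z)) * (Dx^[K + 1] W z + -1 * FF p W K z)

section
variable {T d α m M C0 : ℝ} {p : ℝ → ℝ} {W : ℝ × ℝ → ℝ}

lemma VM.wpos (V : VM T d α m M C0 p W) : ∀ z ∈ Om T d, 0 < W z := fun z hz =>
  (mul_pos V.hm hz.2.1).trans_le (V.lb z hz)

lemma VM.wne (V : VM T d α m M C0 p W) : ∀ z ∈ Om T d, W z ≠ 0 := fun z hz => (V.wpos z hz).ne'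

lemma VM.smi (V : VM T d α m M C0 p W) : Sm T d (fun z => 1 / W z) := (Sm.const 1).div V.sm V.wne

lemma VM.dxi (V : VM T d α m M C0 p W) :
    EqOn (Dx (fun z => 1 / W z)) (fun z => -1 * (Dx W z * (1 / W z * (1 / W z)))) (Om T d) := by
  intro z hz
  rw [Dx_div (Sm.const 1) V.sm V.wne hz]
  have := V.wne z hz
  simp only [Dx_const]
  field_simp
  ring

lemma VM.dyi (V : VM T d α m M C0 p W) :
    EqOn (Dy (fun z => 1 / W z)) (fun z => -1 * (Dy W z * (1 / W z * (1 / W z)))) (Om T d) := by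
  intro z hz
  rw [Dy_div (Sm.const 1) V.sm V.wne hz]
  have := V.wne z hz
  simp only [Dy_const]
  field_simp
  ring

lemma VM.algSm (V : VM T d α m M C0 p W) {K : ℕ} {g : ℝ × ℝ → ℝ} (h : Alg T d W K g) : Sm T d g := by
  induction h with
  | fst q hq => exact Sm.fst hq
  | w => exact V.sm
  | fw j hj => exact (V.sm.dxn j).mul V.smi
  | add g h _ _ i1 i2 => exact i1.add i2
  | mul g h _ _ i1 i2 => exact i1.mul i2
  | congr g h _ e i => exact i.congr e

lemma Alg.up {K K' : ℕ} {g : ℝ × ℝ → ℝ} (h : Alg T d W K g) (hK : K ≤ K') : Alg T d W K' g := by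
  induction h with
  | fst q hq => exact .fst q hq
  | w => exact .w
  | fw j hj => exact .fw j (hj.trans hK)
  | add g h _ _ i1 i2 => exact .add _ _ i1 i2
  | mul g h _ _ i1 i2 => exact .mul _ _ i1 i2
  | congr g h _ e i => exact .congr _ _ i e

lemma VM.algDx (V : VM T d α m M C0 p W) {K : ℕ} {g : ℝ × ℝ → ℝ} (h : Alg T d W K g) :
    Alg T d W (K + 1) (Dx g) := by
  induction h with
  | fst q hq =>
    exact .congr _ _ (.fst (deriv q) (contDiff_deriv hq)) (fun z hz => Dx_fst hq z)
  | w =>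
    refine .congr _ _ (.mul _ _ (.fw 1 (by omega)) (.w)) (fun z hz => ?_)
    have := V.wne z hz
    simp only [Function.iterate_one]
    field_simp
  | fw j hj =>
    refine .congr _ _ (.add _ _ (.fw (j + 1) (by omega)) (.mul _ _ (.fst (fun _ => -1) contDiff_const)
      (.mul _ _ (.fw j (by omega)) (.fw 1 (by omega))))) (fun z hz => ?_)
    rw [Dx_mul (V.sm.dxn j) V.smi hz]
    simp only [Function.iterate_one, V.dxi hz, Function.iterate_succ_apply' Dx j]
    ring
  | add g h a b i1 i2 =>
    exact .congr _ _ (.add _ _ i1 i2) (Dx_add (V.algSm a) (V.algSm b))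
  | mul g h a b i1 i2 =>
    refine .congr _ _ (.add _ _ (.mul _ _ i1 (b.up (Nat.le_succ _))) (.mul _ _ (a.up (Nat.le_succ _)) i2))
      (Dx_mul (V.algSm a) (V.algSm b))
  | congr g h _ e i => exact .congr _ _ i (Dx_congr e)

lemma VM.algF (V : VM T d α m M C0 p W) (K : ℕ) : Alg T d W K (FF p W K) := by
  induction K with
  | zero => exact .fst _ (contDiff_const.mul (contDiff_deriv V.hp))
  | succ K ih =>
    refine .add _ _ (V.algDx ih) (.mul _ _ (.mul _ _ (.fst (fun _ => 1 / 2) contDiff_const)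
      (.fw 1 (by omega))) (.add _ _ ?_ (.mul _ _ (.fst (fun _ => -1) contDiff_const) (ih.up (Nat.le_succ _)))))
    refine .congr _ _ (.mul _ _ (.fw (K + 1) le_rfl) (.w)) (fun z hz => ?_)
    have := V.wne z hz
    field_simp

lemma VM.sma (V : VM T d α m M C0 p W) : Sm T d (fun z => Real.sqrt (W z)) := V.sm.sqrt V.wne

lemma VM.eqK (V : VM T d α m M C0 p W) (K : ℕ) : EqOn (Dx (Dx^[K] W))
    (fun z => Real.sqrt (W z) * Dy (Dy (Dx^[K] W)) z + FF p W K z) (Om T d) := by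
  induction K with
  | zero => exact fun z hz => V.eqn z hz
  | succ K ih =>
    intro z hz
    have hg := V.sm.dxn K
    obtain ⟨g, hgd⟩ : ∃ g, g = Dx^[K] W := ⟨_, rfl⟩
    have hF := V.algSm (V.algF K)
    rw [Function.iterate_succ_apply', ← hgd]
    rw [← hgd] at ih hg
    have c1 : EqOn (Dx (Dy (Dy g))) (Dy (Dy (Dx g))) (Om T d) :=
      (Dxy_comm hg.dy).trans (Dy_congr (Dxy_comm hg))
    rw [Dx_congr ih hz, Dx_add (V.sma.mul hg.dy.dy) hF hz]
    simp only [Dx_mul V.sma hg.dy.dy hz, Dx_sqrt V.sm V.wne hz, c1 hz, FF, Function.iterate_succ_apply', ← hgd]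
    have ihz : Dx g z = Real.sqrt (W z) * Dy (Dy g) z + FF p W K z := ih hz
    rw [ihz]
    have hw := V.wpos z hz
    have h2 : Real.sqrt (W z) ≠ 0 := (Real.sqrt_pos.2 hw).ne'
    have h3 : Real.sqrt (W z) * Real.sqrt (W z) = W z := Real.mul_self_sqrt hw.le
    obtain ⟨r, hr⟩ : ∃ r, r = Real.sqrt (W z) := ⟨_, rfl⟩
    rw [← hr] at h2 h3 ⊢
    rw [← h3]
    field_simp
    ring

lemma VM.bW (V : VM T d α m M C0 p W) : Bd T d 1 W := by
  intro b c e h1 h2 h3 h4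
  refine ⟨M, by linarith [V.hm, V.hM], fun z hz => ?_⟩
  have hz' := Bx_sub h1 h2 h4 hz
  rw [abs_of_pos (V.wpos z hz'), Real.rpow_one]
  exact V.ub z hz'

lemma VM.bi (V : VM T d α m M C0 p W) : Bd T d (-1) (fun z => 1 / W z) := by
  intro b c e h1 h2 h3 h4
  refine ⟨1 / m, by have := V.hm; positivity, fun z hz => ?_⟩
  have hz' := Bx_sub h1 h2 h4 hz
  have hw := V.wpos z hz'
  have h5 : 0 < z.2 := hz.2.1
  have hm := V.hm
  rw [abs_of_pos (by positivity), Real.rpow_neg_one, ← one_div, div_mul_div_comm, mul_one]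
  exact one_div_le_one_div_of_le (by positivity) (V.lb z hz')

lemma VM.bdy (V : VM T d α m M C0 p W) : Bd T d 0 (Dy W) := by
  intro b c e h1 h2 h3 h4
  have := V.hm
  have := V.hM
  refine ⟨M, by linarith, fun z hz => ?_⟩
  have hz' := Bx_sub h1 h2 h4 hz
  rw [Real.rpow_zero, mul_one, abs_le]
  exact ⟨by linarith [V.slb z hz'], V.sub z hz'⟩

lemma VM.algBd (V : VM T d α m M C0 p W) {K : ℕ} {g : ℝ × ℝ → ℝ} (h : Alg T d W K g)
    (hB : ∀ j ≤ K, Bd T d 1 (Dx^[j] W)) : Bd T d 0 g := by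
  induction h with
  | fst q hq => exact Bd.fst hq.continuous
  | w => exact V.bW.mono V.hd1 zero_le_one
  | fw j hj =>
    have := (hB j hj).mul V.bi
    rwa [show (1 : ℝ) + -1 = 0 by norm_num] at this
  | add g h _ _ i1 i2 => exact i1.add i2
  | mul g h _ _ i1 i2 =>
    have := i1.mul i2
    rwa [add_zero] at this
  | congr g h _ e i => exact i.congr e

lemma VM.algDy (V : VM T d α m M C0 p W) {K : ℕ} {g : ℝ × ℝ → ℝ} (h : Alg T d W K g)
    (hB : ∀ j ≤ K, Bd T d 1 (Dx^[j] W)) (hD : ∀ j < K, Dom T d (Dy (Dx^[j] W)) (fun _ => 0)) :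
    Dom T d (Dy g) (Dy (Dx^[K] W)) := by
  have hd1 := V.hd1
  induction h with
  | fst q hq => exact ((Bd.const 0).pb hd1).congr (fun z hz => Dy_fst hq z)
  | w => exact V.bdy.pb hd1
  | fw j hj =>
    refine Dom.congr ?_ (Dy_mul (V.sm.dxn j) V.smi)
    have h1 : Dom T d (Dy (Dx^[j] W)) (Dy (Dx^[K] W)) := by
      rcases hj.eq_or_lt with h | h
      · rw [h]; exact Dom.self
      · exact (hD j h).of_Pb
    refine Dom.add hd1 ?_ ?_
    · exact Dom.congr (Dom.mul (V.bi.pb hd1) h1) (fun z hz => mul_comm _ _)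
    · refine Dom.congr (Bd.pb ((hB j hj).mul ((Bd.const (-1)).mul (V.bdy.mul (V.bi.mul V.bi)))) hd1) ?_
      intro z hz
      simp only [V.dyi hz]
  | add g h a b i1 i2 =>
    exact Dom.congr (Dom.add hd1 i1 i2) (Dy_add (V.algSm a) (V.algSm b))
  | mul g h a b i1 i2 =>
    refine Dom.congr (Dom.add hd1 (Dom.mul ((V.algBd b hB).pb hd1) i1)
      (Dom.mul ((V.algBd a hB).pb hd1) i2)) ?_
    intro z hz
    rw [Dy_mul (V.algSm a) (V.algSm b) hz]
    ring
  | congr g h _ e i => exact Dom.congr i (Dy_congr e)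

lemma VM.algDom (V : VM T d α m M C0 p W) {K : ℕ} (hK : 1 ≤ K) {g : ℝ × ℝ → ℝ} (h : Alg T d W K g)
    (hB : ∀ j ≤ K, Bd T d 1 (Dx^[j] W)) : Dom T d (Dx g) (Dx^[K + 1] W) := by
  have hd1 := V.hd1
  induction h with
  | fst q hq => exact ((Bd.fst (contDiff_deriv hq).continuous).pb hd1).congr (fun z hz => Dx_fst hq z)
  | w => exact (hB 1 hK).pb hd1
  | fw j hj =>
    refine Dom.congr ?_ (Dx_mul (V.sm.dxn j) V.smi)
    have h1 : Dom T d (Dx (Dx^[j] W)) (Dx^[K + 1] W) := by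
      rw [← Function.iterate_succ_apply' Dx]
      rcases hj.eq_or_lt with h | h
      · rw [h]; exact Dom.self
      · exact (hB (j + 1) h).pb hd1
    refine Dom.add hd1 ?_ ?_
    · exact Dom.congr (Dom.mul (V.bi.pb hd1) h1) (fun z hz => mul_comm _ _)
    · refine Dom.congr (Bd.pb ((hB j hj).mul ((Bd.const (-1)).mul ((hB 1 hK).mul (V.bi.mul V.bi)))) hd1) ?_
      intro z hz
      simp only [V.dxi hz, Function.iterate_one]
  | add g h a b i1 i2 =>
    exact Dom.congr (Dom.add hd1 i1 i2) (Dx_add (V.algSm a) (V.algSm b))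
  | mul g h a b i1 i2 =>
    refine Dom.congr (Dom.add hd1 (Dom.mul ((V.algBd b hB).pb hd1) i1)
      (Dom.mul ((V.algBd a hB).pb hd1) i2)) ?_
    intro z hz
    rw [Dx_mul (V.algSm a) (V.algSm b) hz]
    ring
  | congr g h _ e i => exact Dom.congr i (Dx_congr e)

def Lp (T d : ℝ) (f g : ℝ × ℝ → ℝ) : Prop := ∀ b c e, 0 < b → c < T → 0 < e → e < d →
  ∃ A ≥ 0, ∀ x ∈ Icc b c, ∀ s ∈ Icc b c, ∀ ψ ∈ Ioc 0 e,
    |g (x, ψ) - g (s, ψ)| * ψ ≤ A * (|x - s| * ψ + |f (x, ψ) - f (s, ψ)|)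

lemma Lp.of_dx {f g : ℝ × ℝ → ℝ} (hg : Sm T d g) (h : Bd T d 0 (Dx g)) : Lp T d f g := by
  intro b c e h1 h2 h3 h4
  obtain ⟨C, hC, k⟩ := h b c e h1 h2 h3 h4
  refine ⟨C, hC, fun x hx s hs ψ hψ => ?_⟩
  have := lip_of_dx hg h1 h2 (ψ := ψ) ⟨hψ.1, by linarith [hψ.2]⟩ (C := C)
    (fun t ht => by simpa using k (t, ψ) ⟨ht, hψ⟩) x hx s hs
  have e1 := mul_le_mul_of_nonneg_right this hψ.1.le
  have : 0 ≤ C * |f (x, ψ) - f (s, ψ)| := by positivity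
  linarith

lemma Lp.mul {f g h : ℝ × ℝ → ℝ} (hg : Lp T d f g) (hh : Lp T d f h) (bg : Bd T d 0 g) (bh : Bd T d 0 h) :
    Lp T d f (fun z => g z * h z) := by
  intro b c e h1 h2 h3 h4
  obtain ⟨C, hC, k⟩ := bg b c e h1 h2 h3 h4
  obtain ⟨C', hC', k'⟩ := bh b c e h1 h2 h3 h4
  obtain ⟨A, hA, l⟩ := hg b c e h1 h2 h3 h4
  obtain ⟨A', hA', l'⟩ := hh b c e h1 h2 h3 h4
  refine ⟨C * A' + C' * A, by positivity, fun x hx s hs ψ hψ => ?_⟩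
  have e1 := l x hx s hs ψ hψ
  have e2 := l' x hx s hs ψ hψ
  have e3 := k (x, ψ) ⟨hx, hψ⟩
  have e4 := k' (s, ψ) ⟨hs, hψ⟩
  rw [Real.rpow_zero, mul_one] at e3 e4
  have hψ0 := hψ.1
  have e5 := mul_le_mul e3 e2 (by positivity) hC
  have e6 := mul_le_mul e4 e1 (by positivity) hC'
  have e7 : g (x, ψ) * h (x, ψ) - g (s, ψ) * h (s, ψ) =
    g (x, ψ) * (h (x, ψ) - h (s, ψ)) + h (s, ψ) * (g (x, ψ) - g (s, ψ)) := by ring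
  have e8 := abs_add_le (g (x, ψ) * (h (x, ψ) - h (s, ψ))) (h (s, ψ) * (g (x, ψ) - g (s, ψ)))
  rw [abs_mul, abs_mul] at e8
  have e9 := mul_le_mul_of_nonneg_right e8 hψ.1.le
  simp only [e7]
  linarith

lemma VM.algLp (V : VM T d α m M C0 p W) {K : ℕ} (hK : 1 ≤ K) {g : ℝ × ℝ → ℝ} (h : Alg T d W K g)
    (hB : ∀ j ≤ K, Bd T d 1 (Dx^[j] W)) : Lp T d (Dx^[K] W) g := by
  have hd1 := V.hd1
  induction h with
  | fst q hq =>
    exact Lp.of_dx (Sm.fst hq) ((Bd.fst (contDiff_deriv hq).continuous).congr fun z hz => Dx_fst hq z)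
  | w => exact Lp.of_dx V.sm ((hB 1 hK).mono hd1 zero_le_one)
  | fw j hj =>
    rcases hj.eq_or_lt with h | h
    · subst h
      intro b c e h1 h2 h3 h4
      have bix : Bd T d (-1) (Dx fun z => 1 / W z) := by
        refine Bd.congr ?_ V.dxi
        have := (Bd.const (T := T) (d := d) (-1)).mul ((hB 1 hK).mul (V.bi.mul V.bi))
        rwa [show (0 : ℝ) + (1 + (-1 + -1)) = -1 by norm_num] at this
      obtain ⟨C, hC, k⟩ := bix b c e h1 h2 h3 h4
      obtain ⟨C1, hC1, k1⟩ := hB j le_rfl b c e h1 h2 h3 h4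
      obtain ⟨C2, hC2, k2⟩ := V.bi b c e h1 h2 h3 h4
      refine ⟨C2 + C1 * C, by positivity, fun x hx s hs ψ hψ => ?_⟩
      have hψ0 := hψ.1
      have e1 := lip_of_dx V.smi h1 h2 (ψ := ψ) ⟨hψ.1, by linarith [hψ.2]⟩ (C := C * ψ ^ (-1 : ℝ))
        (fun t ht => k (t, ψ) ⟨ht, hψ⟩) x hx s hs
      have e2 := k1 (s, ψ) ⟨hs, hψ⟩
      have e3 := k2 (x, ψ) ⟨hx, hψ⟩
      simp only [Real.rpow_neg_one, Real.rpow_one] at e1 e2 e3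
      generalize Dx^[j] W = f at *
      have e4 : f (x, ψ) * (1 / W (x, ψ)) - f (s, ψ) * (1 / W (s, ψ)) =
        (f (x, ψ) - f (s, ψ)) * (1 / W (x, ψ)) + f (s, ψ) * (1 / W (x, ψ) - 1 / W (s, ψ)) := by ring
      have e5 := abs_add_le ((f (x, ψ) - f (s, ψ)) * (1 / W (x, ψ))) (f (s, ψ) * (1 / W (x, ψ) - 1 / W (s, ψ)))
      rw [abs_mul, abs_mul] at e5
      have e6 := mul_le_mul_of_nonneg_left e3 (abs_nonneg (f (x, ψ) - f (s, ψ)))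
      have e7 := mul_le_mul e2 e1 (by positivity) (by positivity)
      have e8 : |f (x, ψ) * (1 / W (x, ψ)) - f (s, ψ) * (1 / W (s, ψ))| ≤
          |f (x, ψ) - f (s, ψ)| * (C2 * ψ⁻¹) + C1 * ψ * (C * ψ⁻¹ * |x - s|) := by
        rw [e4]; linarith
      have e9 := mul_le_mul_of_nonneg_right e8 hψ0.le
      have e10 : (|f (x, ψ) - f (s, ψ)| * (C2 * ψ⁻¹) + C1 * ψ * (C * ψ⁻¹ * |x - s|)) * ψ =
          C2 * |f (x, ψ) - f (s, ψ)| + C1 * C * (|x - s| * ψ) := by field_simp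
      have e11 : 0 ≤ C2 * (|x - s| * ψ) := by positivity
      have e12 : 0 ≤ C1 * C * |f (x, ψ) - f (s, ψ)| := by positivity
      rw [e10] at e9
      refine e9.trans ?_
      linarith
    · refine Lp.of_dx ((V.sm.dxn j).mul V.smi) (Bd.congr ?_ (Dx_mul (V.sm.dxn j) V.smi))
      refine Bd.add ?_ ?_
      · have := (hB (j + 1) h).mul V.bi
        rw [Function.iterate_succ_apply'] at this
        rwa [show (1 : ℝ) + -1 = 0 by norm_num] at this
      · have := (hB j hj).mul ((Bd.const (-1)).mul ((hB 1 hK).mul (V.bi.mul V.bi)))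
        rw [show (1 : ℝ) + (0 + (1 + (-1 + -1))) = 0 by norm_num] at this
        refine this.congr fun z hz => ?_
        simp only [V.dxi hz, Function.iterate_one]
  | add g h a b i1 i2 =>
    intro b c e h1 h2 h3 h4
    obtain ⟨A, hA, l⟩ := i1 b c e h1 h2 h3 h4
    obtain ⟨A', hA', l'⟩ := i2 b c e h1 h2 h3 h4
    refine ⟨A + A', by positivity, fun x hx s hs ψ hψ => ?_⟩
    have e1 := l x hx s hs ψ hψ
    have e2 := l' x hx s hs ψ hψ
    have e3 := mul_le_mul_of_nonneg_right (abs_add_le (g (x, ψ) - g (s, ψ)) (h (x, ψ) - h (s, ψ))) hψ.1.le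
    rw [show g (x, ψ) + h (x, ψ) - (g (s, ψ) + h (s, ψ)) = g (x, ψ) - g (s, ψ) + (h (x, ψ) - h (s, ψ)) by ring]
    linarith
  | mul g h a b i1 i2 => exact i1.mul i2 (V.algBd a hB) (V.algBd b hB)
  | congr g h _ e i =>
    intro b c e' h1 h2 h3 h4
    obtain ⟨A, hA, l⟩ := i b c e' h1 h2 h3 h4
    refine ⟨A, hA, fun x hx s hs ψ hψ => ?_⟩
    rw [e (Bx_sub h1 h2 h4 (show (x, ψ) ∈ Bx b c e' from ⟨hx, hψ⟩)),
      e (Bx_sub h1 h2 h4 (show (s, ψ) ∈ Bx b c e' from ⟨hs, hψ⟩))]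
    exact l x hx s hs ψ hψ
end

section
variable {T d α m M C0 : ℝ} {p : ℝ → ℝ} {W : ℝ × ℝ → ℝ}

lemma VM.sq1 (V : VM T d α m M C0 p W) {z : ℝ × ℝ} (hz : z ∈ Om T d) :
    z.2 ^ (1 / 2 : ℝ) ≤ 1 / Real.sqrt m * Real.sqrt (W z) := by
  have hm := V.hm
  have h2 : 0 < z.2 := hz.2.1
  rw [← Real.sqrt_eq_rpow, div_mul_eq_mul_div, one_mul, le_div_iff₀ (Real.sqrt_pos.2 hm),
    ← Real.sqrt_mul h2.le]
  exact Real.sqrt_le_sqrt (by linarith [V.lb z hz])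

lemma VM.sq2 (V : VM T d α m M C0 p W) {z : ℝ × ℝ} (hz : z ∈ Om T d) :
    Real.sqrt (W z) ≤ Real.sqrt M * z.2 ^ (1 / 2 : ℝ) := by
  have hm := V.hm
  have hM := V.hM
  rw [← Real.sqrt_eq_rpow, ← Real.sqrt_mul (by linarith)]
  exact Real.sqrt_le_sqrt (V.ub z hz)

lemma VM.hzle (V : VM T d α m M C0 p W) {z : ℝ × ℝ} (hz : z ∈ Om T d) :
    z.2 ≤ z.2 ^ (1 / 2 : ℝ) ∧ z.2 ^ (1 / 2 : ℝ) ≤ 1 := by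
  have h2 : 0 < z.2 := hz.2.1
  have h3 : z.2 ≤ 1 := hz.2.2.le.trans V.hd1
  constructor
  · have := Real.rpow_le_rpow_of_exponent_ge h2 h3 (show (1 / 2 : ℝ) ≤ 1 by norm_num)
    rwa [Real.rpow_one] at this
  · exact Real.rpow_le_one h2.le h3 (by norm_num)

lemma VM.ba (V : VM T d α m M C0 p W) : Bd T d (1 / 2) (fun z => Real.sqrt (W z)) := by
  intro b c e h1 h2 h3 h4
  exact ⟨Real.sqrt M, Real.sqrt_nonneg _, fun z hz => by
    rw [abs_of_nonneg (Real.sqrt_nonneg _)]; exact V.sq2 (Bx_sub h1 h2 h4 hz)⟩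

lemma VM.bai (V : VM T d α m M C0 p W) : Bd T d (-(1 / 2)) (fun z => 1 / Real.sqrt (W z)) := by
  intro b c e h1 h2 h3 h4
  refine ⟨1 / Real.sqrt m, by positivity, fun z hz => ?_⟩
  have hz' := Bx_sub h1 h2 h4 hz
  have h5 : 0 < z.2 := hz.2.1
  have h6 := Real.sqrt_pos.2 (V.wpos z hz')
  have h7 := V.sq1 hz'
  have h8 : 0 < z.2 ^ (1 / 2 : ℝ) := by positivity
  rw [abs_of_pos (by positivity), Real.rpow_neg h5.le, div_le_iff₀ h6, mul_right_comm, ← div_eq_mul_inv,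
    le_div_iff₀ h8, one_mul]
  exact h7

lemma VM.dbl (V : VM T d α m M C0 p W) {f F : ℝ × ℝ → ℝ} (hf : Sm T d f)
    (heq : EqOn (Dx f) (fun z => Real.sqrt (W z) * Dy (Dy f) z + F z) (Om T d))
    (H1 : Bd T d 1 f) (H2 : Dom T d (Dx f) (fun _ => 0)) (H3 : Lp T d f F) (H4 : Bd T d 0 F) :
    Bd T d 1 (Dx f) := by
  intro b c e h1 h2 h3 h4
  by_cases hbc : b ≤ c
  swap
  · exact ⟨0, le_rfl, fun z hz => absurd (hz.1.1.trans hz.1.2) hbc⟩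
  have hm := V.hm
  have hM := V.hM
  have hC0 := V.hC0
  have hb2 : 0 < b / 2 := by linarith
  have he1 : e ≤ 1 := by linarith [V.hd1]
  obtain ⟨A1, p1, k1⟩ := H1 (b / 2) c e hb2 h2 h3 h4
  obtain ⟨N, A2, p2, k2⟩ := H2 (b / 2) c e hb2 h2 h3 h4
  obtain ⟨A3, p3, k3⟩ := H3 (b / 2) c e hb2 h2 h3 h4
  obtain ⟨A4, p4, k4⟩ := H4 (b / 2) c e hb2 h2 h3 h4
  obtain ⟨s1, hs1⟩ : ∃ s1, s1 = 1 / Real.sqrt m := ⟨_, rfl⟩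
  obtain ⟨s2, hs2⟩ : ∃ s2, s2 = Real.sqrt M := ⟨_, rfl⟩
  obtain ⟨s3, hs3⟩ : ∃ s3, s3 = C0 / m := ⟨_, rfl⟩
  have q1 : 0 ≤ s1 := by rw [hs1]; positivity
  have q2 : 0 ≤ s2 := by rw [hs2]; positivity
  have q3 : 0 ≤ s3 := by rw [hs3]; positivity
  obtain ⟨A, hA⟩ : ∃ A, A = 1 + 2 * A1 + A2 + A3 + A4 + s1 + s2 + s3 := ⟨_, rfl⟩
  have hin : ∀ x ∈ Icc (b / 2) c, ∀ ψ ∈ Ioc 0 e, (x, ψ) ∈ Om T d := fun x hx ψ hψ =>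
    Bx_sub hb2 h2 h4 (show (x, ψ) ∈ Bx (b / 2) c e from ⟨hx, hψ⟩)
  have H : DblHyp T d f F (fun z => Real.sqrt (W z)) (b / 2) c e A α N := by
    refine ⟨hf, hb2, by linarith, h2, h3, h4, he1, by linarith, V.hα, ?_, ?_, ?_, ?_, ?_, ?_, ?_, ?_⟩
    · exact fun x hx ψ hψ => heq (hin x hx ψ hψ)
    · intro x hx s hs ψ hψ
      have e1 := k1 (x, ψ) ⟨hx, hψ⟩
      have e2 := k1 (s, ψ) ⟨hs, hψ⟩
      rw [Real.rpow_one] at e1 e2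
      simp only at e1 e2
      have e3 := abs_sub (f (x, ψ)) (f (s, ψ))
      have e4 : 2 * A1 * ψ ≤ A * ψ := mul_le_mul_of_nonneg_right (by linarith) hψ.1.le
      linarith
    · intro x hx s hs ψ hψ
      have hψN : 0 < ψ ^ N := pow_pos hψ.1 _
      have := lip_of_dx hf hb2 h2 (ψ := ψ) ⟨hψ.1, by linarith [hψ.2]⟩ (C := A2 / ψ ^ N)
        (fun t ht => by
          rw [le_div_iff₀ hψN]
          simpa using k2 (t, ψ) ⟨ht, hψ⟩) x hx s hs
      have e1 := mul_le_mul_of_nonneg_right this hψN.le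
      rw [mul_right_comm, div_mul_cancel₀ _ hψN.ne'] at e1
      exact e1.trans (mul_le_mul_of_nonneg_right (by linarith) (abs_nonneg _))
    · intro x hx s hs ψ hψ
      have hψ0 := hψ.1
      exact (k3 x hx s hs ψ hψ).trans (mul_le_mul_of_nonneg_right (by linarith) (by positivity))
    · intro x hx ψ hψ
      have := k4 (x, ψ) ⟨hx, hψ⟩
      rw [Real.rpow_zero, mul_one] at this
      linarith
    · intro x hx s hs ψ hψ
      have hψ0 := hψ.1
      have hax := Real.sqrt_pos.2 (V.wpos _ (hin x hx ψ hψ))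
      have has := Real.sqrt_pos.2 (V.wpos _ (hin s hs ψ hψ))
      have hax2 := Real.mul_self_sqrt (V.wpos _ (hin x hx ψ hψ)).le
      have has2 := Real.mul_self_sqrt (V.wpos _ (hin s hs ψ hψ)).le
      have e1 := lip_of_dx V.sm hb2 h2 (ψ := ψ) ⟨hψ.1, by linarith [hψ.2]⟩ (C := C0 * ψ ^ (1 / 2 + α))
        (fun t ht => V.dxb _ (hin t ht ψ hψ)) x hx s hs
      have e0 := V.lb _ (hin s hs ψ hψ)
      simp only at e0
      rw [← hax2, ← has2] at e1
      rw [← has2] at e0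
      generalize Real.sqrt (W (x, ψ)) = ax at *
      generalize Real.sqrt (W (s, ψ)) = as at *
      have e2 : ax * ax - as * as = (ax - as) * (ax + as) := by ring
      rw [e2, abs_mul, abs_of_pos (show 0 < ax + as by linarith)] at e1
      have e3 : |ax - as| * as ≤ |ax - as| * (ax + as) :=
        mul_le_mul_of_nonneg_left (by linarith) (abs_nonneg _)
      have e4 := mul_le_mul_of_nonneg_right (e3.trans e1) has.le
      have e5 := mul_le_mul_of_nonneg_left e0 (abs_nonneg (ax - as))
      have e6 : ψ ^ (1 / 2 + α) = ψ ^ (α - 1 / 2) * ψ := by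
        rw [← Real.rpow_add_one hψ0.ne']; congr 1; ring
      rw [e6] at e4
      obtain ⟨g, hg⟩ : ∃ g, g = ψ ^ (α - 1 / 2) := ⟨_, rfl⟩
      have hg0 : 0 < g := by rw [hg]; positivity
      rw [← hg] at e4 ⊢
      have e7 : |ax - as| * (m * ψ) ≤ (s3 * |x - s| * g * as) * (m * ψ) := by
        have : (s3 * |x - s| * g * as) * (m * ψ) = C0 * (g * ψ) * |x - s| * as := by
          rw [hs3]; field_simp
        rw [this]; linarith
      have e8 := le_of_mul_le_mul_right e7 (by positivity)
      have e9 : s3 * (|x - s| * g * as) ≤ A * (|x - s| * g * as) :=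
        mul_le_mul_of_nonneg_right (by linarith) (by positivity)
      linarith
    · intro x hx ψ hψ
      have := V.sq1 (hin x hx ψ hψ)
      rw [← hs1] at this
      exact this.trans (mul_le_mul_of_nonneg_right (by linarith) (Real.sqrt_nonneg _))
    · intro x hx ψ hψ
      have := V.sq2 (hin x hx ψ hψ)
      rw [← hs2] at this
      exact this.trans (mul_le_mul_of_nonneg_right (by linarith) (Real.rpow_nonneg hψ.1.le _))
  obtain ⟨C, hC⟩ := dbl_main H (show b / 2 < b by linarith)
  refine ⟨|C|, abs_nonneg C, fun z hz => ?_⟩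
  rw [Real.rpow_one]
  exact (hC z.1 hz.1 z.2 hz.2).trans (mul_le_mul_of_nonneg_right (le_abs_self C) hz.2.1.le)

lemma VM.base (V : VM T d α m M C0 p W) : Bd T d 1 (Dx W) := by
  refine V.dbl V.sm (V.eqK 0) V.bW ?_ ?_ (V.algBd (V.algF 0) (fun j hj => ?_))
  · refine Bd.pb (σ := 1 / 2 + α) ?_ V.hd1
    intro b c e h1 h2 h3 h4
    exact ⟨C0, V.hC0.le, fun z hz => V.dxb z (Bx_sub h1 h2 h4 hz)⟩
  · have hq : ContDiff ℝ (⊤ : ℕ∞) (fun x => -2 * deriv p x) := contDiff_const.mul (contDiff_deriv V.hp)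
    exact Lp.of_dx (Sm.fst hq) ((Bd.fst (contDiff_deriv hq).continuous).congr fun z hz => Dx_fst hq z)
  · rw [Nat.le_zero.1 hj]; exact V.bW

lemma VM.dya (V : VM T d α m M C0 p W) :
    EqOn (Dy (fun z => Real.sqrt (W z))) (fun z => 1 / 2 * (Dy W z * (1 / Real.sqrt (W z)))) (Om T d) := by
  intro z hz
  have h2 : Real.sqrt (W z) ≠ 0 := (Real.sqrt_pos.2 (V.wpos z hz)).ne'
  rw [Dy_sqrt V.sm V.wne hz]
  field_simp

lemma VM.dxa (V : VM T d α m M C0 p W) :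
    EqOn (Dx (fun z => Real.sqrt (W z))) (fun z => 1 / 2 * (Dx W z * (1 / Real.sqrt (W z)))) (Om T d) := by
  intro z hz
  have h2 : Real.sqrt (W z) ≠ 0 := (Real.sqrt_pos.2 (V.wpos z hz)).ne'
  rw [Dx_sqrt V.sm V.wne hz]
  field_simp

lemma VM.step (V : VM T d α m M C0 p W) {K : ℕ} (hK : 1 ≤ K) (hB : ∀ j ≤ K, Bd T d 1 (Dx^[j] W))
    (hD : ∀ j < K, Dom T d (Dy (Dx^[j] W)) (fun _ => 0)) :
    Dom T d (Dy (Dx^[K] W)) (fun _ => 0) ∧ Bd T d 1 (Dx^[K + 1] W) := by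
  have hd1 := V.hd1
  have hF := V.algF K
  have hFB := V.algBd hF hB
  have hFs := V.algSm hF
  have hfs := V.sm.dxn K
  have heq := V.eqK K
  have hFy := V.algDy hF hB hD
  have hFx := V.algDom hK hF hB
  have hLp := V.algLp hK hF hB
  have hBK := hB K le_rfl
  have hF1 : EqOn (Dx (Dx^[K+1] W)) _ (Om T d) := V.eqK (K + 1)
  have b1 := hB 1 hK
  rw [Function.iterate_succ_apply'] at hFx hF1 ⊢
  have hFF1 : FF p W (K + 1) = fun z => Dx (FF p W K) z + 1 / 2 * (Dx W z * (1 / W z)) * (Dx (Dx^[K] W) z + -1 * FF p W K z) := by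
    rw [FF, Function.iterate_succ_apply']
  generalize Dx^[K] W = f at *
  generalize FF p W K = F at *
  have day : Dom T d (Dy fun z => Real.sqrt (W z)) (fun _ => 0) :=
    Bd.pb (((Bd.const (1 / 2)).mul (V.bdy.mul V.bai)).congr V.dya) hd1
  have hGeq : EqOn (Dx (Dy f)) (fun z => Real.sqrt (W z) * Dy (Dy (Dy f)) z +
      (Dy (fun z => Real.sqrt (W z)) z * Dy (Dy f) z + Dy F z)) (Om T d) := by
    intro z hz
    rw [Dxy_comm hfs hz, Dy_congr heq hz, Dy_add (V.sma.mul hfs.dy.dy) hFs hz]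
    simp only [Dy_mul V.sma hfs.dy.dy hz]
    ring
  have ha : ∃ A, ∀ z ∈ Om T d, z.2 ≤ A * Real.sqrt (W z) :=
    ⟨1 / Real.sqrt m, fun z hz => (V.hzle hz).1.trans (V.sq1 hz)⟩
  have ha' : ∃ A, ∀ z ∈ Om T d, Real.sqrt (W z) ≤ A :=
    ⟨Real.sqrt M, fun z hz => (V.sq2 hz).trans
      (by have := mul_le_mul_of_nonneg_left (V.hzle hz).2 (Real.sqrt_nonneg M); linarith)⟩
  have ha0 : ∀ z ∈ Om T d, 0 ≤ Real.sqrt (W z) := fun z _ => Real.sqrt_nonneg _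
  have A1 : Dom T d (Dy f) (fun _ => 0) := by
    refine bern_Pb hd1 hfs.dy hfs ha ha0 ha' (hBK.pb hd1) ?_ ?_ Dom.self
    · exact Dom.congr (hFB.pb hd1) fun z hz => by simp only [heq hz]; ring
    · refine Dom.congr (Dom.add hd1 (Dom.mul day ((Dom.self (g := Dy (Dy f))).mono (k := fun z => |Dy f z| + |Dy (Dy f) z|) ?_))
        (hFy.mono (k := fun z => |Dy f z| + |Dy (Dy f) z|) ?_)) fun z hz => by simp only [hGeq hz]; ring
      · intro z hz
        rw [abs_of_nonneg (show 0 ≤ |Dy f z| + |Dy (Dy f) z| by positivity)]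
        linarith [abs_nonneg (Dy f z)]
      · intro z hz
        rw [abs_of_nonneg (show 0 ≤ |Dy f z| + |Dy (Dy f) z| by positivity)]
        linarith [abs_nonneg (Dy (Dy f) z)]
  have A2 : Dom T d (Dx f) (fun _ => 0) := by
    refine bern_Pb hd1 hfs.dx hfs.dy ha ha0 ha' A1 ?_ ?_ ?_
    · refine Dom.congr (Dom.add hd1 (Dom.mul day Dom.self) (hFy.trans A1 hd1).of_Pb)
        fun z hz => by simp only [hGeq hz]; ring
    · have e1 : Dom T d (FF p W (K + 1)) (Dx f) := by
        rw [hFF1]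
        refine Dom.add hd1 hFx (Dom.mul (Bd.pb ((Bd.const (1 / 2)).mul (b1.mul V.bi)) hd1) (Dom.add hd1 Dom.self ?_))
        exact Bd.pb ((Bd.const (-1)).mul hFB) hd1
      refine Dom.congr (e1.mono ?_) fun z hz => by simp only [hF1 hz]; ring
      intro z hz
      rw [abs_of_nonneg (show 0 ≤ |Dx f z| + |Dy (Dx f) z| by positivity)]
      linarith [abs_nonneg (Dy (Dx f) z)]
    · refine Dom.congr (Dom.add hd1 (Dom.mul (V.ba.pb hd1) Dom.self) (hFB.pb hd1)) heq
  exact ⟨A1, V.dbl hfs heq hBK A2 hLp hFB⟩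

lemma VM.all (V : VM T d α m M C0 p W) : ∀ K, 1 ≤ K → (∀ j ≤ K, Bd T d 1 (Dx^[j] W)) ∧
    (∀ j < K, Dom T d (Dy (Dx^[j] W)) (fun _ => 0)) := by
  intro K hK
  induction K, hK using Nat.le_induction with
  | base =>
    constructor
    · intro j hj
      interval_cases j
      · exact V.bW
      · exact V.base
    · intro j hj
      interval_cases j
      exact V.bdy.pb V.hd1
  | succ K hK ih =>
    obtain ⟨h1, h2⟩ := V.step hK ih.1 ih.2
    constructor
    · intro j hj
      rcases Nat.le_succ_iff.1 hj with h | h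
      · exact ih.1 j h
      · rw [h]; exact h2
    · intro j hj
      rcases Nat.lt_succ_iff_lt_or_eq.1 hj with h | h
      · exact ih.2 j h
      · rw [h]; exact h1

lemma VM.bx (V : VM T d α m M C0 p W) (j : ℕ) : Bd T d 1 (Dx^[j] W) :=
  (V.all (j + 1) (by omega)).1 j (by omega)
end

def Kn (T d : ℝ) (ρ : ℝ → ℝ) : ℕ → ℝ → (ℝ × ℝ → ℝ) → Prop
  | 0, σ, g => Bd T d σ g
  | n + 1, σ, g => Bd T d σ g ∧ Kn T d ρ n σ (Dx g) ∧ Kn T d ρ n σ (fun z => ρ z.2 * Dy g z)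

section
variable {T d σ τ : ℝ} {ρ : ℝ → ℝ} {g h : ℝ × ℝ → ℝ} {n : ℕ}

lemma Kn.bd (hg : Kn T d ρ n σ g) : Bd T d σ g := by
  cases n with
  | zero => exact hg
  | succ n => exact hg.1

lemma Kn.congr (hg : Kn T d ρ n σ g) (e : EqOn h g (Om T d)) : Kn T d ρ n σ h := by
  induction n generalizing g h with
  | zero => exact Bd.congr hg e
  | succ n ih =>
    exact ⟨hg.1.congr e, ih hg.2.1 (Dx_congr e), ih hg.2.2 fun z hz => by simp only [Dy_congr e hz]⟩

lemma Kn.down (hg : Kn T d ρ (n + 1) σ g) : Kn T d ρ n σ g := by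
  induction n generalizing g with
  | zero => exact hg.1
  | succ n ih => exact ⟨hg.1, ih hg.2.1, ih hg.2.2⟩

lemma Kn.mono (hd : d ≤ 1) (hg : Kn T d ρ n σ g) (h : τ ≤ σ) : Kn T d ρ n τ g := by
  induction n generalizing g with
  | zero => exact Bd.mono hd hg h
  | succ n ih => exact ⟨hg.1.mono hd h, ih hg.2.1, ih hg.2.2⟩

lemma Sm.rho (hρ : ContDiff ℝ (⊤ : ℕ∞) ρ) (hg : Sm T d g) : Sm T d (fun z => ρ z.2 * Dy g z) :=
  (Sm.snd hρ).mul hg.dy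

lemma Kn.add (hρ : ContDiff ℝ (⊤ : ℕ∞) ρ) (sg : Sm T d g) (sh : Sm T d h)
    (hg : Kn T d ρ n σ g) (hh : Kn T d ρ n σ h) : Kn T d ρ n σ (fun z => g z + h z) := by
  induction n generalizing g h with
  | zero => exact Bd.add hg hh
  | succ n ih =>
    refine ⟨hg.1.add hh.1, (ih sg.dx sh.dx hg.2.1 hh.2.1).congr (Dx_add sg sh), ?_⟩
    refine (ih (sg.rho hρ) (sh.rho hρ) hg.2.2 hh.2.2).congr fun z hz => ?_
    simp only [Dy_add sg sh hz]; ring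

lemma Kn.mul (hρ : ContDiff ℝ (⊤ : ℕ∞) ρ) (sg : Sm T d g) (sh : Sm T d h)
    (hg : Kn T d ρ n σ g) (hh : Kn T d ρ n τ h) : Kn T d ρ n (σ + τ) (fun z => g z * h z) := by
  induction n generalizing g h with
  | zero => exact Bd.mul hg hh
  | succ n ih =>
    refine ⟨hg.1.mul hh.1, ?_, ?_⟩
    · exact (Kn.add hρ (sg.dx.mul sh) (sg.mul sh.dx) (ih sg.dx sh hg.2.1 hh.down)
        (ih sg sh.dx hg.down hh.2.1)).congr (Dx_mul sg sh)
    · refine (Kn.add hρ ((sg.rho hρ).mul sh) (sg.mul (sh.rho hρ)) (ih (sg.rho hρ) sh hg.2.2 hh.down)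
        (ih sg (sh.rho hρ) hg.down hh.2.2)).congr fun z hz => ?_
      simp only [Dy_mul sg sh hz]; ring

lemma Kn.zero : Kn T d ρ n σ (fun _ => 0) := by
  have hb : Bd T d σ (fun _ => (0 : ℝ)) := fun b c e h1 h2 h3 h4 => ⟨0, le_rfl, fun z hz => by simp⟩
  induction n with
  | zero => exact hb
  | succ n ih =>
    exact ⟨hb, ih.congr fun z hz => Dx_const 0 z, ih.congr fun z hz => by simp only [Dy_const, mul_zero]⟩

lemma Kn.fst {q : ℝ → ℝ} (hq : ContDiff ℝ (⊤ : ℕ∞) q) : Kn T d ρ n 0 (fun z => q z.1) := by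
  induction n generalizing q with
  | zero => exact Bd.fst hq.continuous
  | succ n ih =>
    exact ⟨Bd.fst hq.continuous, (ih (contDiff_deriv hq)).congr fun z hz => Dx_fst hq z,
      Kn.zero.congr fun z hz => by simp only [Dy_fst hq, mul_zero]⟩

lemma Kn.const (c : ℝ) : Kn T d ρ n 0 (fun _ => c) := Kn.fst (q := fun _ => c) contDiff_const

lemma Kn.snd : Kn T d id n 1 (fun z => z.2) := by
  induction n with
  | zero => exact Bd.snd
  | succ n ih =>
    refine ⟨Bd.snd, Kn.zero.congr fun z hz => Dx_snd (q := fun t => t) contDiff_id z, ih.congr fun z hz => ?_⟩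
    simp [Dy_snd (q := fun t => t) contDiff_id z]

lemma Sm.sndi : Sm T d (fun z => 1 / z.2) :=
  (Sm.const 1).div (Sm.snd (q := fun t => t) contDiff_id) fun z hz => hz.2.1.ne'

lemma Kn.sndi : Kn T d id n (-1) (fun z => 1 / z.2) := by
  have hb : Bd T d (-1) (fun z => 1 / z.2) := fun b c e h1 h2 h3 h4 => ⟨1, zero_le_one, fun z hz => by
    have : 0 < z.2 := hz.2.1
    show |1 / z.2| ≤ 1 * z.2 ^ (-1 : ℝ)
    rw [Real.rpow_neg_one, one_div, one_mul, abs_of_pos (by positivity)]⟩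
  have s1 : Sm T d (fun z => z.2) := Sm.snd (q := fun t => t) contDiff_id
  have h0 : ∀ z ∈ Om T d, z.2 ≠ 0 := fun z hz => hz.2.1.ne'
  induction n with
  | zero => exact hb
  | succ n ih =>
    refine ⟨hb, Kn.zero.congr fun z hz => ?_, ?_⟩
    · rw [Dx_div (Sm.const 1) s1 h0 hz]
      simp [Dx_const, Dx_snd (q := fun t => t) contDiff_id z]
    · have := (Kn.mul contDiff_id (Sm.const (-1)) Sm.sndi (Kn.const (-1)) ih)
      rw [zero_add] at this
      refine this.congr fun z hz => ?_
      have := h0 z hz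
      simp only [Dy_div (Sm.const 1) s1 h0 hz]
      simp [Dy_const, Dy_snd (q := fun t => t) contDiff_id z]
      field_simp
end

/-- integration lemma -/
lemma int_bound {h h' : ℝ → ℝ} {e C : ℝ} (hC : 0 ≤ C)
    (hd : ∀ t ∈ Ioc 0 e, HasDerivAt h (h' t) t) (hb : ∀ t ∈ Ioc 0 e, |h' t| ≤ C * t ^ (-(1 / 2) : ℝ)) :
    ∀ y ∈ Ioc 0 e, ∀ t ∈ Ioc 0 e, y ≤ t → |h t - h y| ≤ 2 * C * t ^ (1 / 2 : ℝ) := by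
  intro y hy t ht hyt
  have hc : ∀ s ∈ Icc y t, s ∈ Ioc 0 e := fun s hs => ⟨hy.1.trans_le hs.1, hs.2.trans ht.2⟩
  have hr : ∀ s ∈ Icc y t, HasDerivAt (fun s : ℝ => 2 * C * s ^ (1 / 2 : ℝ)) (C * s ^ (-(1 / 2) : ℝ)) s := by
    intro s hs
    have := (Real.hasDerivAt_rpow_const (x := s) (p := (1 / 2 : ℝ)) (Or.inl (hc s hs).1.ne')).const_mul (2 * C)
    refine this.congr_deriv ?_
    norm_num; ring
  have key : ∀ k k' : ℝ → ℝ, (∀ s ∈ Icc y t, HasDerivAt k (k' s) s) → (∀ s ∈ Icc y t, k' s ≤ C * s ^ (-(1 / 2) : ℝ)) →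
      k t - k y ≤ 2 * C * t ^ (1 / 2 : ℝ) := by
    intro k k' h1 h2
    have hm : MonotoneOn (fun s => 2 * C * s ^ (1 / 2 : ℝ) - k s) (Icc y t) := by
      refine monotoneOn_of_hasDerivWithinAt_nonneg (convex_Icc y t) (f' := fun s => C * s ^ (-(1 / 2) : ℝ) - k' s) ?_ ?_ ?_
      · exact fun s hs => ((hr s hs).fun_sub (h1 s hs)).continuousAt.continuousWithinAt
      · exact fun s hs => ((hr s (interior_subset hs)).fun_sub (h1 s (interior_subset hs))).hasDerivWithinAt
      · exact fun s hs => by linarith [h2 s (interior_subset hs)]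
    have := hm ⟨le_rfl, hyt⟩ ⟨hyt, le_rfl⟩ hyt
    have h3 : 0 ≤ 2 * C * y ^ (1 / 2 : ℝ) := by have := hy.1; positivity
    simp only at this
    linarith
  rw [abs_le]
  constructor
  · have := key (fun s => - h s) (fun s => - h' s) (fun s hs => (hd s (hc s hs)).neg)
      (fun s hs => (neg_le_abs _).trans (hb s (hc s hs)))
    linarith
  · exact key h h' (fun s hs => hd s (hc s hs)) (fun s hs => (le_abs_self _).trans (hb s (hc s hs)))

section
variable {T d α m M C0 : ℝ} {p : ℝ → ℝ} {W : ℝ × ℝ → ℝ}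

lemma Bd.of_dy {g : ℝ × ℝ → ℝ} (hg : Sm T d g) (hd1 : d ≤ 1) (h : Bd T d (-(1 / 2)) (Dy g)) : Bd T d 0 g := by
  intro b c e h1 h2 h3 h4
  obtain ⟨C, hC, k⟩ := h b c e h1 h2 h3 h4
  have hct : ContinuousOn (fun x => g (x, e)) (Icc b c) := by
    refine hg.ct.comp (by fun_prop) fun x hx => ?_
    exact mem_Om (by linarith [hx.1]) (by linarith [hx.2]) h3 h4
  obtain ⟨B, hB⟩ := (isCompact_Icc (a := b) (b := c)).exists_bound_of_continuousOn hct
  refine ⟨|B| + 2 * C, by positivity, fun z hz => ?_⟩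
  rw [Real.rpow_zero, mul_one]
  have e1 := int_bound (h := fun t => g (z.1, t)) (h' := fun t => Dy g (z.1, t)) (e := e) hC
    (fun t ht => hasDy (hg.da (z := (z.1, t)) (Bx_sub h1 h2 h4 ⟨hz.1, ht⟩)))
    (fun t ht => k (z.1, t) ⟨hz.1, ht⟩) z.2 hz.2 e ⟨h3, le_rfl⟩ hz.2.2
  have e2 := (hB z.1 hz.1).trans (le_abs_self B)
  rw [Real.norm_eq_abs] at e2
  have e3 : e ^ (1 / 2 : ℝ) ≤ 1 := Real.rpow_le_one h3.le (by linarith) (by norm_num)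
  have e4 := mul_le_mul_of_nonneg_left e3 (show 0 ≤ 2 * C by linarith)
  have e5 : |g z| ≤ |g (z.1, e)| + |g (z.1, e) - g z| := by
    have := abs_sub_abs_le_abs_sub (g z) (g (z.1, e))
    rw [abs_sub_comm] at this
    linarith
  linarith

lemma Dxn_y {g : ℝ × ℝ → ℝ} (hg : Sm T d g) (j : ℕ) : EqOn (Dx^[j] (Dy g)) (Dy (Dx^[j] g)) (Om T d) := by
  induction j with
  | zero => exact fun z hz => rfl
  | succ j ih =>
    intro z hz
    rw [Function.iterate_succ_apply', Function.iterate_succ_apply', Dx_congr ih hz, Dxy_comm (hg.dxn j) hz]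

lemma VM.smai (V : VM T d α m M C0 p W) : Sm T d (fun z => 1 / Real.sqrt (W z)) :=
  (Sm.const 1).div V.sma fun z hz => (Real.sqrt_pos.2 (V.wpos z hz)).ne'

lemma VM.dyx (V : VM T d α m M C0 p W) (j : ℕ) : Bd T d 0 (Dy (Dx^[j] W)) := by
  refine Bd.of_dy (V.sm.dxn j).dy V.hd1 ?_
  have h1 : Bd T d 0 (fun z => Dx (Dx^[j] W) z + -1 * FF p W j z) := by
    have := V.bx (j + 1)
    rw [Function.iterate_succ_apply'] at this
    have h2 := (Bd.const (T := T) (d := d) (-1)).mul (V.algBd (V.algF j) (fun i _ => V.bx i))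
    rw [add_zero] at h2
    exact (this.mono V.hd1 zero_le_one).add h2
  have h3 := V.bai.mul h1
  rw [add_zero] at h3
  refine h3.congr fun z hz => ?_
  have h4 : Real.sqrt (W z) ≠ 0 := (Real.sqrt_pos.2 (V.wpos z hz)).ne'
  simp only [V.eqK j hz]
  field_simp
  ring

lemma VM.Kai (V : VM T d α m M C0 p W) {n : ℕ} (h : Kn T d id n 1 W) :
    Kn T d id n (-(1 / 2)) (fun z => 1 / Real.sqrt (W z)) := by
  induction n with
  | zero => exact V.bai
  | succ n ih =>
    have h1 := ih h.down
    have hne : ∀ z ∈ Om T d, Real.sqrt (W z) ≠ 0 := fun z hz => (Real.sqrt_pos.2 (V.wpos z hz)).ne'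
    have h3 := Kn.mul contDiff_id V.smai (V.smai.mul V.smai) h1 (Kn.mul contDiff_id V.smai V.smai h1 h1)
    have s3 := V.smai.mul (V.smai.mul V.smai)
    have gen : ∀ k, Sm T d k → Kn T d id n 1 k → Kn T d id n (-(1 / 2)) (fun z => -(1 / 2) * (k z *
        (1 / Real.sqrt (W z) * (1 / Real.sqrt (W z) * (1 / Real.sqrt (W z)))))) := by
      intro k sk hk
      have := Kn.mul contDiff_id (Sm.const (-(1 / 2))) (sk.mul s3) (Kn.const (-(1 / 2)))
        (Kn.mul contDiff_id sk s3 hk h3)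
      norm_num at this ⊢
      exact this
    refine ⟨V.bai, (gen _ V.sm.dx h.2.1).congr fun z hz => ?_, (gen _ (V.sm.rho contDiff_id) h.2.2).congr fun z hz => ?_⟩
    · rw [Dx_div (Sm.const 1) V.sma hne hz]
      have := hne z hz
      simp only [Dx_const, V.dxa hz]
      field_simp
      ring
    · have := hne z hz
      simp only [Dy_div (Sm.const 1) V.sma hne hz, Dy_const, V.dya hz]
      field_simp
      ring

lemma VM.KF (V : VM T d α m M C0 p W) {n : ℕ} (hW : ∀ j, Kn T d id n 1 (Dx^[j] W)) {K : ℕ} {g : ℝ × ℝ → ℝ}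
    (h : Alg T d W K g) : Kn T d id n 0 g := by
  have hid : ContDiff ℝ (⊤ : ℕ∞) (id : ℝ → ℝ) := contDiff_id
  induction h with
  | fst q hq => exact Kn.fst hq
  | w => exact (hW 0).mono V.hd1 zero_le_one
  | fw j hj =>
    have h1 := V.Kai (hW 0)
    have := Kn.mul hid (V.sm.dxn j) (V.smai.mul V.smai) (hW j) (Kn.mul hid V.smai V.smai h1 h1)
    rw [show (1 : ℝ) + (-(1 / 2) + -(1 / 2)) = 0 by norm_num] at this
    refine this.congr fun z hz => ?_
    have hw := V.wpos z hz
    have h4 : Real.sqrt (W z) ≠ 0 := (Real.sqrt_pos.2 hw).ne'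
    have h5 := Real.mul_self_sqrt hw.le
    simp only [one_div, ← mul_inv, h5]
  | add g h a b i1 i2 => exact Kn.add hid (V.algSm a) (V.algSm b) i1 i2
  | mul g h a b i1 i2 =>
    have := Kn.mul hid (V.algSm a) (V.algSm b) i1 i2
    rwa [add_zero] at this
  | congr g h _ e i => exact i.congr e

lemma VM.KW (V : VM T d α m M C0 p W) (n : ℕ) : ∀ j, Kn T d id n 1 (Dx^[j] W) ∧
    Kn T d id n 1 (fun z => z.2 * Dy (Dx^[j] W) z) := by
  have hid : ContDiff ℝ (⊤ : ℕ∞) (id : ℝ → ℝ) := contDiff_id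
  have hb : ∀ j, Bd T d 1 (fun z => z.2 * Dy (Dx^[j] W) z) := by
    intro j
    have := (Bd.snd (T := T) (d := d)).mul (V.dyx j)
    rwa [add_zero] at this
  induction n with
  | zero => exact fun j => ⟨V.bx j, hb j⟩
  | succ n ih =>
    intro j
    have s2 : Sm T d (fun z => z.2) := Sm.snd (q := fun t => t) contDiff_id
    have hx : Kn T d id n 1 (Dx (Dx^[j] W)) := by
      have := (ih (j + 1)).1
      rwa [Function.iterate_succ_apply'] at this
    have hF := V.algF j
    refine ⟨⟨V.bx j, hx, (ih j).2⟩, hb j, ?_, ?_⟩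
    · have := (ih (j + 1)).2
      rw [Function.iterate_succ_apply'] at this
      refine this.congr fun z hz => ?_
      rw [Dx_mul s2 (V.sm.dxn j).dy hz]
      simp only [Dx_snd (q := fun t => t) contDiff_id z, Dxy_comm (V.sm.dxn j) hz]
      ring
    · have kF := V.KF (fun j => (ih j).1) hF
      have sF := V.algSm hF
      have hs := (Sm.const (-1)).mul sF
      have k1 : Kn T d id n 0 (fun z => Dx (Dx^[j] W) z + -1 * FF p W j z) := by
        refine Kn.add hid (V.sm.dxn j).dx hs (hx.mono V.hd1 zero_le_one) ?_
        have := Kn.mul hid (Sm.const (-1)) sF (Kn.const (-1)) kF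
        rwa [add_zero] at this
      have sx := (V.sm.dxn j).dx.add hs
      have k2 := Kn.mul hid (s2.mul s2) (V.smai.mul sx) (Kn.mul hid s2 s2 Kn.snd Kn.snd)
        (Kn.mul hid V.smai sx (V.Kai (ih 0).1) k1)
      have k3 := Kn.add hid (s2.mul (V.sm.dxn j).dy) ((s2.mul s2).mul (V.smai.mul sx)) (ih j).2
        (k2.mono V.hd1 (show (1 : ℝ) ≤ _ by norm_num))
      refine k3.congr fun z hz => ?_
      have h4 : Real.sqrt (W z) ≠ 0 := (Real.sqrt_pos.2 (V.wpos z hz)).ne'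
      have e1 := V.eqK j hz
      simp only [Dy_mul s2 (V.sm.dxn j).dy hz, Dy_snd (q := fun t => t) contDiff_id z, e1]
      simp
      field_simp
end

structure CV (T δ α m M C0 : ℝ) (p : ℝ → ℝ) (W : ℝ × ℝ → ℝ) (e c1 c2 : ℝ) (P u : ℝ × ℝ → ℝ) : Prop where
  vm : VM T δ α m M C0 p W
  he1 : e ≤ 1
  sP : Sm T e P
  map : ∀ z ∈ Om T e, (z.1, P z) ∈ Om T δ
  dyP : ∀ z ∈ Om T e, Dy P z = u z
  uW : ∀ z ∈ Om T e, u z = Real.sqrt (W (z.1, P z))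
  hc1 : 0 < c1
  hc2 : 0 < c2
  lbP : ∀ z ∈ Om T e, c1 * z.2 ^ 2 ≤ P z
  ubP : ∀ z ∈ Om T e, P z ≤ c2 * z.2 ^ 2
  c2e : c2 * e ^ 2 ≤ δ

def KK (T d σ : ℝ) (g : ℝ × ℝ → ℝ) : Prop := Sm T d g ∧ ∀ n, Kn T d id n σ g

section
variable {T d σ τ : ℝ} {g h : ℝ × ℝ → ℝ}
lemma KK.mul (hg : KK T d σ g) (hh : KK T d τ h) : KK T d (σ + τ) (fun z => g z * h z) :=
  ⟨hg.1.mul hh.1, fun n => Kn.mul contDiff_id hg.1 hh.1 (hg.2 n) (hh.2 n)⟩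
lemma KK.add (hg : KK T d σ g) (hh : KK T d σ h) : KK T d σ (fun z => g z + h z) :=
  ⟨hg.1.add hh.1, fun n => Kn.add contDiff_id hg.1 hh.1 (hg.2 n) (hh.2 n)⟩
lemma KK.dx (hg : KK T d σ g) : KK T d σ (Dx g) := ⟨hg.1.dx, fun n => (hg.2 (n + 1)).2.1⟩
lemma KK.rho (hg : KK T d σ g) : KK T d σ (fun z => z.2 * Dy g z) :=
  ⟨hg.1.rho contDiff_id, fun n => (hg.2 (n + 1)).2.2⟩
lemma KK.congr (hg : KK T d σ g) (e : EqOn h g (Om T d)) : KK T d σ h :=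
  ⟨hg.1.congr e, fun n => (hg.2 n).congr e⟩
lemma KK.mono (hd : d ≤ 1) (hg : KK T d σ g) (h : τ ≤ σ) : KK T d τ g :=
  ⟨hg.1, fun n => (hg.2 n).mono hd h⟩
lemma KK.const (c : ℝ) : KK T d 0 (fun _ => c) := ⟨Sm.const c, fun n => Kn.const c⟩
lemma KK.fst {q : ℝ → ℝ} (hq : ContDiff ℝ (⊤ : ℕ∞) q) : KK T d 0 (fun z => q z.1) :=
  ⟨Sm.fst hq, fun n => Kn.fst hq⟩
lemma KK.sndi : KK T d (-1) (fun z => 1 / z.2) := ⟨Sm.sndi, fun n => Kn.sndi⟩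
lemma KK.dy (hg : KK T d σ g) : KK T d (σ - 1) (Dy g) := by
  have := KK.sndi.mul hg.rho
  rw [show -1 + σ = σ - 1 by ring] at this
  refine this.congr fun z hz => ?_
  have : z.2 ≠ 0 := hz.2.1.ne'
  field_simp

/-- purely tangential classes -/
lemma kx_iff {n : ℕ} : Kn T d (fun _ => 0) n σ g ↔ ∀ j ≤ n, Bd T d σ (Dx^[j] g) := by
  induction n generalizing g with
  | zero => exact ⟨fun h j hj => by obtain rfl : j = 0 := by omega
                                    exact h, fun h => h 0 le_rfl⟩
  | succ n ih =>
    constructor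
    · intro h j hj
      cases j with
      | zero => exact h.1
      | succ j => exact ih.1 h.2.1 j (by omega)
    · intro h
      refine ⟨h 0 (by omega), ih.2 fun j hj => h (j + 1) (by omega), Kn.zero.congr fun z hz => by simp⟩

lemma lemL (hg : Sm T d g) (h1 : Bd T d 1 g) (h2 : Bd T d 0 (Dx (Dy g))) : Bd T d 1 (Dx g) := by
  intro b c e hb hc he hed
  by_cases hbc : c < b
  · exact ⟨0, le_rfl, fun z hz => absurd (hz.1.1.trans hz.1.2) (by linarith)⟩
  push Not at hbc
  obtain ⟨C, hC, k1⟩ := h1 (b / 2) ((c + T) / 2) e (by linarith) (by linarith) he hed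
  obtain ⟨D, hD, k2⟩ := h2 (b / 2) ((c + T) / 2) e (by linarith) (by linarith) he hed
  simp only [Real.rpow_one, Real.rpow_zero, mul_one] at k1 k2
  refine ⟨D, hD, fun z hz => ?_⟩
  rw [Real.rpow_one]
  have hz1 : z.1 ∈ Icc (b / 2) ((c + T) / 2) := ⟨by linarith [hz.1.1], by linarith [hz.1.2]⟩
  have hsub : ∀ x ∈ Icc (b / 2) ((c + T) / 2), ∀ t ∈ Ioc 0 e, (x, t) ∈ Om T d := fun x hx t ht =>
    mem_Om (by linarith [hx.1]) (by linarith [hx.2]) ht.1 (by linarith [ht.2])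
  have key : ∀ x ∈ Icc (b / 2) ((c + T) / 2), |g (x, z.2) - g z| ≤ D * z.2 * |x - z.1| := by
    intro x hx
    have step : ∀ y ∈ Ioc 0 z.2, |g (x, z.2) - g z| ≤ D * z.2 * |x - z.1| + 2 * C * y := by
      intro y hy
      have hI : ∀ t ∈ Icc y z.2, t ∈ Ioc 0 e := fun t ht => ⟨hy.1.trans_le ht.1, ht.2.trans hz.2.2⟩
      have := (convex_Icc y z.2).norm_image_sub_le_of_norm_hasDerivWithin_le
        (f := fun t => g (x, t) - g (z.1, t)) (f' := fun t => Dy g (x, t) - Dy g (z.1, t)) (C := D * |x - z.1|)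
        (fun t ht => ((hasDy (z := (x, t)) (hg.da (hsub x hx t (hI t ht)))).fun_sub
          (hasDy (z := (z.1, t)) (hg.da (hsub z.1 hz1 t (hI t ht))))).hasDerivWithinAt)
        (fun t ht => lip_of_dx hg.dy (by linarith : 0 < b / 2) (by linarith : (c + T) / 2 < T)
          (mem_Ioo.2 ⟨(hI t ht).1, by linarith [(hI t ht).2]⟩)
          (fun x hx => k2 (x, t) ⟨hx, hI t ht⟩) x hx z.1 hz1) ⟨le_rfl, hy.2⟩ ⟨hy.2, le_rfl⟩
      simp only [Real.norm_eq_abs] at this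
      have a1 := k1 (x, y) ⟨hx, hI y ⟨le_rfl, hy.2⟩⟩
      have a2 := k1 (z.1, y) ⟨hz1, hI y ⟨le_rfl, hy.2⟩⟩
      have a3 := abs_sub (g (x, y)) (g (z.1, y))
      have a4 : |z.2 - y| ≤ z.2 := by rw [abs_of_nonneg (by linarith [hy.2])]; linarith [hy.1]
      have a5 := mul_le_mul_of_nonneg_left a4 (show 0 ≤ D * |x - z.1| by positivity)
      have a6 := abs_sub_abs_le_abs_sub (g (x, z.2) - g z) (g (x, y) - g (z.1, y))
      simp only at a1 a2
      change |g (x, z.2) - g z - (g (x, y) - g (z.1, y))| ≤ _ at this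
      nlinarith
    have hz2 : 0 < z.2 := hz.2.1
    refine le_of_forall_pos_le_add fun ε hε => ?_
    obtain ⟨y, hy⟩ : ∃ q, q = min z.2 (ε / (2 * C + 1)) := ⟨_, rfl⟩
    have hy0 : 0 < y := by rw [hy]; positivity
    have := step y ⟨hy0, hy ▸ min_le_left _ _⟩
    have h3 : y ≤ ε / (2 * C + 1) := hy ▸ min_le_right _ _
    rw [le_div_iff₀ (by linarith)] at h3
    nlinarith
  have hd := hasDx (hg.da (Bx_sub hb hc hed hz))
  have hz2 : 0 < z.2 := hz.2.1
  refine hd.le_of_lip' (C := D * z.2) (by positivity) ?_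
  have : Icc (b / 2) ((c + T) / 2) ∈ nhds z.1 := Icc_mem_nhds (by linarith [hz.1.1]) (by linarith [hz.1.2])
  filter_upwards [this] with x hx
  exact key x hx
end

section
variable {T δ α m M C0 e c1 c2 σ : ℝ} {p : ℝ → ℝ} {W P u g : ℝ × ℝ → ℝ}

lemma CV.smp (H : CV T δ α m M C0 p W e c1 c2 P u) (hg : Sm T δ g) : Sm T e (fun z => g (z.1, P z)) :=
  ContDiffOn.comp (g := g) (f := fun z : ℝ × ℝ => (z.1, P z)) hg (contDiffOn_fst.prodMk H.sP) H.map

lemma CV.chain (H : CV T δ α m M C0 p W e c1 c2 P u) (hg : Sm T δ g) {z : ℝ × ℝ} (hz : z ∈ Om T e) (a : ℝ × ℝ) :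
    fderiv ℝ (fun z => g (z.1, P z)) z a = a.1 * Dx g (z.1, P z) + fderiv ℝ P z a * Dy g (z.1, P z) := by
  have h1 : HasFDerivAt (fun z : ℝ × ℝ => (z.1, P z)) ((ContinuousLinearMap.fst ℝ ℝ ℝ).prod (fderiv ℝ P z)) z :=
    hasFDerivAt_fst.prodMk (H.sP.da hz).hasFDerivAt
  have h2 : HasFDerivAt (fun z => g (z.1, P z)) _ z :=
    HasFDerivAt.comp (g := g) z (hg.da (H.map z hz)).hasFDerivAt h1
  rw [h2.fderiv]
  simp only [ContinuousLinearMap.comp_apply, ContinuousLinearMap.prod_apply, ContinuousLinearMap.coe_fst']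
  have : (a.1, fderiv ℝ P z a) = a.1 • ((1 : ℝ), (0 : ℝ)) + (fderiv ℝ P z a) • ((0 : ℝ), (1 : ℝ)) := by
    ext <;> simp
  rw [this, map_add, map_smul, map_smul]
  rfl

lemma CV.dxp (H : CV T δ α m M C0 p W e c1 c2 P u) (hg : Sm T δ g) :
    EqOn (Dx (fun z => g (z.1, P z))) (fun z => Dx g (z.1, P z) + Dx P z * Dy g (z.1, P z)) (Om T e) := by
  intro z hz
  have := H.chain hg hz (1, 0)
  simp only [one_mul] at this
  exact this

lemma CV.dyp (H : CV T δ α m M C0 p W e c1 c2 P u) (hg : Sm T δ g) :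
    EqOn (Dy (fun z => g (z.1, P z))) (fun z => u z * Dy g (z.1, P z)) (Om T e) := by
  intro z hz
  have := H.chain hg hz (0, 1)
  simp only [zero_mul, zero_add] at this
  simp only [← H.dyP z hz]
  exact this

lemma CV.su (H : CV T δ α m M C0 p W e c1 c2 P u) : Sm T e u := (H.smp H.vm.sma).congr H.uW

lemma CV.upos (H : CV T δ α m M C0 p W e c1 c2 P u) : ∀ z ∈ Om T e, 0 < u z := fun z hz => by
  rw [H.uW z hz]; exact Real.sqrt_pos.2 (H.vm.wpos _ (H.map z hz))

lemma CV.dxu (H : CV T δ α m M C0 p W e c1 c2 P u) : EqOn (Dx u)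
    (fun z => 1 / 2 * (Dx W (z.1, P z) * (1 / u z)) + Dx P z * (1 / 2 * (Dy W (z.1, P z) * (1 / u z)))) (Om T e) := by
  intro z hz
  rw [Dx_congr H.uW hz, H.dxp H.vm.sma hz]
  simp only [H.vm.dxa (H.map z hz), H.vm.dya (H.map z hz), ← H.uW z hz]

lemma CV.dyu (H : CV T δ α m M C0 p W e c1 c2 P u) : EqOn (Dy u)
    (fun z => 1 / 2 * Dy W (z.1, P z)) (Om T e) := by
  intro z hz
  rw [Dy_congr H.uW hz, H.dyp H.vm.sma hz]
  simp only [H.vm.dya (H.map z hz), ← H.uW z hz]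
  have := (H.upos z hz).ne'
  field_simp

lemma CV.dyyu (H : CV T δ α m M C0 p W e c1 c2 P u) : EqOn (Dy (Dy u))
    (fun z => 1 / 2 * Dx W (z.1, P z) + deriv p z.1) (Om T e) := by
  intro z hz
  rw [Dy_congr H.dyu hz, H.dyp ((Sm.const (1 / 2)).mul H.vm.sm.dy) hz]
  simp only [Dy_mul (Sm.const (1 / 2)) H.vm.sm.dy (H.map z hz), Dy_const, H.vm.eqn _ (H.map z hz), ← H.uW z hz]
  ring

lemma CV.dxyP (H : CV T δ α m M C0 p W e c1 c2 P u) : EqOn (Dy (Dx P)) (Dx u) (Om T e) := fun z hz => by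
  rw [← Dxy_comm H.sP hz, Dx_congr H.dyP hz]

lemma CV.dyZ (H : CV T δ α m M C0 p W e c1 c2 P u) : EqOn (Dy (fun z => Dx P z / u z))
    (fun z => 1 / 2 * (Dx W (z.1, P z) * (1 / W (z.1, P z)))) (Om T e) := by
  intro z hz
  have h1 := (H.upos z hz).ne'
  have h2 : W (z.1, P z) = u z ^ 2 := by
    rw [H.uW z hz, Real.sq_sqrt (H.vm.wpos _ (H.map z hz)).le]
  rw [Dy_div H.sP.dx H.su (fun z hz => (H.upos z hz).ne') hz]
  simp only [H.dxyP hz, H.dxu hz, H.dyu hz, h2]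
  field_simp
  ring

lemma CV.prp (H : CV T δ α m M C0 p W e c1 c2 P u) : EqOn (Dy (Dy u))
    (fun z => u z * Dx u z - Dx P z * Dy u z + deriv p z.1) (Om T e) := by
  intro z hz
  have h1 := (H.upos z hz).ne'
  simp only [H.dyyu hz, H.dxu hz, H.dyu hz]
  field_simp
  ring

lemma CV.dyr (H : CV T δ α m M C0 p W e c1 c2 P u) : EqOn (Dy (Dy (Dy u)))
    (fun z => u z * Dx (Dy u) z + -1 * (Dx P z * Dy (Dy u) z)) (Om T e) := by
  intro z hz
  have s1 := H.su
  have s2 := H.sP.dx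
  have hp : ContDiff ℝ (⊤ : ℕ∞) (deriv p) := contDiff_deriv H.vm.hp
  rw [Dy_congr H.prp hz, Dy_add ((s1.mul s1.dx).sub (s2.mul s1.dy)) (Sm.fst hp) hz]
  simp only [Dy_sub (s1.mul s1.dx) (s2.mul s1.dy) hz, Dy_mul s1 s1.dx hz, Dy_mul s2 s1.dy hz, Dy_fst hp,
    H.dxyP hz, Dxy_comm s1 hz]
  ring

lemma CV.bp (H : CV T δ α m M C0 p W e c1 c2 P u) (hg : Bd T δ σ g) :
    Bd T e (2 * σ) (fun z => g (z.1, P z)) := by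
  intro b c r hb hc hr hre
  have hc1 := H.hc1
  have hc2 := H.hc2
  obtain ⟨C, hC, k⟩ := hg b c (c2 * r ^ 2) hb hc (by positivity) (by
    have := H.c2e
    have h3 : r ^ 2 < e ^ 2 := by nlinarith
    nlinarith)
  refine ⟨C * (c1 ^ σ + c2 ^ σ), by positivity, fun z hz => ?_⟩
  have hzO : z ∈ Om T e := Bx_sub hb hc hre hz
  have hz2 : 0 < z.2 := hz.2.1
  have hP := (H.map z hzO).2.1
  simp only at hP
  have hz3 : z.2 ^ 2 ≤ r ^ 2 := by have := hz.2.2; nlinarith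
  have h1 := k (z.1, P z) ⟨hz.1, hP, (H.ubP z hzO).trans (by nlinarith)⟩
  refine h1.trans ?_
  rw [mul_assoc]
  refine mul_le_mul_of_nonneg_left ?_ hC
  have e1 : z.2 ^ (2 * σ) = (z.2 ^ 2) ^ σ := by
    rw [Real.rpow_mul hz2.le]; norm_num
  rw [e1, add_mul, ← Real.mul_rpow hc1.le (by positivity), ← Real.mul_rpow hc2.le (by positivity)]
  rcases le_total 0 σ with h | h
  · have := Real.rpow_le_rpow hP.le (H.ubP z hzO) h
    have h4 : 0 ≤ (c1 * z.2 ^ 2) ^ σ := by positivity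
    simp only; linarith
  · have := Real.rpow_le_rpow_of_nonpos (by positivity) (H.lbP z hzO) h
    have h4 : 0 ≤ (c2 * z.2 ^ 2) ^ σ := by positivity
    simp only; linarith
end

section
variable {T δ α m M C0 e c1 c2 σ : ℝ} {p : ℝ → ℝ} {W P u g : ℝ × ℝ → ℝ}

/-- base bound for `Z = ∂ₓΨ / u`, one sided version -/
lemma CV.baseZ (H : CV T δ α m M C0 p W e c1 c2 P u) {b c r C s : ℝ} (hb : 0 < b) (hc : c < T) (hr : r < e)
    (hC : ∀ z ∈ Bx (b / 2) ((c + T) / 2) r, |Dy (fun z => Dx P z / u z) z| ≤ C) {z : ℝ × ℝ} (hz : z ∈ Bx b c r) :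
    s * (Dx P z / u z) ≤ |s| * C * z.2 := by
  by_contra hcon
  push Not at hcon
  obtain ⟨Z, hZ⟩ : ∃ Z, Z = fun z => Dx P z / u z := ⟨_, rfl⟩
  have sZ : Sm T e Z := hZ ▸ H.sP.dx.div H.su fun z hz => (H.upos z hz).ne'
  rw [← hZ] at hC
  have hcon' : |s| * C * z.2 < s * Z z := by rw [hZ]; exact hcon
  obtain ⟨l, hl⟩ : ∃ l, l = (s * Z z - |s| * C * z.2) / 2 := ⟨_, rfl⟩
  have hl0 : 0 < l := by rw [hl]; linarith
  have hbc : b ≤ c := hz.1.1.trans hz.1.2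
  have hz2 : 0 < z.2 := hz.2.1
  have hzO : z ∈ Om T e := Bx_sub hb hc hr hz
  have hct : ContinuousAt (fun x => s * Z (x, z.2)) z.1 :=
    ((hasDx (sZ.da hzO)).continuousAt).const_mul s
  have hev : ∀ᶠ x in nhds z.1, x ∈ Icc (b / 2) ((c + T) / 2) ∧ s * Z z - l < s * Z (x, z.2) := by
    refine Filter.Eventually.and (Icc_mem_nhds (by linarith [hz.1.1]) (by linarith [hz.1.2])) ?_
    exact hct.eventually (lt_mem_nhds (by simp only; linarith))
  obtain ⟨R, hR, hball⟩ := Metric.eventually_nhds_iff.1 hev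
  have hI : ∀ t ∈ Ioc 0 z.2, t ∈ Ioc 0 r := fun t ht => ⟨ht.1, ht.2.trans hz.2.2⟩
  have hO : ∀ x ∈ Icc (b / 2) ((c + T) / 2), ∀ t ∈ Ioc 0 z.2, (x, t) ∈ Om T e := fun x hx t ht =>
    mem_Om (by linarith [hx.1]) (by linarith [hx.2]) ht.1 (by linarith [(hI t ht).2])
  have hZl : ∀ x, |x - z.1| < R → ∀ t ∈ Ioc 0 z.2, (x, t) ∈ Om T e ∧ l ≤ s * Z (x, t) := by
    intro x hx t ht
    obtain ⟨hx1, hx2⟩ := hball (by rw [Real.dist_eq]; exact hx)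
    refine ⟨hO x hx1 t ht, ?_⟩
    have := (convex_Ioc 0 z.2).norm_image_sub_le_of_norm_hasDerivWithin_le (f := fun t => Z (x, t))
      (f' := fun t => Dy Z (x, t)) (C := C) (fun t ht => (hasDy (z := (x, t)) (sZ.da (hO x hx1 t ht))).hasDerivWithinAt)
      (fun t ht => hC (x, t) ⟨hx1, hI t ht⟩) ht ⟨hz2, le_rfl⟩
    simp only [Real.norm_eq_abs] at this
    have a1 : |s * Z (x, z.2) - s * Z (x, t)| ≤ |s| * (C * |z.2 - t|) := by
      rw [← mul_sub, abs_mul]; exact mul_le_mul_of_nonneg_left this (abs_nonneg s)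
    have hC0 : 0 ≤ C := (abs_nonneg _).trans (hC (x, t) ⟨hx1, hI t ht⟩)
    have a2 : |z.2 - t| ≤ z.2 := by rw [abs_of_nonneg (by linarith [ht.2])]; linarith [ht.1]
    have a3 : |s| * (C * |z.2 - t|) ≤ |s| * (C * z.2) := by gcongr
    have := (abs_le.1 a1).2
    rw [hl] at hx2 ⊢
    linarith
  -- the curve
  obtain ⟨y, hy⟩ : ∃ y, y = min z.2 (l * R / (|s| + 1) / 2) := ⟨_, rfl⟩
  have hy0 : 0 < y := by rw [hy]; positivity
  have hy1 : y ≤ z.2 := hy ▸ min_le_left _ _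
  have hy2 : y ≤ l * R / (|s| + 1) / 2 := hy ▸ min_le_right _ _
  have hzy : (z.1, y) ∈ Om T e := (hZl z.1 (by simpa using hR) y ⟨hy0, hy1⟩).1
  have hPy : 0 < P (z.1, y) := (H.map _ hzy).2.1
  obtain ⟨q, hq⟩ : ∃ q, q = min y (P (z.1, y) / (2 * c2)) := ⟨_, rfl⟩
  have hc2 := H.hc2
  have hq0 : 0 < q := by rw [hq]; positivity
  have hq1 : q ≤ y := hq ▸ min_le_left _ _
  have hq2 : q ≤ P (z.1, y) / (2 * c2) := hq ▸ min_le_right _ _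
  obtain ⟨t1, ht1⟩ : ∃ t1, t1 = (y - q) / l := ⟨_, rfl⟩
  have ht0 : 0 ≤ t1 := by rw [ht1]; exact div_nonneg (by linarith) hl0.le
  have hlt1 : l * t1 = y - q := by rw [ht1]; field_simp
  have hin : ∀ t ∈ Icc 0 t1, |z.1 + s * t - z.1| < R ∧ y - l * t ∈ Ioc 0 z.2 := by
    intro t ht
    have h1 : l * t ≤ y - q := by rw [← hlt1]; exact mul_le_mul_of_nonneg_left ht.2 hl0.le
    have h2 : 0 ≤ l * t := mul_nonneg hl0.le ht.1
    refine ⟨?_, by linarith, by linarith⟩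
    rw [add_sub_cancel_left, abs_mul, abs_of_nonneg ht.1]
    have h3 : l * t < l * R / (|s| + 1) := by
      have : 0 < l * R / (|s| + 1) := by positivity
      linarith
    rw [lt_div_iff₀ (by positivity)] at h3
    have h4 : t * (|s| + 1) < R := by nlinarith
    nlinarith [ht.1, abs_nonneg s]
  have hder : ∀ t ∈ Icc 0 t1, HasDerivAt (fun t => P (z.1 + s * t, y - l * t))
      (s * Dx P (z.1 + s * t, y - l * t) - l * Dy P (z.1 + s * t, y - l * t)) t := by
    intro t ht
    have hm := (hZl _ (hin t ht).1 _ (hin t ht).2).1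
    have h1 : HasDerivAt (fun t : ℝ => (z.1 + s * t, y - l * t)) (s, -l) t := by
      refine HasDerivAt.prodMk ?_ ?_
      · simpa using ((hasDerivAt_id t).const_mul s).const_add z.1
      · simpa using ((hasDerivAt_id t).const_mul l).const_sub y
    have h2 := HasFDerivAt.comp_hasDerivAt t (f := fun t : ℝ => (z.1 + s * t, y - l * t)) (H.sP.da hm).hasFDerivAt h1
    refine h2.congr_deriv ?_
    have : (s, -l) = s • ((1 : ℝ), (0 : ℝ)) + (-l) • ((0 : ℝ), (1 : ℝ)) := by ext <;> simp
    rw [this, map_add, map_smul, map_smul]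
    simp only [smul_eq_mul, Dx, Dy]
    ring
  have hmon : MonotoneOn (fun t => P (z.1 + s * t, y - l * t)) (Icc 0 t1) := by
    refine monotoneOn_of_hasDerivWithinAt_nonneg (convex_Icc 0 t1)
      (fun t ht => (hder t ht).continuousAt.continuousWithinAt)
      (fun t ht => (hder t (interior_subset ht)).hasDerivWithinAt) fun t ht => ?_
    have ht' := interior_subset ht
    obtain ⟨hm, h3⟩ := hZl _ (hin t ht').1 _ (hin t ht').2
    have hu := H.upos _ hm
    rw [H.dyP _ hm]
    have h5 : Dx P (z.1 + s * t, y - l * t) = Z (z.1 + s * t, y - l * t) * u (z.1 + s * t, y - l * t) := by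
      rw [hZ]; exact (div_mul_cancel₀ _ hu.ne').symm
    rw [h5]
    nlinarith
  have hfin := hmon ⟨le_rfl, ht0⟩ ⟨ht0, le_rfl⟩ ht0
  simp only [mul_zero, add_zero, sub_zero] at hfin
  have hm := (hZl _ (hin t1 ⟨ht0, le_rfl⟩).1 _ (hin t1 ⟨ht0, le_rfl⟩).2).1
  have hu := H.ubP _ hm
  simp only [hlt1, sub_sub_cancel] at hu hfin
  rw [le_div_iff₀ (by positivity)] at hq2
  have hq3 : q ≤ 1 := by have := H.he1; linarith [hz.2.2]
  nlinarith [mul_pos hc2 hq0]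
end

section
variable {T δ α m M C0 e c1 c2 σ : ℝ} {p : ℝ → ℝ} {W P u g : ℝ × ℝ → ℝ}

lemma VM.kW (V : VM T δ α m M C0 p W) : KK T δ 1 W := ⟨V.sm, fun n => (V.KW n 0).1⟩

lemma VM.kai (V : VM T δ α m M C0 p W) : KK T δ (-(1 / 2)) (fun z => 1 / Real.sqrt (W z)) :=
  ⟨V.smai, fun n => V.Kai (V.kW.2 n)⟩

lemma VM.ka (V : VM T δ α m M C0 p W) : KK T δ (1 / 2) (fun z => Real.sqrt (W z)) := by
  have := V.kW.mul V.kai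
  rw [show (1 : ℝ) + -(1 / 2) = 1 / 2 by norm_num] at this
  refine this.congr fun z hz => ?_
  have h1 := V.wpos z hz
  have h2 := Real.sqrt_pos.2 h1
  have h3 := Real.mul_self_sqrt h1.le
  simp only
  field_simp
  linarith

lemma VM.ke (V : VM T δ α m M C0 p W) : KK T δ 0 (fun z => 1 / 2 * (Dx W z * (1 / W z))) := by
  have := (KK.const (T := T) (d := δ) (1 / 2)).mul (V.kW.dx.mul (V.kai.mul V.kai))
  rw [show (0 : ℝ) + (1 + (-(1 / 2) + -(1 / 2))) = 0 by norm_num] at this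
  refine this.congr fun z hz => ?_
  have hw := V.wpos z hz
  have h5 := Real.mul_self_sqrt hw.le
  simp only [one_div, ← mul_inv, h5]

lemma CV.bZ (H : CV T δ α m M C0 p W e c1 c2 P u) : Bd T e 1 (fun z => Dx P z / u z) := by
  have h0 : Bd T e 0 (Dy (fun z => Dx P z / u z)) := by
    have := H.bp (H.vm.ke.2 0).bd
    rw [mul_zero] at this
    exact this.congr H.dyZ
  intro b c r hb hc hr hre
  by_cases hbc : c < b
  · exact ⟨0, le_rfl, fun z hz => absurd (hz.1.1.trans hz.1.2) (by linarith)⟩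
  push Not at hbc
  obtain ⟨C, hC, k⟩ := h0 (b / 2) ((c + T) / 2) r (by linarith) (by linarith) hr hre
  simp only [Real.rpow_zero, mul_one] at k
  refine ⟨C, hC, fun z hz => ?_⟩
  have a1 := H.baseZ (s := 1) hb hc hre k hz
  have a2 := H.baseZ (s := -1) hb hc hre k hz
  rw [abs_neg] at a2
  rw [abs_one] at a1 a2
  rw [Real.rpow_one, abs_le]
  constructor <;> linarith

lemma CV.pullK (H : CV T δ α m M C0 p W e c1 c2 P u) {n : ℕ}
    (hZ : ∀ j < n, Bd T e 1 (Dx^[j] (fun z => Dx P z / u z))) {σ : ℝ} {g : ℝ × ℝ → ℝ} (hg : KK T δ σ g) :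
    Kn T e (fun _ => 0) n (2 * σ) (fun z => g (z.1, P z)) := by
  have h0 : ContDiff ℝ (⊤ : ℕ∞) (fun _ : ℝ => (0 : ℝ)) := contDiff_const
  induction n generalizing g σ with
  | zero => exact H.bp (hg.2 0)
  | succ n ih =>
    refine ⟨H.bp (hg.2 0), ?_, Kn.zero.congr fun z hz => by simp⟩
    have hk := hg.dy.mul H.vm.ka
    have sZ : Sm T e (fun z => Dx P z / u z) := H.sP.dx.div H.su fun z hz => (H.upos z hz).ne'
    have k1 := ih (fun j hj => hZ j (by omega)) hg.dx
    have k2 := ih (fun j hj => hZ j (by omega)) hk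
    have k3 : Kn T e (fun _ => 0) n 1 (fun z => Dx P z / u z) := kx_iff.2 fun j hj => hZ j (by omega)
    have k4 := Kn.mul h0 (H.smp hk.1) sZ k2 k3
    rw [show 2 * (σ - 1 + 1 / 2) + 1 = 2 * σ by ring] at k4
    refine (Kn.add h0 (H.smp hg.1.dx) ((H.smp hk.1).mul sZ) k1 k4).congr fun z hz => ?_
    have hu := (H.upos z hz).ne'
    simp only [H.dxp hg.1 hz, ← H.uW z hz]
    field_simp

lemma Dxn_congr {T d : ℝ} {g h : ℝ × ℝ → ℝ} (j : ℕ) (e : EqOn g h (Om T d)) :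
    EqOn (Dx^[j] g) (Dx^[j] h) (Om T d) := by
  induction j generalizing g h with
  | zero => exact e
  | succ j ih => exact ih (Dx_congr e)

lemma CV.allZ (H : CV T δ α m M C0 p W e c1 c2 P u) (n : ℕ) :
    ∀ j ≤ n, Bd T e 1 (Dx^[j] (fun z => Dx P z / u z)) := by
  have sZ : Sm T e (fun z => Dx P z / u z) := H.sP.dx.div H.su fun z hz => (H.upos z hz).ne'
  induction n with
  | zero => intro j hj; obtain rfl : j = 0 := by omega
            exact H.bZ
  | succ n ih =>
    intro j hj
    rcases Nat.lt_or_ge j (n + 1) with h | h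
    · exact ih j (by omega)
    obtain rfl : j = n + 1 := by omega
    rw [Function.iterate_succ_apply']
    refine lemL (sZ.dxn n) (ih n le_rfl) ?_
    have k := kx_iff.1 (H.pullK (n := n + 1) (fun j hj => ih j (by omega)) H.vm.ke) (n + 1) le_rfl
    rw [mul_zero] at k
    refine k.congr fun z hz => ?_
    rw [← Dxn_congr (n + 1) H.dyZ hz, Function.iterate_succ_apply']
    exact (Dx_congr (Dxn_y sZ n) hz).symm

lemma CV.pullX (H : CV T δ α m M C0 p W e c1 c2 P u) (hσ : 0 ≤ σ) (hg : KK T δ σ g) (j : ℕ) :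
    Bd T e 0 (Dx^[j] (fun z => g (z.1, P z))) :=
  (kx_iff.1 (H.pullK (n := j) (fun i hi => H.allZ j i hi.le) hg) j le_rfl).mono H.he1 (by linarith)

lemma CV.xu (H : CV T δ α m M C0 p W e c1 c2 P u) (j : ℕ) : Bd T e 0 (Dx^[j] u) :=
  (H.pullX (by norm_num) H.vm.ka j).congr (Dxn_congr j H.uW)

lemma CV.xq (H : CV T δ α m M C0 p W e c1 c2 P u) (j : ℕ) : Bd T e 0 (Dx^[j] (Dy u)) :=
  (H.pullX (by norm_num) ((KK.const (1 / 2)).mul H.vm.kW.dy) j).congr (Dxn_congr j H.dyu)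

lemma CV.xr (H : CV T δ α m M C0 p W e c1 c2 P u) (j : ℕ) : Bd T e 0 (Dx^[j] (Dy (Dy u))) := by
  have h1 := (KK.const (T := T) (d := δ) (1 / 2)).mul (H.vm.kW.dx.mono H.vm.hd1 zero_le_one)
  rw [zero_add] at h1
  exact (H.pullX le_rfl (h1.add (KK.fst (contDiff_deriv H.vm.hp))) j).congr (Dxn_congr j H.dyyu)

lemma CV.xV (H : CV T δ α m M C0 p W e c1 c2 P u) (j : ℕ) : Bd T e 0 (Dx^[j] (Dx P)) := by
  have sZ : Sm T e (fun z => Dx P z / u z) := H.sP.dx.div H.su fun z hz => (H.upos z hz).ne'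
  have := Kn.mul (contDiff_const (c := 0)) H.su sZ (kx_iff.2 fun i (hi : i ≤ j) => H.xu i) (kx_iff.2 (H.allZ j))
  refine ((kx_iff.1 this j le_rfl).mono H.he1 (by norm_num)).congr (Dxn_congr j fun z hz => ?_)
  have hu := (H.upos z hz).ne'
  field_simp

def JJ (T d : ℝ) (n : ℕ) (g : ℝ × ℝ → ℝ) : Prop := ∀ j, Kn T d (fun _ => 1) n 0 (Dx^[j] g)

variable {d : ℝ} {h : ℝ × ℝ → ℝ} {n : ℕ}

lemma JJ.dx (hg : JJ T d n g) : JJ T d n (Dx g) := fun j => hg (j + 1)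
lemma JJ.congr (hg : JJ T d n g) (e : EqOn h g (Om T d)) : JJ T d n h := fun j => (hg j).congr (Dxn_congr j e)
lemma JJ.add (sg : Sm T d g) (sh : Sm T d h) (hg : JJ T d n g) (hh : JJ T d n h) : JJ T d n (fun z => g z + h z) := by
  intro j
  induction j generalizing g h with
  | zero => exact Kn.add contDiff_const sg sh (hg 0) (hh 0)
  | succ j ih => exact (ih sg.dx sh.dx hg.dx hh.dx).congr (Dxn_congr j (Dx_add sg sh))
lemma Dxn_add (sg : Sm T d g) (sh : Sm T d h) (j : ℕ) :
    EqOn (Dx^[j] (fun z => g z + h z)) (fun z => (Dx^[j] g) z + (Dx^[j] h) z) (Om T d) := by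
  induction j generalizing g h with
  | zero => exact fun z hz => rfl
  | succ j ih =>
    intro z hz
    have h1 : (Dx^[j] (Dx (fun z => g z + h z))) z = (Dx^[j] (fun z => Dx g z + Dx h z)) z :=
      Dxn_congr j (Dx_add sg sh) hz
    exact h1.trans (ih sg.dx sh.dx hz)
lemma JJ.mul (sg : Sm T d g) (sh : Sm T d h) (hg : JJ T d n g) (hh : JJ T d n h) : JJ T d n (fun z => g z * h z) := by
  intro j
  induction j generalizing g h with
  | zero =>
    have := Kn.mul contDiff_const sg sh (hg 0) (hh 0)
    rwa [add_zero] at this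
  | succ j ih =>
    have : Kn T d (fun _ => 1) n 0 (Dx^[j] (fun z => Dx g z * h z + g z * Dx h z)) := by
      have a1 := ih sg.dx sh hg.dx hh
      have a2 := ih sg sh.dx hg hh.dx
      have := Kn.add contDiff_const ((sg.dx.mul sh).dxn j) ((sg.mul sh.dx).dxn j) a1 a2
      exact this.congr (Dxn_add (sg.dx.mul sh) (sg.mul sh.dx) j)
    exact this.congr (Dxn_congr j (Dx_mul sg sh))

lemma JJ.const (c : ℝ) : JJ T d n (fun _ => c) := by
  intro j
  have : ∀ j, ∀ c : ℝ, ∃ c' : ℝ, Dx^[j] (fun _ => c) = fun _ => c' := by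
    intro j
    induction j with
    | zero => exact fun c => ⟨c, rfl⟩
    | succ j ih =>
      intro c
      rw [Function.iterate_succ_apply, show Dx (fun _ => c) = fun _ => 0 from funext (Dx_const c)]
      exact ih 0
  obtain ⟨c', h⟩ := this j c
  rw [h]
  exact Kn.const c'

lemma JJ.succ (sg : Sm T d g) (hg : JJ T d n g) (h : JJ T d n (Dy g)) : JJ T d (n + 1) g := fun j =>
  ⟨(hg j).bd, by have := hg (j + 1); rwa [Function.iterate_succ_apply'] at this,
    (h j).congr fun z hz => by simp only [one_mul]; exact (Dxn_y sg j hz).symm⟩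

lemma JJ.dy (sg : Sm T d g) (hg : JJ T d (n + 1) g) : JJ T d n (Dy g) := fun j =>
  (hg j).2.2.congr fun z hz => by simp only [one_mul]; exact (Dxn_y sg j hz)

lemma CV.jj (H : CV T δ α m M C0 p W e c1 c2 P u) (n : ℕ) : JJ T e n u ∧ JJ T e n (Dy u) ∧ JJ T e n (Dy (Dy u)) ∧
    JJ T e n (Dx P) := by
  have s1 := H.su
  have s2 := H.sP.dx
  induction n with
  | zero => exact ⟨H.xu, H.xq, H.xr, H.xV⟩
  | succ n ih =>
    obtain ⟨a, b, c, d⟩ := ih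
    refine ⟨a.succ s1 b, b.succ s1.dy c, c.succ s1.dy.dy ?_, d.succ s2 (a.dx.congr H.dxyP)⟩
    exact (JJ.add (s1.mul s1.dy.dx) ((Sm.const (-1)).mul (s2.mul s1.dy.dy)) (JJ.mul s1 s1.dy.dx a b.dx)
      (JJ.mul (Sm.const (-1)) (s2.mul s1.dy.dy) (JJ.const (-1)) (JJ.mul s2 s1.dy.dy d c))).congr H.dyr

lemma Sm.dyn (hg : Sm T d g) (k : ℕ) : Sm T d (Dy^[k] g) := by
  induction k with
  | zero => exact hg
  | succ n ih => rw [Function.iterate_succ_apply']; exact ih.dy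

lemma CV.final (H : CV T δ α m M C0 p W e c1 c2 P u) (j k : ℕ) : Bd T e 0 (Dx^[j] (Dy^[k] u)) := by
  have : ∀ n, JJ T e n (Dy^[k] u) := by
    induction k with
    | zero => exact fun n => (H.jj n).1
    | succ k ih =>
      intro n
      rw [Function.iterate_succ_apply']
      exact (ih (n + 1)).dy (H.su.dyn k)
  exact (this 0 j).bd
end

section
variable {T d δ e : ℝ} {W P F : ℝ × ℝ → ℝ}

lemma sm_of_implicit (hW : Sm T δ W) (hpos : ∀ z ∈ Om T δ, 0 < Dy W z) (hF : Sm T e F)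
    (hmap : ∀ z ∈ Om T e, (z.1, P z) ∈ Om T δ) (hE : ∀ z ∈ Om T e, W (z.1, P z) = F z) : Sm T e P := by
  intro z0 hz0
  obtain ⟨a, ha⟩ : ∃ a, a = (z0.1, P z0) := ⟨_, rfl⟩
  have haO : a ∈ Om T δ := ha ▸ hmap z0 hz0
  have hinj : ∀ x s t, (x, s) ∈ Om T δ → (x, t) ∈ Om T δ → W (x, s) = W (x, t) → s = t := by
    intro x s t hs ht h
    have hm : StrictMonoOn (fun t => W (x, t)) (Ioo 0 δ) := by
      have hd : ∀ t ∈ Ioo 0 δ, HasDerivAt (fun t => W (x, t)) (Dy W (x, t)) t := fun t ht' =>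
        hasDy (z := (x, t)) (hW.da ⟨hs.1, ht'⟩)
      refine strictMonoOn_of_deriv_pos (convex_Ioo 0 δ) (fun t ht' => (hd t ht').continuousAt.continuousWithinAt) ?_
      intro t ht'
      rw [interior_Ioo] at ht'
      rw [(hd t ht').deriv]
      exact hpos _ ⟨hs.1, ht'⟩
    exact hm.injOn hs.2 ht.2 h
  obtain ⟨f, hf⟩ : ∃ f : ℝ × ℝ → ℝ × ℝ, f = fun z => (z.1, W z) := ⟨_, rfl⟩
  have hfs : ContDiffAt ℝ (⊤ : ℕ∞) f a := hf ▸ contDiffAt_fst.prodMk (hW.cdAt haO)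
  obtain ⟨A, hA⟩ : ∃ A, A = Dx W a := ⟨_, rfl⟩
  obtain ⟨B, hB⟩ : ∃ B, B = Dy W a := ⟨_, rfl⟩
  have hB0 : B ≠ 0 := by rw [hB]; exact (hpos a haO).ne'
  let fst := ContinuousLinearMap.fst ℝ ℝ ℝ
  let snd := ContinuousLinearMap.snd ℝ ℝ ℝ
  let L : (ℝ × ℝ) ≃L[ℝ] (ℝ × ℝ) := ContinuousLinearEquiv.equivOfInverse (fst.prod (A • fst + B • snd))
    (fst.prod (B⁻¹ • (snd - A • fst)))
    (fun z => by ext <;> simp [fst, snd]; field_simp) (fun z => by ext <;> simp [fst, snd]; field_simp; ring)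
  have hL : HasFDerivAt f (L : (ℝ × ℝ) →L[ℝ] (ℝ × ℝ)) a := by
    have h1 : HasFDerivAt f (fst.prod (fderiv ℝ W a)) a := hf ▸ hasFDerivAt_fst.prodMk (hW.da haO).hasFDerivAt
    have h2 : fderiv ℝ W a = A • fst + B • snd := by
      ext
      · simp [fst, snd, hA, Dx]
      · simp [fst, snd, hB, Dy]
    rw [h2] at h1
    exact h1
  have h1n : (1 : WithTop ℕ∞) ≤ ((⊤ : ℕ∞) : WithTop ℕ∞) := by exact_mod_cast le_top
  have hst := hfs.hasStrictFDerivAt' hL (by simp)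
  obtain ⟨S, hS⟩ : ∃ S, S = hst.localInverse f L a := ⟨_, rfl⟩
  have hSs : ContDiffAt ℝ (⊤ : ℕ∞) S (f a) := hS ▸ hfs.to_localInverse hL (by simp)
  have hSa : S (f a) = a := by rw [hS]; exact hst.localInverse_apply_image
  have hSr : ∀ᶠ y in nhds (f a), f (S y) = y := by rw [hS]; exact hst.eventually_right_inverse
  have hfa : f a = (z0.1, F z0) := by rw [hf]; simp only; rw [ha, hE z0 hz0]
  obtain ⟨G, hG⟩ : ∃ G : ℝ × ℝ → ℝ × ℝ, G = fun z => (z.1, F z) := ⟨_, rfl⟩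
  have hGs : ContDiffAt ℝ (⊤ : ℕ∞) G z0 := hG ▸ contDiffAt_fst.prodMk (hF.cdAt hz0)
  have hG0 : G z0 = f a := by rw [hfa, hG]
  have hSO : ∀ᶠ y in nhds (f a), S y ∈ Om T δ :=
    hSs.continuousAt.eventually_mem (by rw [hSa]; exact (isOpen_Om T δ).mem_nhds haO)
  have hGt : Filter.Tendsto G (nhds z0) (nhds (f a)) := hG0 ▸ hGs.continuousAt
  have hev : (fun z => (S (G z)).2) =ᶠ[nhds z0] P := by
    filter_upwards [hGt.eventually hSr, hGt.eventually hSO, (isOpen_Om T e).mem_nhds hz0] with z h1 h2 h3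
    rw [hf, hG] at h1
    simp only [Prod.mk.injEq] at h1
    rw [hG]
    have h4 : S (z.1, F z) = (z.1, (S (z.1, F z)).2) := Prod.ext h1.1 rfl
    rw [hG] at h2
    simp only at h2
    refine hinj z.1 _ _ ?_ (hmap z h3) ?_
    · simp only; rw [← h4]; exact h2
    · simp only; rw [← h4, h1.2, hE z h3]
  have : ContDiffAt ℝ (⊤ : ℕ∞) (fun z => (S (G z)).2) z0 :=
    contDiffAt_snd.comp z0 (ContDiffAt.comp (g := S) z0 (hG0 ▸ hSs) hGs)
  exact (this.congr_of_eventuallyEq hev.symm).contDiffWithinAt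

lemma itDy {f : ℝ → ℝ → ℝ} (hf : Sm T d (fun z => f z.1 z.2)) (m : ℕ) :
    ∀ z ∈ Om T d, iteratedDeriv m (f z.1) z.2 = (Dy^[m] (fun z => f z.1 z.2)) z := by
  induction m with
  | zero => intro z hz; simp
  | succ m ih =>
    intro z hz
    rw [iteratedDeriv_succ, Function.iterate_succ_apply']
    have h1 : iteratedDeriv m (f z.1) =ᶠ[nhds z.2] fun t => (Dy^[m] (fun z => f z.1 z.2)) (z.1, t) := by
      filter_upwards [isOpen_Ioo.mem_nhds hz.2] with t ht
      exact ih (z.1, t) ⟨hz.1, ht⟩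
    rw [h1.deriv_eq]
    exact (hasDy ((hf.dyn m).da hz)).deriv

lemma pd_eq {f : ℝ → ℝ → ℝ} (hf : Sm T d (fun z => f z.1 z.2)) (k m : ℕ) :
    ∀ z ∈ Om T d, pd k m f z.1 z.2 = (Dx^[k] (Dy^[m] (fun z => f z.1 z.2))) z := by
  unfold pd
  induction k with
  | zero => intro z hz; simpa using itDy hf m z hz
  | succ k ih =>
    intro z hz
    rw [iteratedDeriv_succ, Function.iterate_succ_apply']
    have h1 : iteratedDeriv k (fun x' => iteratedDeriv m (f x') z.2) =ᶠ[nhds z.1]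
        fun t => (Dx^[k] (Dy^[m] (fun z => f z.1 z.2))) (t, z.2) := by
      filter_upwards [isOpen_Ioo.mem_nhds hz.1] with t ht
      exact ih (t, z.2) ⟨ht, hz.2⟩
    rw [h1.deriv_eq]
    exact (hasDx (((hf.dyn m).dxn k).da hz)).deriv

lemma VM.of_ole {X : ℝ} {p : ℝ → ℝ} {w : ℝ → ℝ → ℝ} {α m M C₀ δ₁ : ℝ} (H : OleinikSolution X p w α m M C₀ δ₁) :
    VM X δ₁ α m M C₀ p (fun z => w z.1 z.2) := by
  have hsub : Om X δ₁ ⊆ Ioc 0 X ×ˢ Ioi 0 := fun z hz => ⟨⟨hz.1.1, hz.1.2.le⟩, hz.2.1⟩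
  have hs : Sm X δ₁ (fun z => w z.1 z.2) := H.smooth.mono hsub
  have i1 : ∀ z ∈ Om X δ₁, z.1 ∈ Icc 0 X := fun z hz => ⟨hz.1.1.le, hz.1.2.le⟩
  have i2 : ∀ z ∈ Om X δ₁, z.2 ∈ Icc 0 δ₁ := fun z hz => ⟨hz.2.1.le, hz.2.2.le⟩
  have i3 : ∀ z ∈ Om X δ₁, z.2 ∈ Ioc 0 δ₁ := fun z hz => ⟨hz.2.1, hz.2.2.le⟩
  refine ⟨H.hX, H.hδ₁.1, H.hδ₁.2.le, H.hα, H.hm, H.hmM, H.hC₀, H.hp, hs, ?_, ?_, ?_, ?_, ?_, ?_⟩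
  · exact fun z hz => (H.growth_lb z.1 (i1 z hz) z.2 (i3 z hz)).le
  · exact fun z hz => (H.growth_ub z.1 (i1 z hz) z.2 (i3 z hz)).le
  · intro z hz
    have := (H.slope_lb z.1 (i1 z hz) z.2 (i2 z hz)).le
    rwa [pd_eq hs 0 1 z hz] at this
  · intro z hz
    have := (H.slope_ub z.1 (i1 z hz) z.2 (i2 z hz)).le
    rwa [pd_eq hs 0 1 z hz] at this
  · intro z hz
    have := H.eqn z.1 (hsub hz).1 z.2 (hsub hz).2
    rw [pd_eq hs 1 0 z hz, pd_eq hs 0 2 z hz] at this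
    simp only [Function.iterate_succ, Function.iterate_zero, Function.comp, id] at this
    linarith
  · intro z hz
    have := H.dx_bound z.1 (i1 z hz) z.2 (i2 z hz)
    rwa [pd_eq hs 1 0 z hz] at this
end

lemma prim_facts {f : ℝ → ℝ} {m M y : ℝ} (hm : 0 < m) (hM : 0 < M) (hc : ContinuousOn f (Ici 0))
    (hpos : ∀ t > 0, 0 < f t) (hy : 0 < y) :
    HasDerivAt (fun t => ∫ s in (0 : ℝ)..t, f s) (f y) y ∧ 0 < (∫ s in (0 : ℝ)..y, f s) ∧
    ((∀ t ∈ Ioo 0 y, m * (∫ s in (0 : ℝ)..t, f s) ≤ f t ^ 2 ∧ f t ^ 2 ≤ M * (∫ s in (0 : ℝ)..t, f s)) →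
      m / 4 * y ^ 2 ≤ (∫ s in (0 : ℝ)..y, f s) ∧ (∫ s in (0 : ℝ)..y, f s) ≤ M / 4 * y ^ 2) := by
  have hF : Continuous (fun t => f (max t 0)) :=
    hc.comp_continuous (by fun_prop) fun t => le_max_right t 0
  obtain ⟨G, hG⟩ : ∃ G : ℝ → ℝ, G = fun t => ∫ s in (0 : ℝ)..t, f (max s 0) := ⟨_, rfl⟩
  have hGd : ∀ t, HasDerivAt G (f (max t 0)) t := fun t => by
    rw [hG]
    exact intervalIntegral.integral_hasDerivAt_right (hF.intervalIntegrable _ _)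
      (hF.stronglyMeasurableAtFilter _ _) hF.continuousAt
  have hGe : ∀ t, 0 ≤ t → ∫ s in (0 : ℝ)..t, f s = G t := fun t ht => by
    rw [hG]
    refine intervalIntegral.integral_congr fun s hs => ?_
    rw [uIcc_of_le ht] at hs
    simp [hs.1]
  have hG0 : G 0 = 0 := by rw [hG]; simp
  have hGc : Continuous G := continuous_iff_continuousAt.2 fun t => (hGd t).continuousAt
  have hGp : ∀ t > 0, 0 < G t := by
    have hm : StrictMonoOn G (Ici 0) := by
      refine strictMonoOn_of_deriv_pos (convex_Ici 0) hGc.continuousOn fun t ht => ?_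
      rw [interior_Ici] at ht
      rw [(hGd t).deriv, max_eq_left (le_of_lt ht)]
      exact hpos t ht
    intro t ht
    have := hm (mem_Ici.2 le_rfl) (mem_Ici.2 ht.le) ht
    rwa [hG0] at this
  refine ⟨?_, by rw [hGe y hy.le]; exact hGp y hy, ?_⟩
  · have h1 := hGd y
    rw [max_eq_left hy.le] at h1
    refine h1.congr_of_eventuallyEq ?_
    filter_upwards [lt_mem_nhds hy] with t ht
    exact hGe t ht.le
  · intro h
    rw [hGe y hy.le]
    have hsq : ∀ t ∈ Ioo 0 y, HasDerivAt (fun t => Real.sqrt (G t)) (f t / (2 * Real.sqrt (G t))) t := by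
      intro t ht
      have := (hGd t).sqrt (hGp t ht.1).ne'
      rwa [max_eq_left ht.1.le] at this
    have hsc : ContinuousOn (fun t => Real.sqrt (G t)) (Icc 0 y) := hGc.sqrt.continuousOn
    have hdo : DifferentiableOn ℝ (fun t => Real.sqrt (G t)) (interior (Icc 0 y)) := by
      rw [interior_Icc]; exact fun t ht => (hsq t ht).differentiableAt.differentiableWithinAt
    have hfl : ∀ t ∈ Ioo 0 y, Real.sqrt m * Real.sqrt (G t) ≤ f t ∧ f t ≤ Real.sqrt M * Real.sqrt (G t) := by
      intro t ht
      have h1 := h t ht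
      rw [hGe t ht.1.le] at h1
      rw [← Real.sqrt_mul hm.le, ← Real.sqrt_mul hM.le]
      have h2 := (hpos t ht.1).le
      exact ⟨Real.sqrt_le_iff.2 ⟨h2, h1.1⟩, Real.le_sqrt_of_sq_le h1.2⟩
    have e1 := (convex_Icc 0 y).mul_sub_le_image_sub_of_le_deriv hsc hdo (C := Real.sqrt m / 2) (by
      intro t ht
      rw [interior_Icc] at ht
      have := Real.sqrt_pos.2 (hGp t ht.1)
      rw [(hsq t ht).deriv, le_div_iff₀ (by positivity)]
      linarith [(hfl t ht).1]) 0 ⟨le_rfl, hy.le⟩ y ⟨hy.le, le_rfl⟩ hy.le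
    have e2 := (convex_Icc 0 y).image_sub_le_mul_sub_of_deriv_le hsc hdo (C := Real.sqrt M / 2) (by
      intro t ht
      rw [interior_Icc] at ht
      have := Real.sqrt_pos.2 (hGp t ht.1)
      rw [(hsq t ht).deriv, div_le_iff₀ (by positivity)]
      linarith [(hfl t ht).2]) 0 ⟨le_rfl, hy.le⟩ y ⟨hy.le, le_rfl⟩ hy.le
    simp only [hG0, Real.sqrt_zero, sub_zero] at e1 e2
    have h3 := Real.sq_sqrt (hGp y hy).le
    have h4 := Real.sq_sqrt hm.le
    have h5 := Real.sq_sqrt hM.le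
    have h6 := Real.sqrt_nonneg m
    have h7 := Real.sqrt_nonneg M
    have h8 := Real.sqrt_nonneg (G y)
    constructor
    · have := mul_self_le_mul_self (by positivity) e1
      nlinarith
    · have := mul_self_le_mul_self (by positivity) e2
      nlinarith

lemma exists_CV {U p : ℝ → ℝ} {u v w : ℝ → ℝ → ℝ} (hP : PrandtlSolution U p u v)
    (hV : ∀ x ∈ Ici (0 : ℝ), ∀ y ∈ Ici (0 : ℝ), w x (∫ z in (0 : ℝ)..y, u x z) = (u x y) ^ 2)
    {X α m M C₀ δ₁ : ℝ} (H : OleinikSolution X p w α m M C₀ δ₁) :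
    ∃ e > 0, ∃ P, CV X δ₁ α m M C₀ p (fun z => w z.1 z.2) e (m / 4) (M / 4) P (fun z => u z.1 z.2) := by
  have V := VM.of_ole H
  have hm := V.hm
  have hM : 0 < M := hm.trans V.hM
  have hd := V.hd
  have hcu : ∀ x ∈ Ici (0 : ℝ), ContinuousOn (u x) (Ici 0) := fun x hx =>
    hP.cont_u.comp (f := fun t => (x, t)) (by fun_prop) fun t ht => ⟨hx, ht⟩
  obtain ⟨B, hB⟩ := (isCompact_Icc (a := (0 : ℝ)) (b := X)).prod (isCompact_Icc (a := (0 : ℝ)) (b := 1))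
    |>.exists_bound_of_continuousOn (hP.cont_u.mono (prod_mono (fun t ht => ht.1) (fun t ht => ht.1)))
  obtain ⟨e, he⟩ : ∃ e, e = min 1 (min (δ₁ / (|B| + 1)) (δ₁ / (M / 4))) := ⟨_, rfl⟩
  have he0 : 0 < e := by rw [he]; positivity
  have he1 : e ≤ 1 := he ▸ min_le_left _ _
  have he2 : e ≤ δ₁ / (|B| + 1) := he ▸ (min_le_right _ _).trans (min_le_left _ _)
  have he3 : e ≤ δ₁ / (M / 4) := he ▸ (min_le_right _ _).trans (min_le_right _ _)
  rw [le_div_iff₀ (by positivity)] at he2 he3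
  obtain ⟨P, hPd⟩ : ∃ P : ℝ × ℝ → ℝ, P = fun z => ∫ t in (0 : ℝ)..z.2, u z.1 t := ⟨_, rfl⟩
  have hx0 : ∀ z ∈ Om X e, z.1 ∈ Ici (0 : ℝ) := fun z hz => hz.1.1.le
  have hy0 : ∀ z ∈ Om X e, z.2 ∈ Ici (0 : ℝ) := fun z hz => hz.2.1.le
  have pf : ∀ z ∈ Om X e, _ := fun z hz => prim_facts hm hM (hcu z.1 (hx0 z hz))
    (fun t ht => hP.pos z.1 (hx0 z hz) t ht) hz.2.1
  have hmap : ∀ z ∈ Om X e, (z.1, P z) ∈ Om X δ₁ := by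
    intro z hz
    refine ⟨hz.1, by rw [hPd]; exact (pf z hz).2.1, ?_⟩
    have h1 : ‖∫ t in (0 : ℝ)..z.2, u z.1 t‖ ≤ |B| * |z.2 - 0| := by
      refine intervalIntegral.norm_integral_le_of_norm_le_const fun t ht => ?_
      rw [uIoc_of_le (hy0 z hz)] at ht
      exact (hB (z.1, t) ⟨⟨hz.1.1.le, hz.1.2.le⟩, ht.1.le, by linarith [ht.2, hz.2.2]⟩).trans (le_abs_self B)
    have h2 := hz.2.1
    have h3 := hz.2.2
    rw [sub_zero, abs_of_pos h2] at h1
    have h4 := (le_abs_self _).trans h1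
    rw [hPd]
    simp only
    nlinarith [abs_nonneg B]
  have hW : ∀ z ∈ Om X e, w z.1 (P z) = u z.1 z.2 ^ 2 := fun z hz => by
    rw [hPd]; exact hV z.1 (hx0 z hz) z.2 (hy0 z hz)
  have su : Sm X e (fun z => u z.1 z.2) := hP.smooth.mono fun z hz => ⟨hz.1.1, hz.2.1⟩
  have sP : Sm X e P := sm_of_implicit V.sm (fun z hz => hm.trans_le (V.slb z hz)) (su.mul su) hmap
    (fun z hz => by rw [← sq]; exact hW z hz)
  have bds : ∀ z ∈ Om X e, m / 4 * z.2 ^ 2 ≤ P z ∧ P z ≤ M / 4 * z.2 ^ 2 := by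
    intro z hz
    rw [hPd]
    refine (pf z hz).2.2 fun t ht => ?_
    have hzt : (z.1, t) ∈ Om X e := ⟨hz.1, ht.1, ht.2.trans hz.2.2⟩
    have h1 := V.lb _ (hmap _ hzt)
    have h2 := V.ub _ (hmap _ hzt)
    have h3 := hW _ hzt
    simp only [h3] at h1 h2
    rw [hPd] at h1 h2
    exact ⟨h1, h2⟩
  refine ⟨e, he0, P, V, he1, sP, hmap, ?_, ?_, by positivity, by positivity, fun z hz => (bds z hz).1,
    fun z hz => (bds z hz).2, ?_⟩
  · intro z hz
    refine Dy_eq (sP.da hz) ?_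
    rw [hPd]
    exact (pf z hz).1
  · intro z hz
    rw [hW z hz, Real.sqrt_sq (hP.pos z.1 (hx0 z hz) z.2 hz.2.1).le]
  · nlinarith

lemma lim_of_lip {f : ℝ → ℝ} {r C : ℝ} (hr : 0 < r) (hC : 0 ≤ C)
    (h : ∀ s ∈ Ioc 0 r, ∀ t ∈ Ioc 0 r, |f s - f t| ≤ C * |s - t|) : ∃ L, ∀ t ∈ Ioc 0 r, |f t - L| ≤ C * t := by
  have h1 : LipschitzOnWith ⟨C, hC⟩ f (Ioc 0 r) := LipschitzOnWith.of_dist_le_mul fun s hs t ht => by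
    rw [Real.dist_eq, Real.dist_eq]; exact h s hs t ht
  obtain ⟨g, hg, hfg⟩ := h1.extend_real
  refine ⟨g 0, fun t ht => ?_⟩
  have := hg.dist_le_mul t 0
  rw [Real.dist_eq, Real.dist_eq, sub_zero, abs_of_pos ht.1] at this
  rw [hfg ht]
  exact this

lemma deriv_alt {φ γ : ℝ → ℝ} {c x : ℝ} (h : ∀ᶠ s in nhds x, φ s = 0 ∨ φ s = γ s) (hγ : HasDerivAt γ c x) :
    deriv φ x = 0 ∨ deriv φ x = c := by
  by_cases hd : DifferentiableAt ℝ φ x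
  swap
  · exact Or.inl (deriv_zero_of_not_differentiableAt hd)
  have hD := hd.hasDerivAt
  have hct : Filter.Tendsto φ (nhdsWithin x {x}ᶜ) (nhds (φ x)) := hd.continuousAt.tendsto.mono_left nhdsWithin_le_nhds
  by_cases hf : ∃ᶠ s in nhdsWithin x {x}ᶜ, φ s = 0
  · left
    have h0 : φ x ∈ ({0} : Set ℝ) := isClosed_singleton.mem_of_frequently_of_tendsto hf hct
    have h0' : φ x = 0 := h0
    have h2 : ∃ᶠ s in nhdsWithin x {x}ᶜ, slope φ x s ∈ ({0} : Set ℝ) := hf.mono fun s hs => by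
      simp [slope, hs, h0']
    exact isClosed_singleton.mem_of_frequently_of_tendsto h2 (hasDerivAt_iff_tendsto_slope.1 hD)
  · right
    rw [Filter.not_frequently] at hf
    have h1 : ∀ᶠ s in nhdsWithin x {x}ᶜ, φ s = γ s := by
      filter_upwards [hf, h.filter_mono nhdsWithin_le_nhds] with s hs h'
      exact h'.resolve_left hs
    have hcg : Filter.Tendsto γ (nhdsWithin x {x}ᶜ) (nhds (γ x)) :=
      hγ.continuousAt.tendsto.mono_left nhdsWithin_le_nhds
    have hx : φ x = γ x := tendsto_nhds_unique (hct.congr' h1) hcg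
    have h2 : φ =ᶠ[nhds x] γ := by
      have := eventually_nhdsWithin_iff.1 h1
      filter_upwards [this] with s hs
      by_cases hsx : s = x
      · rw [hsx, hx]
      · exact hs hsx
    rw [h2.deriv_eq, hγ.deriv]

lemma iter_alt {f : ℝ → ℝ} {g : ℕ → ℝ → ℝ} {T : ℝ} (hg : ∀ j, ∀ x ∈ Ioo 0 T, HasDerivAt (g j) (g (j + 1) x) x)
    (h : ∀ x ∈ Ioo 0 T, f x = 0 ∨ f x = g 0 x) (k : ℕ) :
    ∀ x ∈ Ioo 0 T, iteratedDeriv k f x = 0 ∨ iteratedDeriv k f x = g k x := by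
  induction k with
  | zero => simpa using h
  | succ k ih =>
    intro x hx
    rw [iteratedDeriv_succ]
    refine deriv_alt ?_ (hg k x hx)
    filter_upwards [isOpen_Ioo.mem_nhds hx] with s hs
    exact ih s hs

lemma bdry_alt {f : ℝ → ℝ} {m : ℕ} {L r : ℝ} (hr : 0 < r) (hd : ∀ y ∈ Ioo 0 r, DifferentiableAt ℝ (iteratedDeriv m f) y)
    (hL : Filter.Tendsto (iteratedDeriv (m + 1) f) (nhdsWithin 0 (Ioi 0)) (nhds L)) :
    iteratedDeriv (m + 1) f 0 = 0 ∨ iteratedDeriv (m + 1) f 0 = L := by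
  rw [iteratedDeriv_succ] at hL ⊢
  by_cases h0 : DifferentiableAt ℝ (iteratedDeriv m f) 0
  · right
    have h1 := hasDerivWithinAt_Ici_of_tendsto_deriv (s := Ioo 0 r) (a := 0) (f := iteratedDeriv m f) (e := L)
      (fun y hy => (hd y hy).differentiableWithinAt) h0.continuousAt.continuousWithinAt
      (Ioo_mem_nhdsGT hr) hL
    exact (uniqueDiffWithinAt_Ici 0).eq_deriv _ h0.hasDerivAt.hasDerivWithinAt h1
  · exact Or.inl (deriv_zero_of_not_differentiableAt h0)

lemma bdry_bound {T e : ℝ} {u : ℝ → ℝ → ℝ} (he : 0 < e) (su : Sm T e (fun z => u z.1 z.2))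
    (hB : ∀ j k, Bd T e 0 (Dx^[j] (Dy^[k] (fun z => u z.1 z.2)))) (k m : ℕ) {b c : ℝ} (hb : 0 < b) (hc : c < T) :
    ∃ C, ∀ x ∈ Icc b c, |pd k (m + 1) u x 0| ≤ C := by
  obtain ⟨A, hA⟩ : ∃ A : ℕ → ℝ × ℝ → ℝ, A = fun j => Dx^[j] (Dy^[m + 1] (fun z => u z.1 z.2)) := ⟨_, rfl⟩
  have sA : ∀ j, Sm T e (A j) := fun j => by rw [hA]; exact (su.dyn _).dxn j
  have hAx : ∀ j, Dx (A j) = A (j + 1) := fun j => by rw [hA]; exact (Function.iterate_succ_apply' _ _ _).symm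
  have bA : ∀ j, Bd T e 0 (A j) := fun j => by rw [hA]; exact hB j (m + 1)
  have bAy : ∀ j, Bd T e 0 (Dy (A j)) := fun j => by
    have := hB j (m + 2)
    rw [Function.iterate_succ_apply'] at this
    rw [hA]
    exact this.congr fun z hz => (Dxn_y (su.dyn (m + 1)) j hz).symm
  have hlim : ∀ j b c, 0 < b → c < T → ∃ C ≥ 0, ∀ x ∈ Icc b c, ∃ L, ∀ t ∈ Ioc 0 (e / 2), |A j (x, t) - L| ≤ C * t := by
    intro j b c hb hc
    obtain ⟨C, hC, hk⟩ := bAy j b c (e / 2) hb hc (by linarith) (by linarith)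
    simp only [Real.rpow_zero, mul_one] at hk
    refine ⟨C, hC, fun x hx => lim_of_lip (by linarith) hC fun s hs t ht => ?_⟩
    exact (convex_Ioc 0 (e / 2)).norm_image_sub_le_of_norm_hasDerivWithin_le (f := fun t => A j (x, t))
      (f' := fun t => Dy (A j) (x, t)) (fun t ht => (hasDy (z := (x, t)) ((sA j).da
        (Bx_sub hb hc (by linarith : e / 2 < e) ⟨hx, ht⟩))).hasDerivWithinAt)
      (fun t ht => hk (x, t) ⟨hx, ht⟩) ht hs
  have htd : ∀ {L C : ℝ} {f : ℝ → ℝ}, (∀ t ∈ Ioc 0 (e / 2), |f t - L| ≤ C * t) →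
      Filter.Tendsto f (nhdsWithin 0 (Ioi 0)) (nhds L) := by
    intro L C f h
    have h1 : Filter.Tendsto (fun t : ℝ => C * t) (nhdsWithin 0 (Ioi 0)) (nhds 0) := by
      have : Filter.Tendsto (fun t : ℝ => C * t) (nhds 0) (nhds (C * 0)) := (continuous_const.mul continuous_id).tendsto 0
      rw [mul_zero] at this
      exact this.mono_left nhdsWithin_le_nhds
    rw [tendsto_iff_norm_sub_tendsto_zero]
    refine squeeze_zero' (Filter.Eventually.of_forall fun t => norm_nonneg _) ?_ h1
    filter_upwards [Ioc_mem_nhdsGT (by linarith : 0 < e / 2)] with t ht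
    exact h t ht
  have hex : ∀ j x, ∃ L, x ∈ Ioo 0 T → Filter.Tendsto (fun t => A j (x, t)) (nhdsWithin 0 (Ioi 0)) (nhds L) := by
    intro j x
    by_cases hx : x ∈ Ioo 0 T
    · obtain ⟨C, hC, h⟩ := hlim j x x hx.1 hx.2
      obtain ⟨L, hL⟩ := h x ⟨le_rfl, le_rfl⟩
      exact ⟨L, fun _ => htd hL⟩
    · exact ⟨0, fun h => absurd h hx⟩
  choose g hg using hex
  have hder : ∀ j, ∀ x ∈ Ioo 0 T, HasDerivAt (g j) (g (j + 1) x) x := by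
    intro j x hx
    have hx1 := hx.1
    have hx2 := hx.2
    obtain ⟨C, hC, h⟩ := hlim (j + 1) (x / 2) ((x + T) / 2) (by linarith) (by linarith)
    have hsub : ∀ s ∈ Ioo (x / 2) ((x + T) / 2), s ∈ Ioo 0 T := fun s hs => ⟨by linarith [hs.1], by linarith [hs.2]⟩
    refine hasDerivAt_of_tendstoUniformlyOn (l := nhdsWithin 0 (Ioi 0)) (s := Ioo (x / 2) ((x + T) / 2))
      (f := fun t s => A j (s, t)) (f' := fun t s => A (j + 1) (s, t)) (g := g j) (g' := g (j + 1)) isOpen_Ioo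
      ?_ ?_ (fun s hs => hg j s (hsub s hs)) ⟨by linarith, by linarith⟩
    · rw [Metric.tendstoUniformlyOn_iff]
      intro ε hε
      have h3 : 0 < min (e / 2) (ε / (C + 1)) := by positivity
      filter_upwards [Ioo_mem_nhdsGT h3] with t ht s hs
      obtain ⟨L, hL⟩ := h s ⟨hs.1.le, hs.2.le⟩
      have hLg : L = g (j + 1) s := tendsto_nhds_unique (htd hL) (hg (j + 1) s (hsub s hs))
      have h4 := hL t ⟨ht.1, (ht.2.trans_le (min_le_left _ _)).le⟩
      have h5 := ht.2.trans_le (min_le_right _ _)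
      rw [lt_div_iff₀ (by positivity)] at h5
      rw [dist_comm, Real.dist_eq, ← hLg]
      nlinarith [ht.1]
    · filter_upwards [Ioo_mem_nhdsGT he] with t ht s hs
      have := hasDx (z := (s, t)) ((sA j).da ⟨hsub s hs, ht⟩)
      rw [hAx] at this
      exact this
  obtain ⟨C, hC, hk⟩ := bA k b c (e / 2) hb hc (by linarith) (by linarith)
  simp only [Real.rpow_zero, mul_one] at hk
  refine ⟨C, fun x hx => ?_⟩
  have hxT : x ∈ Ioo 0 T := ⟨hb.trans_le hx.1, hx.2.trans_lt hc⟩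
  have hgk : |g k x| ≤ C := by
    refine le_of_tendsto (hg k x hxT).abs ?_
    filter_upwards [Ioc_mem_nhdsGT (by linarith : 0 < e / 2)] with t ht
    exact hk (x, t) ⟨hx, ht⟩
  have halt : ∀ x ∈ Ioo 0 T, iteratedDeriv (m + 1) (u x) 0 = 0 ∨ iteratedDeriv (m + 1) (u x) 0 = g 0 x := by
    intro x hx
    have hev : ∀ n, ∀ t ∈ Ioo 0 e, iteratedDeriv n (u x) t = (Dy^[n] (fun z => u z.1 z.2)) (x, t) :=
      fun n t ht => itDy su n (x, t) ⟨hx, ht⟩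
    refine bdry_alt he (fun y hy => ?_) ?_
    · have := (hasDy (z := (x, y)) ((su.dyn m).da ⟨hx, hy⟩)).differentiableAt
      refine this.congr_of_eventuallyEq ?_
      filter_upwards [isOpen_Ioo.mem_nhds hy] with t ht
      exact hev m t ht
    · refine (hg 0 x hx).congr' ?_
      filter_upwards [Ioo_mem_nhdsGT he] with t ht
      rw [hev (m + 1) t ht, hA]
      rfl
  have := iter_alt (f := fun x => iteratedDeriv (m + 1) (u x) 0) hder halt k x hxT
  unfold pd
  rcases this with h | h
  · rw [h, abs_zero]; exact hC
  · rw [h]; exact hgk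

/-- Global `C^∞` regularity of Oleinik's solution of the steady Prandtl equation
with favorable pressure: if the Von Mises transform `w` of `u` is an Oleinik
solution on `[0,X]` for every `X > 0`, then for all positive integers `k, m` and
all `0 < ε < X`, `Y > 0` there is `C > 0` with `|∂ₓ^k ∂_y^m u| ≤ C` on
`[ε,X] × [0,Y]`. -/
theorem global_regularity_steady_prandtl
    (U p : ℝ → ℝ) (u v w : ℝ → ℝ → ℝ)
    (hP : PrandtlSolution U p u v)
    (hVonMises : ∀ x ∈ Set.Ici (0 : ℝ), ∀ y ∈ Set.Ici (0 : ℝ),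
      w x (∫ z in (0 : ℝ)..y, u x z) = (u x y) ^ 2)
    (hOle : ∀ X > (0 : ℝ), ∃ α m M C₀ δ₁ : ℝ, OleinikSolution X p w α m M C₀ δ₁)
    (k mm : ℕ) (hk : 1 ≤ k) (hmm : 1 ≤ mm)
    (ε X Y : ℝ) (hε : 0 < ε) (hεX : ε < X) (hY : 0 < Y) :
    ∃ C > 0, ∀ x ∈ Set.Icc ε X, ∀ y ∈ Set.Icc (0 : ℝ) Y,
      |pd k mm u x y| ≤ C := by
  have hX : 0 < X := hε.trans hεX
  obtain ⟨α, m, M, C₀, δ₁, H⟩ := hOle (X + 1) (by linarith)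
  obtain ⟨e, he, P, K⟩ := exists_CV hP hVonMises H
  have su := K.su
  have hB := K.final
  obtain ⟨C1, hC1, h1⟩ := hB k mm ε X (e / 2) hε (by linarith) (by linarith) (by linarith)
  simp only [Real.rpow_zero, mul_one] at h1
  have su2 : Sm (X + 1) (Y + 1) (fun z : ℝ × ℝ => u z.1 z.2) :=
    hP.smooth.mono (fun z hz => ⟨hz.1.1, hz.2.1⟩)
  have hct := ((su2.dyn mm).dxn k).ct
  have hsub : Icc ε X ×ˢ Icc (e / 2) Y ⊆ Om (X + 1) (Y + 1) := by
    intro z hz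
    have a1 := hz.1.1
    have a2 := hz.1.2
    have a3 := hz.2.1
    have a4 := hz.2.2
    exact ⟨⟨by linarith, by linarith⟩, ⟨by linarith, by linarith⟩⟩
  obtain ⟨C2, h2⟩ := (isCompact_Icc.prod isCompact_Icc).exists_bound_of_continuousOn (hct.mono hsub)
  obtain ⟨n, rfl⟩ : ∃ n, mm = n + 1 := ⟨mm - 1, by omega⟩
  obtain ⟨C3, h3⟩ := bdry_bound he su hB k n hε (by linarith : X < X + 1)
  refine ⟨|C1| + |C2| + |C3| + 1, by positivity, fun x hx y hy => ?_⟩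
  have b1 := le_abs_self C1
  have b2 := le_abs_self C2
  have b3 := le_abs_self C3
  have c1 := abs_nonneg C1
  have c2 := abs_nonneg C2
  have c3 := abs_nonneg C3
  rcases hy.1.eq_or_lt with h0 | h0
  · subst h0
    have := h3 x hx
    linarith
  · rcases le_total y (e / 2) with hye | hye
    · have hq := h1 (x, y) ⟨hx, h0, hye⟩
      have hz : (x, y) ∈ Om (X + 1) e :=
        ⟨⟨hε.trans_le hx.1, hx.2.trans_lt (by linarith)⟩, h0, by linarith⟩
      have hp := pd_eq su k (n + 1) (x, y) hz
      simp only at hp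
      rw [hp]
      linarith
    · have hq := h2 (x, y) ⟨hx, hye, hy.2⟩
      have hp := pd_eq su2 k (n + 1) (x, y) (hsub ⟨hx, hye, hy.2⟩)
      simp only at hp
      rw [hp]
      rw [Real.norm_eq_abs] at hq
      linarith
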